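/- Let (K,h,δ) be a marked strongly invertible knot, with quotient projection π: S³ → S³/h, O = π(Fix(h)), k = π(K), δ̌ = π(δ), Ǩ = k ∪ δ̌ and δ̌ᶜ = cl(O∖δ̌). If Š is a spanning surface for the knot Ǩ in S³/h which is disjoint from the interior of δ̌ᶜ and satisfies Condition (C) (every loop γ in int Š is orientation-preserving or orientation-reversing in Š according to whether lk(γ,O) is even or odd), then the inverse image π⁻¹(Š) is an invariant Seifert surface for (K,h,δ). -/

import Mathlib

open Set Function Metric Topology Manifold
open scoped Manifold

noncomputable section

/-! ### Basic spaces: the 3-sphere and the circle -/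

/-- Euclidean 4-space. -/
abbrev E4 : Type := EuclideanSpace ℝ (Fin 4)
/-- Euclidean 2-space. -/
abbrev E2 : Type := EuclideanSpace ℝ (Fin 2)
/-- Euclidean 3-space. -/
abbrev E3 : Type := EuclideanSpace ℝ (Fin 3)

/-- The 3-sphere `S³`, realized as the unit sphere in `ℝ⁴`. -/
abbrev S3 : Type := Metric.sphere (0 : E4) 1
/-- The circle `S¹`, realized as the unit sphere in `ℝ²`. -/
abbrev Circle1 : Type := Metric.sphere (0 : E2) 1

/-- A subset of `S³` which is a topological circle (simple loop). -/
def IsCircleSet (A : Set S3) : Prop := Nonempty (A ≃ₜ Circle1)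

/-- A subset of `S³` which is a topological arc. -/
def IsArcSet (A : Set S3) : Prop := Nonempty (A ≃ₜ (Set.Icc (0:ℝ) 1))

/-! ### Isotopies and orientation -/

/-- An (ambient) isotopy of `S³` starting at the identity. -/
def IsIsotopy (F : ℝ → S3 → S3) : Prop :=
  Continuous (fun p : ℝ × S3 => F p.1 p.2) ∧ (∀ t, IsHomeomorph (F t)) ∧ F 0 = id

/-- A self-map of `S³` is orientation preserving iff it is (a homeomorphism)
isotopic to the identity; for `S³` this is equivalent to the usual notion. -/
def OrientationPreserving (φ : S3 → S3) : Prop := ∃ F, IsIsotopy F ∧ F 1 = φ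

/-- An isotopy of the circle. -/
def CircleIsotopy (F : ℝ → Circle1 → Circle1) : Prop :=
  Continuous (fun p : ℝ × Circle1 => F p.1 p.2) ∧ (∀ t, IsHomeomorph (F t)) ∧ F 0 = id

/-- A self-map of the circle is orientation preserving iff it is isotopic to the identity. -/
def CircleOrientationPreserving (g : Circle1 → Circle1) : Prop :=
  ∃ F, CircleIsotopy F ∧ F 1 = g

/-- A diffeomorphism of `S³` (a smooth map with a smooth inverse). -/
def IsDiffeo (φ : S3 → S3) : Prop :=
  ∃ ψ : S3 → S3, ContMDiff (𝓡 3) (𝓡 3) (⊤ : ℕ∞) φ ∧ ContMDiff (𝓡 3) (𝓡 3) (⊤ : ℕ∞) ψ ∧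
    ψ ∘ φ = id ∧ φ ∘ ψ = id

/-! ### Knots -/

/-- A (smooth) knot in `S³`: the image of a smooth embedding of the circle. -/
def IsKnot (K : Set S3) : Prop :=
  ∃ γ : Circle1 → S3, ContMDiff (𝓡 1) (𝓡 3) (⊤ : ℕ∞) γ ∧ IsEmbedding γ ∧ Set.range γ = K

/-! ### Surfaces with boundary in `S³` -/

/-- The closed half plane, model for boundary points of a surface. -/
def halfPlane : Set (ℝ × ℝ) := {p | 0 ≤ p.1}

/-- `x` is a 2-manifold interior point of `S ⊆ S³`. -/
def IsInteriorPointOf (S : Set S3) (x : S3) : Prop :=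
  ∃ U : Set S3, IsOpen U ∧ x ∈ U ∧ Nonempty ((U ∩ S : Set S3) ≃ₜ (ℝ × ℝ))

/-- `x` is a 2-manifold boundary point of `S ⊆ S³`: some relative neighbourhood of `x`
in `S` is homeomorphic to the closed half plane, with `x` going to the boundary line. -/
def IsBoundaryPointOf (S : Set S3) (x : S3) : Prop :=
  ∃ (U : Set S3) (_ : IsOpen U) (hx : x ∈ U ∩ S) (φ : (U ∩ S : Set S3) ≃ₜ halfPlane),
    ((φ ⟨x, hx⟩ : halfPlane) : ℝ × ℝ).1 = 0

/-- `S` is a compact connected 2-manifold in `S³` with (manifold) boundary the set `B`. -/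
def IsSurfaceWithBoundary (S B : Set S3) : Prop :=
  IsCompact S ∧ IsConnected S ∧ B ⊆ S ∧
  (∀ x ∈ S \ B, IsInteriorPointOf S x) ∧
  (∀ x ∈ B, IsBoundaryPointOf S x)

/-- The relation generating the Möbius band as a quotient of `ℝ × [-1,1]`. -/
def mobiusRel : (ℝ × (Set.Icc (-1:ℝ) 1)) → (ℝ × (Set.Icc (-1:ℝ) 1)) → Prop :=
  fun a b => b.1 = a.1 + 1 ∧ (b.2 : ℝ) = -(a.2 : ℝ)

/-- The Möbius band. -/
def MobiusBand : Type := Quot mobiusRel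

instance : TopologicalSpace MobiusBand := by unfold MobiusBand; infer_instance

/-- A surface in `S³` is orientable iff it contains no Möbius band. -/
def Orientable (S : Set S3) : Prop :=
  ¬ ∃ M : Set S3, M ⊆ S ∧ Nonempty (M ≃ₜ MobiusBand)

/-- `S` has first Betti number `b`: its fundamental group is free of rank `b`
(a correct characterization for compact connected surfaces with nonempty boundary). -/
def HasBetti1 (S : Set S3) (b : ℕ) : Prop :=
  ∃ x : S, Nonempty (FundamentalGroup S x ≃* FreeGroup (Fin b))

/-- The first Betti number of `S`. -/
def betti1 (S : Set S3) : ℕ := sInf {b | HasBetti1 S b}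

/-- A compact connected orientable surface with one boundary circle has genus `g`
iff its first Betti number is `2g`. -/
def HasGenus (S : Set S3) (g : ℕ) : Prop := HasBetti1 S (2 * g)

/-- The genus of a surface. -/
def genusOf (S : Set S3) : ℕ := sInf {g | HasGenus S g}

/-! ### Seifert surfaces and genus -/

/-- A Seifert surface for a knot `K`: a compact connected orientable surface
embedded in `S³` with boundary `K`. -/
def IsSeifertSurface (K S : Set S3) : Prop :=
  IsSurfaceWithBoundary S K ∧ Orientable S

/-- The genus `g(K)` of a knot: the minimal genus of its Seifert surfaces. -/
def knotGenus (K : Set S3) : ℕ := sInf {g | ∃ S, IsSeifertSurface K S ∧ HasGenus S g}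

/-- A minimal genus Seifert surface. -/
def IsMinimalSeifertSurface (K S : Set S3) : Prop :=
  IsSeifertSurface K S ∧ HasGenus S (knotGenus K)

/-! ### Strongly invertible knots -/

/-- A strong inversion of the knot `K`: a smooth involution of `S³` leaving `K`
invariant whose fixed point set is a simple loop meeting `K` in two points. -/
structure StrongInversion (K : Set S3) where
  toFun : S3 → S3
  smooth : ContMDiff (𝓡 3) (𝓡 3) (⊤ : ℕ∞) toFun
  involutive : Function.Involutive toFun
  invariant : toFun '' K = K
  fixCircle : IsCircleSet (Function.fixedPoints toFun)
  fixMeetsK : (Function.fixedPoints toFun ∩ K).ncard = 2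

/-- A strongly invertible knot `(K, h)`. -/
structure SIKnot where
  K : Set S3
  isKnot : IsKnot K
  h : S3 → S3
  smooth : ContMDiff (𝓡 3) (𝓡 3) (⊤ : ℕ∞) h
  involutive : Function.Involutive h
  invariant : h '' K = K
  fixCircle : IsCircleSet (Function.fixedPoints h)
  fixMeetsK : (Function.fixedPoints h ∩ K).ncard = 2

/-- The endpoints of an arc `A`: the non-cut points of `A`. -/
def arcEndpoints (A : Set S3) : Set S3 := {x ∈ A | IsPreconnected (A \ {x})}

/-- The interior of an arc. -/
def arcInterior (A : Set S3) : Set S3 := A \ arcEndpoints A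

/-- `δ` is one of the two subarcs of `Fix(h)` bounded by the two points of `Fix(h) ∩ K`. -/
def IsMarking (K : Set S3) (h : S3 → S3) (δ : Set S3) : Prop :=
  δ ⊆ Function.fixedPoints h ∧ IsArcSet δ ∧ arcEndpoints δ = Function.fixedPoints h ∩ K

/-- A marked strongly invertible knot `(K, h, δ)`. -/
structure MarkedSIK where
  K : Set S3
  isKnot : IsKnot K
  h : S3 → S3
  smooth : ContMDiff (𝓡 3) (𝓡 3) (⊤ : ℕ∞) h
  involutive : Function.Involutive h
  invariant : h '' K = K
  fixCircle : IsCircleSet (Function.fixedPoints h)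
  fixMeetsK : (Function.fixedPoints h ∩ K).ncard = 2
  δ : Set S3
  marking : IsMarking K h δ

/-- An invariant Seifert surface for a marked strongly invertible knot `(K,h,δ)`:
a Seifert surface `S` for `K` with `h(S) = S` and `Fix(h) ∩ S = δ`. -/
def IsInvariantSeifertSurface (K : Set S3) (h : S3 → S3) (δ S : Set S3) : Prop :=
  IsSeifertSurface K S ∧ h '' S = S ∧ Function.fixedPoints h ∩ S = δ

/-- The equivariant genus `g(K,h,δ)`. -/
def equivGenus (K : Set S3) (h : S3 → S3) (δ : Set S3) : ℕ :=
  sInf {g | ∃ S, IsInvariantSeifertSurface K h δ S ∧ HasGenus S g}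

/-! ### Equivalence of inversions and marked knots -/

/-- Two strong inversions are equivalent iff they are conjugate by an
orientation-preserving diffeomorphism of `S³`. -/
def InversionEquiv (h h' : S3 → S3) : Prop :=
  ∃ φ : S3 → S3, IsDiffeo φ ∧ OrientationPreserving φ ∧ ∀ x, h' (φ x) = φ (h x)

/-- Equivalence of marked strongly invertible knots. -/
def MarkedEquiv (M M' : MarkedSIK) : Prop :=
  ∃ φ : S3 → S3, IsDiffeo φ ∧ OrientationPreserving φ ∧
    φ '' M.K = M'.K ∧ (∀ x, M'.h (φ x) = φ (M.h x)) ∧ φ '' M.δ = M'.δ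

/-- Isotopy of (Seifert) surfaces: ambient isotopy of `S³` preserving `K` throughout. -/
def SurfIsotopic (K S S' : Set S3) : Prop :=
  ∃ F : ℝ → S3 → S3, IsIsotopy F ∧ (∀ t, F t '' K = K) ∧ F 1 '' S = S'

/-! ### Special knots -/

/-- The unknot: a knot bounding an embedded disk. -/
def IsUnknot (K : Set S3) : Prop :=
  IsKnot K ∧ ∃ D : Set S3, IsSurfaceWithBoundary D K ∧
    Nonempty (D ≃ₜ (Metric.closedBall (0:E2) 1))

/-- The standard `(p,q)` torus knot on the Clifford torus in `S³`. -/
def stdTorusKnot (p q : ℤ) : Set S3 :=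
  {x | ∃ θ : ℝ, ∀ i : Fin 4,
    (x : E4) i = (Real.sqrt 2)⁻¹ *
      ![Real.cos (p * θ), Real.sin (p * θ), Real.cos (q * θ), Real.sin (q * θ)] i}

/-- A torus knot: the image of a standard torus knot under a diffeomorphism of `S³`. -/
def IsTorusKnot (K : Set S3) : Prop :=
  ∃ p q : ℤ, ∃ φ : S3 → S3, IsDiffeo φ ∧ φ '' stdTorusKnot p q = K

/-- `f` maps `K` to itself preserving its orientation. -/
def PreservesKnotOrientation (f : S3 → S3) (K : Set S3) : Prop :=
  ∃ (γ : Circle1 → S3) (g : Circle1 → Circle1), IsEmbedding γ ∧ Set.range γ = K ∧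
    IsHomeomorph g ∧ (∀ t, f (γ t) = γ (g t)) ∧ CircleOrientationPreserving g

/-- `f` maps `K` to itself reversing its orientation. -/
def ReversesKnotOrientation (f : S3 → S3) (K : Set S3) : Prop :=
  ∃ (γ : Circle1 → S3) (g : Circle1 → Circle1), IsEmbedding γ ∧ Set.range γ = K ∧
    IsHomeomorph g ∧ (∀ t, f (γ t) = γ (g t)) ∧ ¬ CircleOrientationPreserving g

/-- An invertible knot: some orientation-preserving diffeomorphism of `S³` maps `K`
to itself reversing its orientation. -/
def IsInvertibleKnot (K : Set S3) : Prop :=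
  ∃ φ : S3 → S3, IsDiffeo φ ∧ OrientationPreserving φ ∧ φ '' K = K ∧
    ReversesKnotOrientation φ K

/-! ### Hyperbolicity -/

/-- Inverse hyperbolic cosine. -/
def arcosh (x : ℝ) : ℝ := Real.log (x + Real.sqrt (x ^ 2 - 1))

/-- The upper half space model of hyperbolic 3-space. -/
abbrev H3 : Type := {p : E3 // 0 < p 2}

/-- The hyperbolic distance on the upper half space. -/
def hypDist (p q : H3) : ℝ :=
  arcosh (1 + (dist (p : E3) (q : E3)) ^ 2 / (2 * (p : E3) 2 * (q : E3) 2))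

/-- A knot is hyperbolic iff its complement carries a complete metric, compatible with
its topology, which is locally isometric to hyperbolic 3-space. -/
def IsHyperbolicKnot (K : Set S3) : Prop :=
  ∃ d : ↥(Kᶜ) → ↥(Kᶜ) → ℝ,
    (∀ x y, d x y = d y x) ∧
    (∀ x y, d x y = 0 ↔ x = y) ∧
    (∀ x y z, d x z ≤ d x y + d y z) ∧
    (∀ (x : ↥(Kᶜ)) (U : Set ↥(Kᶜ)), U ∈ nhds x ↔ ∃ ε > 0, {y | d x y < ε} ⊆ U) ∧
    (∀ u : ℕ → ↥(Kᶜ), (∀ ε > 0, ∃ N, ∀ m n, N ≤ m → N ≤ n → d (u m) (u n) < ε) →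
      ∃ x, Filter.Tendsto u Filter.atTop (nhds x)) ∧
    (∀ x : ↥(Kᶜ), ∃ ε > 0, ∃ φ : ↥(Kᶜ) → H3,
      (∀ y z : ↥(Kᶜ), d x y < ε → d x z < ε → hypDist (φ y) (φ z) = d y z) ∧
      (∃ r > 0, {w : H3 | hypDist (φ x) w < r} ⊆ φ '' {y | d x y < ε}))

/-! ### Periods -/

/-- `K` has cyclic period 2. -/
def HasCyclicPeriod2 (K : Set S3) : Prop :=
  ∃ f : S3 → S3, ContMDiff (𝓡 3) (𝓡 3) (⊤ : ℕ∞) f ∧ Function.Involutive f ∧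
    OrientationPreserving f ∧ f '' K = K ∧ PreservesKnotOrientation f K ∧
    IsCircleSet (Function.fixedPoints f)

/-- `K` has free period 2. -/
def HasFreePeriod2 (K : Set S3) : Prop :=
  ∃ f : S3 → S3, ContMDiff (𝓡 3) (𝓡 3) (⊤ : ℕ∞) f ∧ Function.Involutive f ∧
    OrientationPreserving f ∧ f '' K = K ∧ PreservesKnotOrientation f K ∧
    Function.fixedPoints f = ∅

/-- `K` admits exactly one strong inversion up to equivalence. -/
def ExactlyOneInversion (K : Set S3) : Prop :=
  ∃ h1 : StrongInversion K, ∀ h2 : StrongInversion K, InversionEquiv h2.toFun h1.toFun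

/-- `K` admits exactly two strong inversions up to equivalence. -/
def ExactlyTwoInversions (K : Set S3) : Prop :=
  ∃ h1 h2 : StrongInversion K, ¬ InversionEquiv h1.toFun h2.toFun ∧
    ∀ h3 : StrongInversion K, InversionEquiv h3.toFun h1.toFun ∨ InversionEquiv h3.toFun h2.toFun

/-! ### Bridge number -/

/-- The height function on `S³`. -/
def heightFn : S3 → ℝ := fun x => (x : E4) 3

/-- A 2-bridge knot: after a diffeomorphism of `S³`, the standard height function
restricted to the knot has exactly two local maxima and two local minima. -/
def Is2Bridge (K : Set S3) : Prop :=
  ∃ φ : S3 → S3, IsDiffeo φ ∧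
    {x : S3 | x ∈ φ '' K ∧ IsLocalMaxOn heightFn (φ '' K) x}.ncard = 2 ∧
    {x : S3 | x ∈ φ '' K ∧ IsLocalMinOn heightFn (φ '' K) x}.ncard = 2

/-! ### Fibered knots -/

/-- `p` exhibits the complement of `K` as a fiber bundle over the circle whose fibers
(together with `K`) are minimal genus Seifert surfaces for `K`. -/
def IsFibration (K : Set S3) (p : ↥(Kᶜ) → Circle1) : Prop :=
  Continuous p ∧ Function.Surjective p ∧
  (∀ c : Circle1, ∃ U : Set Circle1, IsOpen U ∧ c ∈ U ∧
    ∃ φ : ↥(p ⁻¹' U) ≃ₜ U × ↥(p ⁻¹' {c}), ∀ y : ↥(p ⁻¹' U), ((φ y).1 : Circle1) = p y.val) ∧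
  (∀ c : Circle1, IsMinimalSeifertSurface K (closure (Subtype.val '' (p ⁻¹' {c}))))

/-- A fibered knot. -/
def IsFiberedKnot (K : Set S3) : Prop := ∃ p, IsFibration K p

/-- A fiber surface for `K`: the closure of a fiber of a fibration of the complement. -/
def IsFiberSurface (K S : Set S3) : Prop :=
  ∃ p, IsFibration K p ∧ ∃ c : Circle1, S = closure (Subtype.val '' (p ⁻¹' {c}))

/-! ### The quotient under a strong inversion -/

/-- `π : S³ → S³/h ≅ S³` realizes the quotient of `S³` by the involution `h`. -/
def IsQuotProj (h : S3 → S3) (π : S3 → S3) : Prop :=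
  Continuous π ∧ Function.Surjective π ∧ ∀ x y, π x = π y ↔ (y = x ∨ y = h x)

/-- `γ` (a loop disjoint from `O`) has even mod 2 linking number with `O`: it lifts
to any connected double cover of the complement of `O`, i.e. has disconnected preimage. -/
def EvenLinking (O γ : Set S3) : Prop :=
  γ ⊆ Oᶜ ∧
  ∀ (Y : Type) [_i : TopologicalSpace Y] (p : Y → ↥(Oᶜ)),
    IsCoveringMap p → ConnectedSpace Y → (∀ x : ↥(Oᶜ), (p ⁻¹' {x}).ncard = 2) →
    ¬ IsPreconnected (p ⁻¹' {y : ↥(Oᶜ) | (y : S3) ∈ γ})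

/-- `γ` has odd mod 2 linking number with `O`: its preimage in any connected double
cover of the complement of `O` is connected. -/
def OddLinking (O γ : Set S3) : Prop :=
  γ ⊆ Oᶜ ∧
  ∀ (Y : Type) [_i : TopologicalSpace Y] (p : Y → ↥(Oᶜ)),
    IsCoveringMap p → ConnectedSpace Y → (∀ x : ↥(Oᶜ), (p ⁻¹' {x}).ncard = 2) →
    IsPreconnected (p ⁻¹' {y : ↥(Oᶜ) | (y : S3) ∈ γ})

/-- The loop `γ` has an annulus neighbourhood in the surface `S`
(i.e. it is orientation-preserving in `S`). -/
def HasAnnulusNbhd (S γ : Set S3) : Prop :=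
  ∃ N : Set S3, γ ⊆ N ∧ N ⊆ S ∧ (∀ x ∈ γ, N ∈ nhdsWithin x S) ∧
    Nonempty (N ≃ₜ (Circle1 × (Set.Icc (-1:ℝ) 1)))

/-- The loop `γ` has a Möbius band neighbourhood in the surface `S`
(i.e. it is orientation-reversing in `S`). -/
def HasMobiusNbhd (S γ : Set S3) : Prop :=
  ∃ N : Set S3, γ ⊆ N ∧ N ⊆ S ∧ (∀ x ∈ γ, N ∈ nhdsWithin x S) ∧
    Nonempty (N ≃ₜ MobiusBand)

/-- Condition (C): every (embedded) loop in the interior of the surface `Sq` (with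
boundary `bd`) is orientation-preserving or -reversing in `Sq` according to whether its
linking number with `O` is even or odd. -/
def ConditionC (O Sq bd : Set S3) : Prop :=
  ∀ γ : Set S3, γ ⊆ Sq \ bd → IsCircleSet γ →
    (EvenLinking O γ → HasAnnulusNbhd Sq γ) ∧ (OddLinking O γ → HasMobiusNbhd Sq γ)

/-- The band number of a knot `L`: the minimum first Betti number of all
(not necessarily orientable) spanning surfaces for `L`. -/
def bandNumber (L : Set S3) : ℕ :=
  sInf {b | ∃ G : Set S3, IsSurfaceWithBoundary G L ∧ HasBetti1 G b}

/-! ### Two-bridge knots via continued fractions (Schubert presentations) -/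

/-- The value of the continued fraction `[a₁,…,aₘ] = 1/(a₁ - 1/(a₂ - ⋯))`. -/
def cfValQ : List ℤ → ℚ
  | [] => 0
  | a :: t => (a - cfValQ t)⁻¹

/-- The continued fraction `[2,4,2,4,…,2,4]` of length `2n`. -/
def cf24 (n : ℕ) : List ℤ := (List.replicate n [(2:ℤ), 4]).flatten

/-- The Schubert relator word `w = b^{ε₁} a^{ε₂} b^{ε₃} ⋯` with
`εᵢ = (-1)^{⌊iq/p⌋}` for the two-bridge knot `b(p,q)`. -/
def tbWord (p q : ℕ) : FreeGroup (Fin 2) :=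
  ((List.range (p - 1)).map (fun i =>
    (FreeGroup.of (if (i + 1) % 2 = 1 then (1 : Fin 2) else 0)) ^
      ((-1 : ℤ) ^ (((i + 1) * q) / p)))).prod

/-- The relation set of the Schubert presentation `⟨a,b | a w = w b⟩` of the
two-bridge knot group of `b(p,q)`. -/
def twoBridgeRel (p q : ℕ) : Set (FreeGroup (Fin 2)) :=
  { FreeGroup.of 0 * tbWord p q * (FreeGroup.of 1)⁻¹ * (tbWord p q)⁻¹ }

/-- The two-bridge knot group of `b(p,q)`. -/
def TwoBridgeGroup (p q : ℕ) : Type := PresentedGroup (twoBridgeRel p q)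

instance (p q : ℕ) : Group (TwoBridgeGroup p q) := by unfold TwoBridgeGroup; infer_instance

/-- The knot group (fundamental group of the complement) of `K` is isomorphic to `G`. -/
def HasKnotGroup (K : Set S3) (G : Type) [Group G] : Prop :=
  ∃ x : ↥(Kᶜ), Nonempty (FundamentalGroup ↥(Kᶜ) x ≃* G)

/-- `K` is the 2-bridge knot whose slope has the continued fraction expansion
`[2,4,2,4,…,2,4]` of length `2n`: it is a 2-bridge knot whose knot group is the
corresponding two-bridge knot group. -/
def IsCF24TwoBridgeKnot (n : ℕ) (K : Set S3) : Prop :=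
  IsKnot K ∧ Is2Bridge K ∧
  HasKnotGroup K (TwoBridgeGroup (cfValQ (cf24 n)).den (cfValQ (cf24 n)).num.toNat)

/-! ### Exteriors, longitudes, metrics and area (for the minimal surface argument) -/

/-- `A` is isotopic to `B` through embeddings whose images stay in `X`. -/
def IsotopicWithin (A B X : Set S3) : Prop :=
  ∃ H : ℝ → ↥A → S3, Continuous (fun p : ℝ × ↥A => H p.1 p.2) ∧
    (∀ t, IsEmbedding (H t) ∧ Set.range (H t) ⊆ X) ∧
    (H 0 = Subtype.val) ∧ Set.range (H 1) = B

/-- `N` is a (closed) tubular neighbourhood of the knot `K`. -/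
def IsTubularNbhd (K N : Set S3) : Prop :=
  IsCompact N ∧ K ⊆ interior N ∧
  Nonempty (N ≃ₜ (Circle1 × (Metric.closedBall (0:E2) 1)))

/-- `ℓ` is a preferred longitude on the boundary of the tubular neighbourhood `N` of `K`:
a circle in `∂N`, isotopic to `K` within `N`, having linking number `0` with `K`
(equivalently, bounding an orientable surface disjoint from `K`). -/
def IsPreferredLongitude (K N ℓ : Set S3) : Prop :=
  ℓ ⊆ frontier N ∧ IsCircleSet ℓ ∧ IsotopicWithin ℓ K N ∧
  ∃ W : Set S3, IsSurfaceWithBoundary W ℓ ∧ Orientable W ∧ W ∩ K = ∅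

/-- The distance function of a bundled metric space structure. -/
def mdist {X : Type} (m : MetricSpace X) (x y : X) : ℝ :=
  @dist X (m.toPseudoMetricSpace.toDist) x y

/-- The 2-dimensional Hausdorff measure ("area") of a subset, with respect to a
bundled metric space structure. -/
def mArea {X : Type} (m : MetricSpace X) (A : Set X) : ENNReal := by
  letI := m
  letI : MeasurableSpace X := borel X
  letI : BorelSpace X := ⟨rfl⟩
  exact MeasureTheory.Measure.hausdorffMeasure 2 A

/-! ### Lifting through covering maps -/

/-- Maps from contractible spaces lift through surjective covering maps. -/
theorem exists_lift_of_contractible {A E X : Type*} [TopologicalSpace A] [TopologicalSpace E]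
    [TopologicalSpace X] [ContractibleSpace A] {p : E → X} (cov : IsCoveringMap p)
    (hp : Surjective p) (f : C(A, X)) : ∃ F : C(A, E), ∀ a, p (F a) = f a := by
  obtain ⟨a₀, ⟨H⟩⟩ := id_nullhomotopic A
  obtain ⟨e, he⟩ := hp (f a₀)
  let G : C(unitInterval × A, X) := f.comp H.symm.toContinuousMap
  have hG : ∀ a, G (0, a) = p (ContinuousMap.const A e a) := by
    intro a
    simp [G, he]
  let L := cov.liftHomotopy G (ContinuousMap.const A e) hG
  refine ⟨L.comp ((ContinuousMap.const A 1).prodMk (ContinuousMap.id A)), fun a => ?_⟩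
  have := congr_fun (cov.liftHomotopy_lifts G (ContinuousMap.const A e) hG) (1, a)
  simp only [comp_apply] at this
  change p (L (1, a)) = _
  rw [this]
  simp [G]

/-- Nonvanishing continuous functions on convex sets have continuous logarithms. -/
theorem exists_log_of_convex {E : Type*} [NormedAddCommGroup E] [NormedSpace ℝ E] {C : Set E}
    (hC : Convex ℝ C) (hne : C.Nonempty) {K : E → ℂ} (hK : ContinuousOn K C)
    (h0 : ∀ x ∈ C, K x ≠ 0) :
    ∃ Λ : E → ℂ, ContinuousOn Λ C ∧ ∀ x ∈ C, Complex.exp (Λ x) = K x := by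
  classical
  have := hC.contractibleSpace hne
  let f : C(C, {z : ℂ // z ≠ 0}) :=
    ⟨fun x => ⟨K x, h0 x x.2⟩, (continuousOn_iff_continuous_domRestrict.1 hK).subtype_mk _⟩
  obtain ⟨F, hF⟩ := exists_lift_of_contractible Complex.isCoveringMap_exp
    (fun z => ⟨Complex.log z, Subtype.ext (Complex.exp_log z.2)⟩) f
  refine ⟨fun x => if h : x ∈ C then F ⟨x, h⟩ else 0, ?_, ?_⟩
  · rw [continuousOn_iff_continuous_domRestrict]
    convert! F.continuous using 1
    ext x
    simp
  · intro x hx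
    have := congrArg Subtype.val (hF ⟨x, hx⟩)
    simp only [hx, dite_true]
    exact this

theorem eq_of_exp_eq_one {X : Type*} [TopologicalSpace X] {S : Set X} (hS : IsPreconnected S)
    {u : X → ℂ} (hu : ContinuousOn u S) (h1 : ∀ x ∈ S, Complex.exp (u x) = 1)
    {x y : X} (hx : x ∈ S) (hy : y ∈ S) : u x = u y := by
  have key : ∀ x ∈ S, ∃ n : ℤ, u x = n * (2 * Real.pi * Complex.I) := fun x hx =>
    Complex.exp_eq_one_iff.1 (h1 x hx)
  have hd : DiscreteTopology (range ((↑) : ℤ → ℝ)) :=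
    Int.isClosedEmbedding_coe_real.isEmbedding.toHomeomorph.symm.isEmbedding.discreteTopology
  have hpi := Real.pi_ne_zero
  have him : ∀ (n : ℤ), ((n : ℂ) * (2 * Real.pi * Complex.I)).im / (2 * Real.pi) = n := by
    intro n
    simp
  have hc : ContinuousOn (fun x => (u x).im / (2 * Real.pi)) S :=
    (Complex.continuous_im.comp_continuousOn hu).div_const _
  have hm : MapsTo (fun x => (u x).im / (2 * Real.pi)) S (range ((↑) : ℤ → ℝ)) := by
    intro x hx
    obtain ⟨n, hn⟩ := key x hx
    exact ⟨n, by simp only [hn, him]⟩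
  have := hS.constant_of_mapsTo ⟨hd⟩ hc hm hx hy
  obtain ⟨n, hn⟩ := key x hx
  obtain ⟨m, hmm⟩ := key y hy
  simp only [hn, hmm, him, Int.cast_inj] at this
  rw [hn, hmm, this]

/-! ### The local degree of planar maps -/

/-- `f` winds `n` times around `f z` along small circles around `z`. -/
def HasDeg (f : ℂ → ℂ) (z : ℂ) (n : ℤ) : Prop :=
  ∃ (R : ℝ) (Λ : ℂ → ℂ), ContinuousOn Λ {ζ | ζ.re < R} ∧ ∀ ζ : ℂ, ζ.re < R →
    Complex.exp (Λ ζ) = f (z + Complex.exp ζ) - f z ∧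
    Λ (ζ + 2 * Real.pi * Complex.I) = Λ ζ + n * (2 * Real.pi * Complex.I)

/-- `f` is continuous and injective near `z`. -/
def GoodAt {T : Type*} [TopologicalSpace T] (f : ℂ → T) (z : ℂ) : Prop :=
  ∃ r > 0, ContinuousOn f (ball z r) ∧ InjOn f (ball z r)

theorem convex_re_lt (R : ℝ) : Convex ℝ {ζ : ℂ | ζ.re < R} := convex_halfSpace_re_lt R

theorem nonempty_re_lt (R : ℝ) : {ζ : ℂ | ζ.re < R}.Nonempty := ⟨((R - 1 : ℝ) : ℂ), by simp⟩

theorem re_add_two_pi_I (ζ : ℂ) : (ζ + 2 * Real.pi * Complex.I).re = ζ.re := by simp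

theorem norm_exp_lt {ζ : ℂ} {r : ℝ} (hr : 0 < r) (h : ζ.re < Real.log r) :
    ‖Complex.exp ζ‖ < r := by
  rw [Complex.norm_exp]
  exact (Real.lt_log_iff_exp_lt hr).1 h

theorem HasDeg.unique {f : ℂ → ℂ} {z : ℂ} {n m : ℤ} (h : HasDeg f z n) (h' : HasDeg f z m) :
    n = m := by
  obtain ⟨R, Λ, hc, hΛ⟩ := h
  obtain ⟨R', Λ', hc', hΛ'⟩ := h'
  have hS : IsPreconnected {ζ : ℂ | ζ.re < min R R'} := (convex_re_lt _).isPreconnected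
  obtain ⟨ζ, hζ⟩ := nonempty_re_lt (min R R')
  have hζ1 : ∀ {ζ : ℂ}, ζ ∈ {ζ : ℂ | ζ.re < min R R'} → ζ.re < R := fun h => lt_of_lt_of_le h (min_le_left _ _)
  have hζ2 : ∀ {ζ : ℂ}, ζ ∈ {ζ : ℂ | ζ.re < min R R'} → ζ.re < R' := fun h => lt_of_lt_of_le h (min_le_right _ _)
  have hd : ContinuousOn (fun ζ => Λ ζ - Λ' ζ) {ζ : ℂ | ζ.re < min R R'} :=
    (hc.mono fun _ h => hζ1 h).sub (hc'.mono fun _ h => hζ2 h)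
  have := eq_of_exp_eq_one hS hd (fun x hx => ?_) hζ
    (show ζ + 2 * Real.pi * Complex.I ∈ {ζ : ℂ | ζ.re < min R R'} by
      simpa only [mem_ofPred_eq, re_add_two_pi_I] using hζ)
  · simp only [(hΛ ζ (hζ1 hζ)).2, (hΛ' ζ (hζ2 hζ)).2] at this
    have h2 : ((n : ℂ) - m) * (2 * Real.pi * Complex.I) = 0 := by linear_combination -this
    have h3 := (mul_eq_zero.1 h2).resolve_right Complex.two_pi_I_ne_zero
    exact_mod_cast sub_eq_zero.1 h3
  · rw [Complex.exp_sub, (hΛ x (hζ1 hx)).1, (hΛ' x (hζ2 hx)).1, div_self]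
    rw [← (hΛ x (hζ1 hx)).1]
    exact Complex.exp_ne_zero _

theorem HasDeg.congr {f g : ℂ → ℂ} {z : ℂ} {n : ℤ} (h : HasDeg f z n) (hfg : f =ᶠ[𝓝 z] g) :
    HasDeg g z n := by
  obtain ⟨R, Λ, hc, hΛ⟩ := h
  obtain ⟨r, hr, hball⟩ := Metric.eventually_nhds_iff_ball.1 hfg
  refine ⟨min R (Real.log r), Λ, hc.mono fun ζ hζ =>
      lt_of_lt_of_le (show ζ.re < min R (Real.log r) from hζ) (min_le_left _ _),
    fun ζ hζ => ⟨?_, (hΛ ζ (lt_of_lt_of_le hζ (min_le_left _ _))).2⟩⟩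
  rw [(hΛ ζ (lt_of_lt_of_le hζ (min_le_left _ _))).1, hball z (mem_ball_self hr), hball]
  simpa [mem_ball, dist_eq_norm] using norm_exp_lt hr (lt_of_lt_of_le hζ (min_le_right _ _))

/-- The degree exists and is locally constant. -/
theorem GoodAt.exists_hasDeg {f : ℂ → ℂ} {z : ℂ} (h : GoodAt f z) :
    ∃ n, ∀ᶠ z' in 𝓝 z, HasDeg f z' n := by
  obtain ⟨r, hr, hc, hi⟩ := h
  have hr2 : 0 < r / 2 := by positivity
  let D : Set (ℂ × ℂ) := ball z (r / 2) ×ˢ {ζ : ℂ | ζ.re < Real.log (r / 2)}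
  have hDc : Convex ℝ D := (convex_ball _ _).prod (convex_re_lt _)
  have hmem : ∀ p ∈ D, p.1 + Complex.exp p.2 ∈ ball z r := by
    rintro ⟨a, b⟩ ⟨ha, hb⟩
    have h1 := norm_exp_lt hr2 hb
    simp only [mem_ball, dist_eq_norm] at ha ⊢
    calc ‖a + Complex.exp b - z‖ = ‖(a - z) + Complex.exp b‖ := by ring_nf
      _ ≤ ‖a - z‖ + ‖Complex.exp b‖ := norm_add_le _ _
      _ < r := by linarith
  have hmem1 : ∀ p ∈ D, p.1 ∈ ball z r := fun p hp => ball_subset_ball (by linarith) hp.1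
  obtain ⟨Λ, hΛc, hΛ⟩ := exists_log_of_convex hDc
    ((nonempty_ball.2 hr2).prod (nonempty_re_lt _))
    (K := fun p => f (p.1 + Complex.exp p.2) - f p.1)
    ((hc.comp (by fun_prop) hmem).sub (hc.comp (by fun_prop) hmem1)) (by
      intro p hp h0
      have := hi (hmem p hp) (hmem1 p hp) (sub_eq_zero.1 h0)
      simp at this)
  have hsh : ∀ p ∈ D, (p.1, p.2 + 2 * Real.pi * Complex.I) ∈ D := by
    rintro ⟨a, b⟩ ⟨ha, hb⟩
    exact ⟨ha, by simpa only [mem_ofPred_eq, re_add_two_pi_I] using hb⟩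
  let u : ℂ × ℂ → ℂ := fun p => Λ (p.1, p.2 + 2 * Real.pi * Complex.I) - Λ p
  have huc : ContinuousOn u D := (hΛc.comp (by fun_prop) hsh).sub hΛc
  have hu1 : ∀ p ∈ D, Complex.exp (u p) = 1 := by
    intro p hp
    simp only [u]
    rw [Complex.exp_sub, hΛ _ (hsh p hp), hΛ p hp]
    simp only [Complex.exp_add, Complex.exp_two_pi_mul_I, mul_one]
    rw [div_self]
    rw [← hΛ p hp]
    exact Complex.exp_ne_zero _
  obtain ⟨ζ₀, hζ₀⟩ := nonempty_re_lt (Real.log (r / 2))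
  obtain ⟨n, hn⟩ := Complex.exp_eq_one_iff.1 (hu1 (z, ζ₀) ⟨mem_ball_self hr2, hζ₀⟩)
  refine ⟨n, Metric.eventually_nhds_iff_ball.2 ⟨r / 2, hr2, fun z' hz' => ?_⟩⟩
  refine ⟨Real.log (r / 2), fun ζ => Λ (z', ζ),
    hΛc.comp (by fun_prop) (fun ζ hζ => ⟨hz', hζ⟩), fun ζ hζ => ⟨hΛ _ ⟨hz', hζ⟩, ?_⟩⟩
  have := eq_of_exp_eq_one hDc.isPreconnected huc hu1 (x := (z', ζ)) (y := (z, ζ₀)) ⟨hz', hζ⟩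
    ⟨mem_ball_self hr2, hζ₀⟩
  rw [hn] at this
  simp only [u] at this
  linear_combination this

/-- The local degree of an injective map is odd. -/
theorem GoodAt.odd_of_hasDeg {f : ℂ → ℂ} {z : ℂ} (h : GoodAt f z) {n : ℤ} (hn : HasDeg f z n) :
    Odd n := by
  obtain ⟨r, hr, hc, hi⟩ := h
  obtain ⟨R, Λ', hΛ'c, hΛ'⟩ := hn
  let D : Set (ℝ × ℂ) := Icc 0 1 ×ˢ {ζ : ℂ | ζ.re < Real.log r}
  have hDc : Convex ℝ D := (convex_Icc _ _).prod (convex_re_lt _)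
  have hbd : ∀ a b : ℝ, |a| ≤ b → 0 < b → ∀ ζ : ℂ, ζ.re < Real.log r →
      z + Complex.exp ζ * a / b ∈ ball z r := by
    intro a b hab hb ζ hζ
    have h1 := norm_exp_lt hr hζ
    simp only [mem_ball, dist_eq_norm, add_sub_cancel_left, norm_div, norm_mul, Complex.norm_real]
    rw [div_lt_iff₀ (by simpa using hb.ne'), Real.norm_eq_abs, Real.norm_eq_abs, abs_of_pos hb]
    have := norm_nonneg (Complex.exp ζ)
    nlinarith
  have hm1 : ∀ p ∈ D, z + Complex.exp p.2 * (1 : ℝ) / ((1 + p.1 : ℝ) : ℂ) ∈ ball z r := by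
    rintro ⟨t, ζ⟩ ⟨ht, hζ⟩
    exact hbd 1 (1 + t) (by simp [ht.1]) (by linarith [ht.1]) ζ hζ
  have hm2 : ∀ p ∈ D, z + Complex.exp p.2 * (-p.1 : ℝ) / ((1 + p.1 : ℝ) : ℂ) ∈ ball z r := by
    rintro ⟨t, ζ⟩ ⟨ht, hζ⟩
    exact hbd (-t) (1 + t) (by rw [abs_neg, abs_of_nonneg ht.1]; linarith) (by linarith [ht.1]) ζ hζ
  have hne : ∀ p ∈ D, ((1 + p.1 : ℝ) : ℂ) ≠ 0 := by
    rintro ⟨t, ζ⟩ ⟨ht, hζ⟩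
    exact_mod_cast (by linarith [ht.1] : (1 + t : ℝ) ≠ 0)
  obtain ⟨Λ, hΛc, hΛ⟩ := exists_log_of_convex hDc
    ((nonempty_Icc.2 zero_le_one).prod (nonempty_re_lt _))
    (K := fun p => f (z + Complex.exp p.2 * (1 : ℝ) / ((1 + p.1 : ℝ) : ℂ))
      - f (z + Complex.exp p.2 * (-p.1 : ℝ) / ((1 + p.1 : ℝ) : ℂ)))
    ((hc.comp (ContinuousOn.add continuousOn_const
        (ContinuousOn.div (by fun_prop) (by fun_prop) hne)) hm1).sub
      (hc.comp (ContinuousOn.add continuousOn_const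
        (ContinuousOn.div (by fun_prop) (by fun_prop) hne)) hm2)) (by
      intro p hp h0
      have h1 := hi (hm1 p hp) (hm2 p hp) (sub_eq_zero.1 h0)
      have h2 := hne p hp
      field_simp at h1
      have h3 : Complex.exp p.2 * ((1 + p.1 : ℝ) : ℂ) = 0 := by
        push_cast at h1 ⊢
        linear_combination h1
      exact (mul_ne_zero (Complex.exp_ne_zero _) h2) h3)
  have hsh : ∀ p ∈ D, (p.1, p.2 + 2 * Real.pi * Complex.I) ∈ D := by
    rintro ⟨a, b⟩ ⟨ha, hb⟩
    exact ⟨ha, by simpa only [mem_ofPred_eq, re_add_two_pi_I] using hb⟩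
  let u : ℝ × ℂ → ℂ := fun p => Λ (p.1, p.2 + 2 * Real.pi * Complex.I) - Λ p
  have huc : ContinuousOn u D := (hΛc.comp (by fun_prop) hsh).sub hΛc
  have hu1 : ∀ p ∈ D, Complex.exp (u p) = 1 := by
    intro p hp
    simp only [u]
    rw [Complex.exp_sub, hΛ _ (hsh p hp), hΛ p hp]
    simp only [Complex.exp_add, Complex.exp_two_pi_mul_I, mul_one]
    rw [div_self]
    intro h0
    exact Complex.exp_ne_zero (Λ p) ((hΛ p hp).trans (by simpa using h0))
  obtain ⟨ζ₀, hζ₀⟩ := nonempty_re_lt (Real.log r)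
  have hmem0 : ∀ ζ : ℂ, ζ.re < Real.log r → ((0 : ℝ), ζ) ∈ D := fun ζ h => ⟨by simp, h⟩
  have hmem1 : ∀ ζ : ℂ, ζ.re < Real.log r → ((1 : ℝ), ζ) ∈ D := fun ζ h => ⟨by simp, h⟩
  obtain ⟨m, hm⟩ := Complex.exp_eq_one_iff.1 (hu1 (0, ζ₀) (hmem0 _ hζ₀))
  have hconst : ∀ p ∈ D, u p = m * (2 * Real.pi * Complex.I) := fun p hp =>
    (eq_of_exp_eq_one hDc.isPreconnected huc hu1 hp (hmem0 _ hζ₀)).trans hm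
  have hnm : m = n := by
    refine HasDeg.unique (f := f) (z := z) ⟨Real.log r, fun ζ => Λ (0, ζ),
      hΛc.comp (by fun_prop) (fun ζ hζ => hmem0 ζ hζ), fun ζ hζ => ⟨?_, ?_⟩⟩ ⟨R, Λ', hΛ'c, hΛ'⟩
    · rw [hΛ _ (hmem0 ζ hζ)]
      simp
    · have := hconst _ (hmem0 ζ hζ)
      simp only [u] at this
      linear_combination this
  -- half-period shift at parameter `1`
  let v : ℂ → ℂ := fun ζ => Λ (1, ζ + Real.pi * Complex.I) - Λ (1, ζ) - Real.pi * Complex.I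
  have hsh2 : ∀ ζ : ℂ, ζ.re < Real.log r → (ζ + Real.pi * Complex.I).re < Real.log r := by
    intro ζ hζ
    simpa using hζ
  have hvc : ContinuousOn v {ζ : ℂ | ζ.re < Real.log r} :=
    ((hΛc.comp (by fun_prop) (fun ζ hζ => hmem1 _ (hsh2 ζ hζ))).sub
      (hΛc.comp (by fun_prop) (fun ζ hζ => hmem1 ζ hζ))).sub continuousOn_const
  have hv1 : ∀ ζ ∈ {ζ : ℂ | ζ.re < Real.log r}, Complex.exp (v ζ) = 1 := by
    intro ζ hζ
    simp only [v]
    rw [Complex.exp_sub, Complex.exp_sub, hΛ _ (hmem1 _ (hsh2 ζ hζ)), hΛ _ (hmem1 ζ hζ)]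
    have h0 := Complex.exp_ne_zero (Λ (1, ζ))
    rw [hΛ _ (hmem1 ζ hζ)] at h0
    simp only [Complex.exp_add, Complex.exp_pi_mul_I, mul_neg, mul_one, Complex.ofReal_one,
      Complex.ofReal_neg, neg_neg] at h0 ⊢
    rw [div_neg, div_one, ← neg_div, neg_sub, div_self h0]
  obtain ⟨k, hk⟩ := Complex.exp_eq_one_iff.1 (hv1 ζ₀ hζ₀)
  have hv2 := eq_of_exp_eq_one (convex_re_lt _).isPreconnected hvc hv1 (hsh2 ζ₀ hζ₀) hζ₀
  have hu2 := hconst _ (hmem1 ζ₀ hζ₀)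
  refine ⟨k, ?_⟩
  rw [← hnm]
  have e1 : ζ₀ + Real.pi * Complex.I + Real.pi * Complex.I = ζ₀ + 2 * Real.pi * Complex.I := by ring
  simp only [v, e1] at hv2 hk
  simp only [u] at hu2
  have h4 : ((m : ℂ) - (2 * k + 1)) * (2 * Real.pi * Complex.I) = 0 := by
    linear_combination -hu2 + hv2 + 2 * hk
  have h5 := sub_eq_zero.1 ((mul_eq_zero.1 h4).resolve_right Complex.two_pi_I_ne_zero)
  exact_mod_cast h5

theorem HasDeg.comp {f g : ℂ → ℂ} {z : ℂ} {n m : ℤ} (hf : HasDeg f z n) (hg : HasDeg g (f z) m)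
    (hc : ContinuousAt f z) : HasDeg (g ∘ f) z (m * n) := by
  obtain ⟨R, Λ, hΛc, hΛ⟩ := hf
  obtain ⟨R', Λ', hΛ'c, hΛ'⟩ := hg
  obtain ⟨r, hr, hball⟩ := Metric.continuousAt_iff.1 hc (Real.exp R') (Real.exp_pos _)
  have hper : ∀ (k : ℤ) (ζ : ℂ), ζ.re < R' →
      Λ' (ζ + k * (2 * Real.pi * Complex.I)) = Λ' ζ + (k * m : ℤ) * (2 * Real.pi * Complex.I) := by
    intro k ζ hζ
    have hre : ∀ k : ℤ, (ζ + k * (2 * Real.pi * Complex.I)).re < R' := by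
      intro k
      simpa using hζ
    induction k using Int.induction_on with
    | zero => simp
    | succ i ih =>
      have := (hΛ' _ (hre i)).2
      rw [ih] at this
      rw [← sub_eq_zero]
      push_cast at this ⊢
      rw [show ζ + ((i : ℂ) + 1) * (2 * Real.pi * Complex.I)
        = ζ + i * (2 * Real.pi * Complex.I) + 2 * Real.pi * Complex.I by ring, this]
      ring
    | pred i ih =>
      have := (hΛ' _ (hre (-i - 1))).2
      rw [show ζ + ((-i - 1 : ℤ) : ℂ) * (2 * Real.pi * Complex.I) + 2 * Real.pi * Complex.I
        = ζ + ((-i : ℤ) : ℂ) * (2 * Real.pi * Complex.I) by push_cast; ring, ih] at this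
      push_cast at this ⊢
      linear_combination -this
  have hre : ∀ ζ : ℂ, ζ.re < min R (Real.log r) → ζ.re < R ∧ (Λ ζ).re < R' := by
    intro ζ hζ
    have h1 := lt_of_lt_of_le hζ (min_le_left _ _)
    refine ⟨h1, ?_⟩
    have h2 := @hball (z + Complex.exp ζ)
      (by simpa [dist_eq_norm] using norm_exp_lt hr (lt_of_lt_of_le hζ (min_le_right _ _)))
    rw [dist_eq_norm, ← (hΛ ζ h1).1, Complex.norm_exp] at h2
    exact Real.exp_lt_exp.1 h2
  refine ⟨min R (Real.log r), Λ' ∘ Λ, hΛ'c.comp (hΛc.mono fun ζ hζ => (hre ζ hζ).1)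
    (fun ζ hζ => (hre ζ hζ).2), fun ζ hζ => ⟨?_, ?_⟩⟩
  · simp only [comp_apply]
    rw [(hΛ' _ (hre ζ hζ).2).1, (hΛ ζ (hre ζ hζ).1).1]
    simp
  · simp only [comp_apply]
    rw [(hΛ ζ (hre ζ hζ).1).2, hper n _ (hre ζ hζ).2, mul_comm m n]

theorem hasDeg_affine {a : ℂ} (ha : a ≠ 0) (b z : ℂ) : HasDeg (fun w => a * w + b) z 1 := by
  refine ⟨0, fun ζ => ζ + Complex.log a, by fun_prop, fun ζ _ => ⟨?_, by push_cast; ring⟩⟩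
  rw [Complex.exp_add, Complex.exp_log ha]
  ring

theorem hasDeg_conj (z : ℂ) : HasDeg (starRingEnd ℂ) z (-1) := by
  refine ⟨0, starRingEnd ℂ, Complex.continuous_conj.continuousOn, fun ζ _ => ⟨?_, ?_⟩⟩
  · rw [Complex.exp_conj]
    simp
  · simp [map_ofNat]

/-! ### The sign of the local degree -/

open Classical in
/-- The sign of the local degree of `f` at `z`. -/
def sdeg (f : ℂ → ℂ) (z : ℂ) : ℤˣ := if ∃ n, HasDeg f z n ∧ n < 0 then -1 else 1

theorem HasDeg.sdeg_eq {f : ℂ → ℂ} {z : ℂ} {n : ℤ} (h : HasDeg f z n) :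
    sdeg f z = if n < 0 then -1 else 1 := by
  unfold sdeg
  congr 1
  refine propext ⟨fun ⟨m, hm, hneg⟩ => h.unique hm ▸ hneg, fun hn => ⟨n, h, hn⟩⟩

theorem GoodAt.continuousAt {T : Type*} [TopologicalSpace T] {f : ℂ → T} {z : ℂ}
    (h : GoodAt f z) : ContinuousAt f z := by
  obtain ⟨r, hr, hc, -⟩ := h
  exact hc.continuousAt (ball_mem_nhds z hr)

theorem GoodAt.eventually {T : Type*} [TopologicalSpace T] {f : ℂ → T} {z : ℂ}
    (h : GoodAt f z) : ∀ᶠ z' in 𝓝 z, GoodAt f z' := by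
  obtain ⟨r, hr, hc, hi⟩ := h
  filter_upwards [ball_mem_nhds z hr] with z' hz'
  obtain ⟨s, hs, hsub⟩ := Metric.isOpen_iff.1 isOpen_ball z' hz'
  exact ⟨s, hs, hc.mono hsub, hi.mono hsub⟩

theorem goodAt_iff {T : Type*} [TopologicalSpace T] {f : ℂ → T} {z : ℂ} :
    GoodAt f z ↔ ∃ s ∈ 𝓝 z, ContinuousOn f s ∧ InjOn f s := by
  refine ⟨fun ⟨r, hr, h⟩ => ⟨_, ball_mem_nhds z hr, h⟩, fun ⟨s, hs, hc, hi⟩ => ?_⟩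
  obtain ⟨r, hr, hsub⟩ := Metric.mem_nhds_iff.1 hs
  exact ⟨r, hr, hc.mono hsub, hi.mono hsub⟩

theorem GoodAt.comp {T T' : Type*} [TopologicalSpace T] [TopologicalSpace T'] {f : ℂ → T}
    {z : ℂ} (h : GoodAt f z) {g : T → T'} {s : Set T} (hs : s ∈ 𝓝 (f z)) (hg : ContinuousOn g s)
    (hgi : InjOn g s) : GoodAt (g ∘ f) z := by
  have hc := h.continuousAt
  obtain ⟨t, ht, hft, hfi⟩ := goodAt_iff.1 h
  refine goodAt_iff.2 ⟨t ∩ f ⁻¹' s, Filter.inter_mem ht (hc hs), ?_, ?_⟩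
  · exact hg.comp (hft.mono inter_subset_left) fun x hx => hx.2
  · exact hgi.comp (hfi.mono inter_subset_left) fun x hx => hx.2

theorem sdeg_congr {f g : ℂ → ℂ} {z : ℂ} (hf : GoodAt f z) (hfg : f =ᶠ[𝓝 z] g) :
    sdeg f z = sdeg g z := by
  obtain ⟨n, hn⟩ := hf.exists_hasDeg
  rw [hn.self_of_nhds.sdeg_eq, (hn.self_of_nhds.congr hfg).sdeg_eq]

theorem GoodAt.eventually_sdeg_eq {f : ℂ → ℂ} {z : ℂ} (hf : GoodAt f z) :
    ∀ᶠ z' in 𝓝 z, sdeg f z' = sdeg f z := by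
  obtain ⟨n, hn⟩ := hf.exists_hasDeg
  filter_upwards [hn] with z' hz'
  rw [hz'.sdeg_eq, hn.self_of_nhds.sdeg_eq]

theorem sdeg_comp {f g : ℂ → ℂ} {z : ℂ} (hf : GoodAt f z) (hg : GoodAt g (f z)) :
    sdeg (g ∘ f) z = sdeg g (f z) * sdeg f z := by
  obtain ⟨n, hn⟩ := hf.exists_hasDeg
  obtain ⟨m, hm⟩ := hg.exists_hasDeg
  have hn := hn.self_of_nhds
  have hm := hm.self_of_nhds
  have h1 : n ≠ 0 := by rintro rfl; exact absurd (hf.odd_of_hasDeg hn) (by decide)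
  have h2 : m ≠ 0 := by rintro rfl; exact absurd (hg.odd_of_hasDeg hm) (by decide)
  rw [hn.sdeg_eq, hm.sdeg_eq, (hn.comp hm hf.continuousAt).sdeg_eq]
  rcases lt_or_gt_of_ne h1 with h1 | h1 <;> rcases lt_or_gt_of_ne h2 with h2 | h2
  · simp [h1, h2, (mul_pos_of_neg_of_neg h2 h1).le]
  · simp [h1, h2.le, mul_neg_of_pos_of_neg h2 h1]
  · simp [h1.le, h2, mul_neg_of_neg_of_pos h2 h1]
  · rw [if_neg h1.not_gt, if_neg h2.not_gt, if_neg (mul_pos h2 h1).not_gt, mul_one]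

theorem sdeg_affine {a : ℂ} (ha : a ≠ 0) (b z : ℂ) : sdeg (fun w => a * w + b) z = 1 := by
  rw [(hasDeg_affine ha b z).sdeg_eq]
  simp

theorem sdeg_conj (z : ℂ) : sdeg (starRingEnd ℂ) z = -1 := by
  rw [(hasDeg_conj z).sdeg_eq]
  simp

theorem goodAt_of_injective {T : Type*} [TopologicalSpace T] {f : ℂ → T} (hc : Continuous f)
    (hi : Injective f) (z : ℂ) : GoodAt f z :=
  ⟨1, one_pos, hc.continuousOn, hi.injOn⟩

/-- An injective planar map cannot take a point to the boundary of a half plane containing its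
image. -/
theorem GoodAt.not_eventually_re_nonneg {f : ℂ → ℂ} {z : ℂ} (hf : GoodAt f z)
    (h0 : (f z).re = 0) : ¬ ∀ᶠ z' in 𝓝 z, 0 ≤ (f z').re := by
  intro hev
  obtain ⟨n, hn⟩ := hf.exists_hasDeg
  have hodd := hf.odd_of_hasDeg hn.self_of_nhds
  obtain ⟨r, hr, hc, hi⟩ := hf
  obtain ⟨s, hs, hball⟩ := Metric.eventually_nhds_iff_ball.1 hev
  let R := Real.log (min r s)
  have hrs : 0 < min r s := lt_min hr hs
  have hmem : ∀ ζ : ℂ, ζ.re < R → z + Complex.exp ζ ∈ ball z (min r s) := by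
    intro ζ hζ
    simpa [mem_ball, dist_eq_norm] using (lt_min_iff.1 (norm_exp_lt hrs hζ))
  have hne : ∀ ζ : ℂ, ζ.re < R → f (z + Complex.exp ζ) - f z ≠ 0 := by
    intro ζ hζ h
    have := hi (ball_subset_ball (min_le_left _ _) (hmem ζ hζ)) (mem_ball_self hr) (sub_eq_zero.1 h)
    simp at this
  have hslit : ∀ ζ : ℂ, ζ.re < R → f (z + Complex.exp ζ) - f z ∈ Complex.slitPlane := by
    intro ζ hζ
    have h1 := hball _ (ball_subset_ball (min_le_right _ _) (hmem ζ hζ))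
    rw [Complex.mem_slitPlane_iff]
    by_contra hcon
    push Not at hcon
    refine hne ζ hζ (Complex.ext ?_ hcon.2)
    have := hcon.1
    simp only [Complex.sub_re, h0, sub_zero, Complex.zero_re] at this ⊢
    linarith
  have h2 : HasDeg f z 0 := by
    refine ⟨R, fun ζ => Complex.log (f (z + Complex.exp ζ) - f z), ?_, fun ζ hζ =>
      ⟨Complex.exp_log (hne ζ hζ), by simp [Complex.exp_add]⟩⟩
    refine ContinuousOn.clog ?_ (fun ζ hζ => hslit ζ hζ)
    exact (hc.comp (by fun_prop) (fun ζ hζ => ball_subset_ball (min_le_left _ _) (hmem ζ hζ))).sub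
      continuousOn_const
  have := hn.self_of_nhds.unique h2
  subst this
  exact absurd hodd (by decide)

/-! ### Sign cocycles -/

/-- A Čech cocycle with values in `{1, -1}`, defined on the union of the open sets `U i`. -/
structure SignCocycle (ι W : Type*) [TopologicalSpace W] where
  U : ι → Set W
  isOpen : ∀ i, IsOpen (U i)
  g : ι → ι → W → ℤˣ
  locConst : ∀ i j, ∀ z ∈ U i, z ∈ U j → ∀ᶠ z' in 𝓝 z, g i j z' = g i j z
  cocycle : ∀ i j k, ∀ z ∈ U i, z ∈ U j → z ∈ U k → g i j z * g j k z = g i k z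

theorem neg_ne_self_units (u : ℤˣ) : -u ≠ u := by
  rcases Int.units_eq_one_or u with rfl | rfl <;> decide

namespace SignCocycle

variable {ι κ W A B : Type*} [TopologicalSpace W] [TopologicalSpace A] [TopologicalSpace B]

/-- A section of the cocycle `c` along the map `f`. -/
structure IsSection (c : SignCocycle ι W) (f : A → W) (σ : ι → A → ℤˣ) : Prop where
  locConst : ∀ i a, f a ∈ c.U i → ∀ᶠ a' in 𝓝 a, σ i a' = σ i a
  compat : ∀ i j a, f a ∈ c.U i → f a ∈ c.U j → σ j a = c.g i j (f a) * σ i a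

/-- The domain of a cocycle. -/
def dom (c : SignCocycle ι W) : Set W := {w | ∃ i, w ∈ c.U i}

theorem g_self (c : SignCocycle ι W) {i : ι} {z : W} (hz : z ∈ c.U i) : c.g i i z = 1 := by
  have := c.cocycle i i i z hz hz hz
  exact mul_eq_left.1 this

theorem g_symm (c : SignCocycle ι W) {i j : ι} {z : W} (hi : z ∈ c.U i) (hj : z ∈ c.U j) :
    c.g j i z = c.g i j z := by
  have := c.cocycle i j i z hi hj hi
  rw [c.g_self hi] at this
  rw [← Int.units_inv_eq_self (c.g i j z)]
  exact eq_inv_of_mul_eq_one_right this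

theorem IsSection.comp {c : SignCocycle ι W} {f : A → W} {σ : ι → A → ℤˣ} (h : c.IsSection f σ)
    {k : B → A} (hk : Continuous k) : c.IsSection (f ∘ k) (fun i b => σ i (k b)) where
  locConst i b hb := hk.continuousAt.eventually (h.locConst i (k b) hb)
  compat i j b hi hj := h.compat i j (k b) hi hj

theorem IsSection.const_mul {c : SignCocycle ι W} {f : A → W} {σ : ι → A → ℤˣ}
    (h : c.IsSection f σ) (ε : ℤˣ) : c.IsSection f (fun i b => ε * σ i b) where
  locConst i b hb := (h.locConst i b hb).mono fun a ha => by rw [ha]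
  compat i j b hi hj := by rw [h.compat i j b hi hj, mul_left_comm]

/-- The ratio of two sections does not depend on the index. -/
theorem IsSection.ratio_eq {c : SignCocycle ι W} {f : A → W} {σ τ : ι → A → ℤˣ}
    (h : c.IsSection f σ) (h' : c.IsSection f τ) {i j : ι} {a : A} (hi : f a ∈ c.U i)
    (hj : f a ∈ c.U j) : σ j a * τ j a = σ i a * τ i a := by
  rw [h.compat i j a hi hj, h'.compat i j a hi hj, mul_mul_mul_comm, Int.units_mul_self, one_mul]

/-- Two sections over a connected set differ by a constant sign. -/
theorem IsSection.exists_eq_mul {c : SignCocycle ι W} {f : A → W} {σ τ : ι → A → ℤˣ}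
    (h : c.IsSection f σ) (h' : c.IsSection f τ) (hf : Continuous f) {S : Set A}
    (hS : IsPreconnected S) (hdom : ∀ a ∈ S, f a ∈ c.dom) :
    ∃ ε : ℤˣ, ∀ a ∈ S, ∀ i, f a ∈ c.U i → σ i a = ε * τ i a := by
  classical
  rcases S.eq_empty_or_nonempty with rfl | ⟨a₀, ha₀⟩
  · exact ⟨1, by simp⟩
  let r : A → ℤˣ := fun a => if hd : f a ∈ c.dom then σ hd.choose a * τ hd.choose a else 1
  have hr : ∀ a i, f a ∈ c.U i → r a = σ i a * τ i a := by
    intro a i hi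
    have hd : f a ∈ c.dom := ⟨i, hi⟩
    simp only [r, hd, dite_true]
    exact h.ratio_eq h' hi hd.choose_spec
  have hrc : ContinuousOn r S := by
    intro a ha
    obtain ⟨i, hi⟩ := hdom a ha
    refine ContinuousAt.continuousWithinAt (continuousAt_const.congr (f := fun _ => r a) ?_)
    filter_upwards [h.locConst i a hi, h'.locConst i a hi,
      hf.continuousAt ((c.isOpen i).mem_nhds hi)] with a' h1 h2 h3
    rw [hr a i hi, hr a' i h3, h1, h2]
  refine ⟨r a₀, fun a ha i hi => ?_⟩
  rw [hS.constant hrc ha₀ ha, hr a i hi, mul_assoc, Int.units_mul_self, mul_one]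

/-- The pullback of a cocycle. -/
def comap (c : SignCocycle ι W) {f : A → W} (hf : Continuous f) : SignCocycle ι A where
  U i := f ⁻¹' c.U i
  isOpen i := (c.isOpen i).preimage hf
  g i j a := c.g i j (f a)
  locConst i j a hi hj := hf.continuousAt.eventually (c.locConst i j (f a) hi hj)
  cocycle i j k a hi hj hk := c.cocycle i j k (f a) hi hj hk

/-- Invariant sections descend along quotient maps. -/
theorem IsSection.descend {c : SignCocycle ι W} {f : B → W} {q : A → B} {σ : ι → A → ℤˣ}
    (h : c.IsSection (f ∘ q) σ) (hf : Continuous f) (hq : IsQuotientMap q)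
    (hinv : ∀ i a a', q a = q a' → f (q a) ∈ c.U i → σ i a = σ i a') :
    ∃ τ, c.IsSection f τ ∧ ∀ i a, f (q a) ∈ c.U i → τ i (q a) = σ i a := by
  have hqs := hq.surjective
  have key : ∀ i a, f (q a) ∈ c.U i → σ i (surjInv hqs (q a)) = σ i a := fun i a ha =>
    hinv i _ _ (surjInv_eq hqs (q a)) (by rwa [surjInv_eq hqs (q a)])
  refine ⟨fun i b => σ i (surjInv hqs b), ⟨fun i b hb => ?_, fun i j b hi hj => ?_⟩, key⟩
  · set ε := σ i (surjInv hqs b) with hε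
    have ho : IsOpen {b' | f b' ∈ c.U i ∧ σ i (surjInv hqs b') = ε} := by
      rw [← hq.isOpen_preimage, isOpen_iff_mem_nhds]
      rintro a ⟨ha, ha'⟩
      rw [key i a ha] at ha'
      filter_upwards [h.locConst i a ha,
        (hf.comp hq.continuous).continuousAt ((c.isOpen i).mem_nhds ha)] with a' h1 h2
      exact ⟨h2, by rw [key i a' h2, h1, ha']⟩
    filter_upwards [ho.mem_nhds ⟨hb, rfl⟩] with b' hb'
    exact hb'.2
  · have := h.compat i j (surjInv hqs b)
    simp only [comp_apply, surjInv_eq] at this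
    exact this hi hj

/-- Product of cocycles. -/
def mul (c : SignCocycle ι W) (d : SignCocycle κ W) : SignCocycle (ι × κ) W where
  U i := c.U i.1 ∩ d.U i.2
  isOpen i := (c.isOpen _).inter (d.isOpen _)
  g i j z := c.g i.1 j.1 z * d.g i.2 j.2 z
  locConst i j z hi hj := by
    filter_upwards [c.locConst _ _ z hi.1 hj.1, d.locConst _ _ z hi.2 hj.2] with z' h1 h2
    rw [h1, h2]
  cocycle i j k z hi hj hk := by
    rw [mul_mul_mul_comm, c.cocycle _ _ _ z hi.1 hj.1 hk.1, d.cocycle _ _ _ z hi.2 hj.2 hk.2]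

theorem IsSection.mul {c : SignCocycle ι W} {d : SignCocycle κ W} {f : A → W} {σ : ι → A → ℤˣ}
    {τ : κ → A → ℤˣ} (h : c.IsSection f σ) (h' : d.IsSection f τ) :
    (c.mul d).IsSection f (fun i a => σ i.1 a * τ i.2 a) where
  locConst i a ha := by
    filter_upwards [h.locConst _ a ha.1, h'.locConst _ a ha.2] with a' h1 h2
    rw [h1, h2]
  compat i j a hi hj := by
    rw [h.compat _ _ a hi.1 hj.1, h'.compat _ _ a hi.2 hj.2, mul_mul_mul_comm]
    rfl

/-- Dividing a section of a product by a section of the first factor. -/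
theorem IsSection.div_left {c : SignCocycle ι W} {d : SignCocycle κ W} {f : A → W}
    {ρ : ι × κ → A → ℤˣ} {σ : ι → A → ℤˣ} (hf : Continuous f)
    (h : (c.mul d).IsSection f ρ) (h' : c.IsSection f σ) (hdom : ∀ a, f a ∈ c.dom) :
    ∃ τ, d.IsSection f τ ∧ ∀ i j a, f a ∈ c.U i → f a ∈ d.U j → τ j a = ρ (i, j) a * σ i a := by
  have key : ∀ i i' j a, f a ∈ c.U i → f a ∈ c.U i' → f a ∈ d.U j →
      ρ (i, j) a * σ i a = ρ (i', j) a * σ i' a := by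
    intro i i' j a hi hi' hj
    have h1 := h.compat (i, j) (i', j) a ⟨hi, hj⟩ ⟨hi', hj⟩
    have h2 := h'.compat i i' a hi hi'
    rw [h1, h2]
    simp only [SignCocycle.mul, d.g_self hj, mul_one]
    rw [mul_mul_mul_comm, Int.units_mul_self, one_mul]
  choose ix hix using hdom
  refine ⟨fun j a => ρ (ix a, j) a * σ (ix a) a, ⟨fun j a ha => ?_, fun j k a hj hk => ?_⟩,
    fun i j a hi hj => key _ _ _ _ (hix a) hi hj⟩
  · filter_upwards [h.locConst (ix a, j) a ⟨hix a, ha⟩, h'.locConst (ix a) a (hix a),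
      hf.continuousAt ((c.isOpen _).mem_nhds (hix a)),
      hf.continuousAt ((d.isOpen _).mem_nhds ha)] with a' h1 h2 h3 h4
    rw [← h1, ← h2]
    exact key _ _ _ _ (hix a') h3 h4
  · have h1 := h.compat (ix a, j) (ix a, k) a ⟨hix a, hj⟩ ⟨hix a, hk⟩
    rw [h1]
    simp only [SignCocycle.mul, c.g_self (hix a), one_mul, mul_assoc]

/-! ### The associated double cover -/

/-- The fibre bundle with fibre `{1, -1}` attached to a cocycle. -/
def core (c : SignCocycle ι W) (hc : ∀ w, w ∈ c.dom) : FiberBundleCore ι W ℤˣ where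
  baseSet := c.U
  isOpen_baseSet := c.isOpen
  indexAt w := (hc w).choose
  mem_baseSet_at w := (hc w).choose_spec
  coordChange i j z v := c.g i j z * v
  coordChange_self i z hz v := by rw [c.g_self hz, one_mul]
  continuousOn_coordChange i j := by
    rintro ⟨z, v⟩ ⟨⟨hi, hj⟩, -⟩
    refine ContinuousAt.continuousWithinAt ?_
    refine ContinuousAt.mul ?_ continuousAt_snd
    refine ContinuousAt.comp (g := fun z => c.g i j z) ?_ continuousAt_fst
    exact continuousAt_const.congr ((c.locConst i j z hi hj).mono fun z' h => h.symm)
  coordChange_comp i j k z hz v := by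
    rw [← mul_assoc, mul_comm (c.g j k z), c.cocycle i j k z hz.1.1 hz.1.2 hz.2]

/-- The total space of the double cover attached to a cocycle. -/
abbrev Tot (c : SignCocycle ι W) (hc : ∀ w, w ∈ c.dom) := (c.core hc).TotalSpace

section Tot

variable (c : SignCocycle ι W) (hc : ∀ w, w ∈ c.dom)

theorem isCoveringMap_proj : IsCoveringMap (c.core hc).proj :=
  FiberBundle.isCoveringMap (F := ℤˣ) (E := (c.core hc).Fiber)

/-- The point of the total space over `w` with coordinate `u` in the chart `i`. -/
def pt (i : ι) (w : W) (u : ℤˣ) : c.Tot hc := ((c.core hc).localTriv i).toOpenPartialHomeomorph.symm (w, u)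

/-- The coordinate of a point of the total space in the chart `i`. -/
def coord (i : ι) (z : c.Tot hc) : ℤˣ := ((c.core hc).localTriv i z).2

/-- The sign component of a point of the total space. -/
def sgn (z : c.Tot hc) : ℤˣ := z.2

theorem coord_def (i : ι) (z : c.Tot hc) :
    c.coord hc i z = c.g ((hc z.1).choose) i z.1 * c.sgn hc z := rfl

theorem coord_pt {i : ι} {w : W} (hw : w ∈ c.U i) (u : ℤˣ) : c.coord hc i (c.pt hc i w u) = u := by
  have := ((c.core hc).localTriv i).toOpenPartialHomeomorph.right_inv (x := (w, u))
    (by rw [← (c.core hc).localTrivAsPartialEquiv_target i] ; exact ⟨hw, trivial⟩)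
  exact congrArg Prod.snd this

theorem pt_coord {i : ι} {z : c.Tot hc} (hz : (c.core hc).proj z ∈ c.U i) :
    c.pt hc i ((c.core hc).proj z) (c.coord hc i z) = z :=
  ((c.core hc).localTriv i).toOpenPartialHomeomorph.left_inv (x := z) hz

theorem coord_compat {i j : ι} {z : c.Tot hc} (hi : (c.core hc).proj z ∈ c.U i)
    (hj : (c.core hc).proj z ∈ c.U j) :
    c.coord hc j z = c.g i j ((c.core hc).proj z) * c.coord hc i z := by
  rw [coord_def, coord_def, ← mul_assoc, mul_comm (c.g i j _)]
  congr 1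
  exact (c.cocycle _ i j z.1 (hc z.1).choose_spec hi hj).symm

theorem continuousAt_coord {i : ι} {z : c.Tot hc} (hz : (c.core hc).proj z ∈ c.U i) :
    ContinuousAt (c.coord hc i) z := by
  have h : ContinuousAt ((c.core hc).localTriv i) z :=
    ((c.core hc).localTriv i).toOpenPartialHomeomorph.continuousAt (x := z) hz
  exact continuousAt_snd.comp h

theorem continuousOn_pt (i : ι) (u : ℤˣ) : ContinuousOn (fun w => c.pt hc i w u) (c.U i) := by
  refine ((c.core hc).localTriv i).toOpenPartialHomeomorph.continuousOn_symm.comp (by fun_prop) ?_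
  intro w hw
  rw [← (c.core hc).localTrivAsPartialEquiv_target i]
  exact ⟨hw, trivial⟩

/-- Lifts to the total space are sections. -/
theorem isSection_coord {f : A → W} {F : A → c.Tot hc} (hF : Continuous F)
    (hl : ∀ a, (c.core hc).proj (F a) = f a) : c.IsSection f (fun i a => c.coord hc i (F a)) where
  locConst i a ha := by
    have h := (c.continuousAt_coord hc (i := i) (z := F a) (by rwa [hl])).comp hF.continuousAt
    exact h.eventually (IsOpen.mem_nhds (isOpen_discrete {c.coord hc i (F a)}) rfl)
  compat i j a hi hj := by
    have := c.coord_compat hc (i := i) (j := j) (z := F a) (by rwa [hl]) (by rwa [hl])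
    rwa [hl] at this

/-- The deck transformation. -/
def flip (z : c.Tot hc) : c.Tot hc := ⟨z.1, (show ℤˣ from -c.sgn hc z)⟩

theorem proj_flip (z : c.Tot hc) : (c.core hc).proj (c.flip hc z) = (c.core hc).proj z := rfl

theorem coord_flip (i : ι) (z : c.Tot hc) : c.coord hc i (c.flip hc z) = -c.coord hc i z := by
  rw [coord_def, coord_def]
  exact mul_neg _ _

theorem ext_coord {i : ι} {z z' : c.Tot hc} (hz : (c.core hc).proj z ∈ c.U i)
    (h : (c.core hc).proj z = (c.core hc).proj z') (h' : c.coord hc i z = c.coord hc i z') :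
    z = z' := by
  rw [← c.pt_coord hc hz, ← c.pt_coord hc (i := i) (z := z') (h ▸ hz), h, h']

theorem flip_flip (z : c.Tot hc) : c.flip hc (c.flip hc z) = z := by
  obtain ⟨i, hi⟩ := hc ((c.core hc).proj z)
  exact c.ext_coord hc (i := i) hi rfl (by simp [coord_flip])

theorem flip_ne (z : c.Tot hc) : c.flip hc z ≠ z := by
  intro h
  obtain ⟨i, hi⟩ := hc ((c.core hc).proj z)
  have := congrArg (c.coord hc i) h
  rw [coord_flip] at this
  exact neg_ne_self_units _ this

theorem eq_or_eq_flip {z z' : c.Tot hc} (h : (c.core hc).proj z = (c.core hc).proj z') :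
    z' = z ∨ z' = c.flip hc z := by
  obtain ⟨i, hi⟩ := hc ((c.core hc).proj z)
  have hi' : (c.core hc).proj z' ∈ c.U i := h ▸ hi
  by_cases hcd : c.coord hc i z' = c.coord hc i z
  · exact Or.inl (c.ext_coord hc hi' h.symm hcd)
  · refine Or.inr (c.ext_coord hc hi' (h.symm) ?_)
    rw [coord_flip]
    exact Int.units_ne_iff_eq_neg.1 hcd

theorem continuous_flip : Continuous (c.flip hc) := by
  rw [continuous_iff_continuousAt]
  intro z
  obtain ⟨i, hi⟩ := hc ((c.core hc).proj z)
  have hp : Continuous (c.core hc).proj := (c.core hc).continuous_proj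
  have hO := (hp.continuousAt (x := z)) ((c.isOpen i).mem_nhds hi)
  have hcd := c.continuousAt_coord hc hi
  have h1 : ContinuousAt (fun z => c.pt hc i ((c.core hc).proj z) (-c.coord hc i z)) z := by
    have h2 : ContinuousAt (fun z' => c.pt hc i ((c.core hc).proj z') (-c.coord hc i z)) z :=
      ContinuousAt.comp (g := fun w => c.pt hc i w (-c.coord hc i z))
        ((c.continuousOn_pt hc i _).continuousAt ((c.isOpen i).mem_nhds hi)) hp.continuousAt
    refine h2.congr ?_
    filter_upwards [hcd.eventually (IsOpen.mem_nhds (isOpen_discrete {c.coord hc i z}) rfl)]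
      with z' hz'
    rw [show c.coord hc i z' = c.coord hc i z from hz']
  refine h1.congr ?_
  filter_upwards [hO] with z' hz'
  refine c.ext_coord hc (i := i) hz' rfl ?_
  rw [coord_pt _ _ hz', coord_flip]

end Tot

/-- Cocycles are trivial over contractible spaces. -/
theorem exists_section_of_contractible [ContractibleSpace A] (c : SignCocycle ι W) {f : A → W}
    (hf : Continuous f) (hdom : ∀ a, f a ∈ c.dom) : ∃ σ, c.IsSection f σ := by
  let d : SignCocycle ι A := c.comap hf
  have hd : ∀ a, a ∈ d.dom := hdom
  obtain ⟨F, hF⟩ := exists_lift_of_contractible (d.isCoveringMap_proj hd)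
    (fun a => ⟨d.pt hd (hd a).choose a 1, rfl⟩) (ContinuousMap.id A)
  have := d.isSection_coord hd (f := id) F.continuous hF
  exact ⟨_, ⟨this.locConst, this.compat⟩⟩

end SignCocycle

/-! ### Simple arcs in surfaces -/

/-- Every point is the centre of an embedded closed disc with open interior. -/
def HasDiscs (Z : Type*) [TopologicalSpace Z] : Prop :=
  ∀ z : Z, ∃ E : ℂ → Z, ContinuousOn E (closedBall 0 1) ∧ InjOn E (closedBall 0 1) ∧ E 0 = z ∧
    IsOpen (E '' ball 0 1)

/-- Two points are equal or joined by a simple arc. -/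
def ArcJoined {Z : Type*} [TopologicalSpace Z] (z z' : Z) : Prop :=
  z = z' ∨ ∃ α : ℝ → Z, ContinuousOn α (Icc 0 1) ∧ InjOn α (Icc 0 1) ∧ α 0 = z ∧ α 1 = z'

theorem arcJoined_of_disc {Z : Type*} [TopologicalSpace Z] {E : ℂ → Z}
    (hE : ContinuousOn E (closedBall 0 1)) (hi : InjOn E (closedBall 0 1)) {a b : ℂ}
    (ha : a ∈ closedBall (0 : ℂ) 1) (hb : b ∈ closedBall (0 : ℂ) 1) : ArcJoined (E a) (E b) := by
  by_cases hab : a = b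
  · exact Or.inl (by rw [hab])
  have hseg : MapsTo (fun s : ℝ => AffineMap.lineMap a b s) (Icc 0 1) (closedBall (0 : ℂ) 1) :=
    fun s hs => (convex_closedBall _ _).lineMap_mem ha hb hs
  refine Or.inr ⟨fun s => E (AffineMap.lineMap a b s),
    hE.comp AffineMap.lineMap_continuous.continuousOn hseg, ?_, by simp, by simp⟩
  exact hi.comp (AffineMap.lineMap_injective ℝ hab).injOn hseg

theorem ArcJoined.extend_disc {Z : Type*} [TopologicalSpace Z] [T2Space Z] {E : ℂ → Z}
    (hE : ContinuousOn E (closedBall 0 1)) (hi : InjOn E (closedBall 0 1)) {a b : ℂ}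
    (ha : a ∈ closedBall (0 : ℂ) 1) (hb : b ∈ closedBall (0 : ℂ) 1) {z : Z}
    (h : ArcJoined z (E a)) : ArcJoined z (E b) := by
  rcases h with rfl | ⟨α, hα, hαi, hα0, hα1⟩
  · exact arcJoined_of_disc hE hi ha hb
  have hD : IsClosed (E '' closedBall 0 1) :=
    ((isCompact_closedBall _ _).image_of_continuousOn hE).isClosed
  set T : Set ℝ := Icc 0 1 ∩ α ⁻¹' (E '' closedBall 0 1) with hT
  have hTc : IsCompact T :=
    isCompact_Icc.of_isClosed_subset (hα.preimage_isClosed_of_isClosed isClosed_Icc hD)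
      inter_subset_left
  have hTn : T.Nonempty := ⟨1, by simp, by rw [mem_preimage, hα1]; exact mem_image_of_mem _ ha⟩
  obtain ⟨⟨hτ0, hτ1⟩, a', ha', haτ⟩ := hTc.sInf_mem hTn
  have hlt : ∀ t ∈ Icc (0 : ℝ) 1, α t ∈ E '' closedBall 0 1 → sInf T ≤ t := fun t ht h =>
    csInf_le hTc.bddBelow ⟨ht, h⟩
  set τ := sInf T with hτ
  rcases hτ0.eq_or_lt with h0 | h0
  · rw [← hα0, h0, ← haτ]
    exact arcJoined_of_disc hE hi ha' hb
  by_cases hab : a' = b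
  · refine Or.inr ⟨fun s => α (τ * s), ?_, ?_, by simpa using hα0, by simp [← hab, haτ]⟩
    · exact hα.comp (by fun_prop) fun s hs => ⟨by nlinarith [hs.1], by nlinarith [hs.1, hs.2]⟩
    · intro s hs s' hs' hss
      have := hαi (x₁ := τ * s) (x₂ := τ * s') ⟨by nlinarith [hs.1], by nlinarith [hs.1, hs.2]⟩
        ⟨by nlinarith [hs'.1], by nlinarith [hs'.1, hs'.2]⟩ hss
      exact mul_left_cancel₀ h0.ne' this
  have hm1 : ∀ s ∈ Icc (0 : ℝ) 1, s ≤ 1 / 2 → τ * (2 * s) ∈ Icc (0 : ℝ) 1 := fun s hs h =>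
    ⟨by have := hs.1; positivity, by nlinarith [hs.1]⟩
  have hm2 : ∀ s ∈ Icc (0 : ℝ) 1, 1 / 2 ≤ s →
      AffineMap.lineMap a' b (2 * s - 1) ∈ closedBall (0 : ℂ) 1 := fun s hs h =>
    (convex_closedBall _ _).lineMap_mem ha' hb ⟨by linarith, by linarith [hs.2]⟩
  refine Or.inr ⟨fun s => if s ≤ 1 / 2 then α (τ * (2 * s)) else
    E (AffineMap.lineMap a' b (2 * s - 1)), ?_, ?_, by simpa using hα0, by norm_num⟩
  · refine ContinuousOn.if ?_ ?_ ?_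
    · rintro s ⟨hs, hs'⟩
      have : s = 1 / 2 := by
        have := frontier_le_subset_eq continuous_id continuous_const hs'
        exact this
      subst this
      norm_num [haτ]
    · refine hα.comp (by fun_prop) fun s hs => hm1 s hs.1 ?_
      have := closure_le_eq (f := fun s : ℝ => s) (g := fun _ => (1 / 2 : ℝ))
        continuous_id continuous_const ▸ hs.2
      exact this
    · refine hE.comp (AffineMap.lineMap_continuous.comp (by fun_prop)).continuousOn
        fun s hs => hm2 s hs.1 ?_
      have h2 := hs.2
      have : {a : ℝ | ¬ a ≤ 1 / 2} ⊆ {a : ℝ | 1 / 2 ≤ a} := fun x hx => (not_le.1 hx).le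
      exact (closure_minimal this (isClosed_le continuous_const continuous_id)) h2
  · have cross : ∀ s ∈ Icc (0 : ℝ) 1, ∀ s' ∈ Icc (0 : ℝ) 1, s ≤ 1 / 2 → 1 / 2 < s' →
        α (τ * (2 * s)) ≠ E (AffineMap.lineMap a' b (2 * s' - 1)) := by
      intro s hs s' hs' h h' heq
      have h1 := hlt _ (hm1 s hs h) (heq ▸ mem_image_of_mem _ (hm2 s' hs' h'.le))
      have h2 : s = 1 / 2 := by nlinarith
      rw [h2, show τ * (2 * (1 / 2)) = τ by ring, ← haτ] at heq
      have h3 := hi ha' (hm2 s' hs' h'.le) heq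
      have h4 : (AffineMap.lineMap a' b (0 : ℝ) : ℂ) = AffineMap.lineMap a' b (2 * s' - 1) := by
        rw [← h3]; simp
      have := AffineMap.lineMap_injective ℝ hab h4
      linarith
    intro s hs s' hs' hss
    by_cases h : s ≤ 1 / 2 <;> by_cases h' : s' ≤ 1 / 2
    · simp only [h, h', if_true] at hss
      have := hαi (hm1 s hs h) (hm1 s' hs' h') hss
      have := mul_left_cancel₀ h0.ne' this
      linarith
    · simp only [h, h', if_true, if_false] at hss
      exact absurd hss (cross s hs s' hs' h (not_le.1 h'))
    · simp only [h, h', if_true, if_false] at hss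
      exact absurd hss.symm (cross s' hs' s hs h' (not_le.1 h))
    · simp only [h, h', if_false] at hss
      have := hi (hm2 s hs (not_le.1 h).le) (hm2 s' hs' (not_le.1 h').le) hss
      have := AffineMap.lineMap_injective ℝ hab this
      linarith

/-- The set of points joined to a given point by simple arcs is open and closed. -/
theorem isClopen_arcJoined {Z : Type*} [TopologicalSpace Z] [T2Space Z] (hZ : HasDiscs Z) (z : Z) :
    IsClopen {z' | ArcJoined z z'} := by
  constructor
  · rw [← isOpen_compl_iff, isOpen_iff_mem_nhds]
    intro z' hz'
    obtain ⟨E, hE, hi, h0, ho⟩ := hZ z'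
    refine Filter.mem_of_superset (ho.mem_nhds ⟨0, by simp, h0⟩) ?_
    rintro _ ⟨a, ha, rfl⟩ h
    exact hz' (h0 ▸ h.extend_disc hE hi (ball_subset_closedBall ha) (by simp))
  · rw [isOpen_iff_mem_nhds]
    intro z' hz'
    obtain ⟨E, hE, hi, h0, ho⟩ := hZ z'
    refine Filter.mem_of_superset (ho.mem_nhds ⟨0, by simp, h0⟩) ?_
    rintro _ ⟨a, ha, rfl⟩
    have hz'' : ArcJoined z (E 0) := h0 ▸ hz'
    exact hz''.extend_disc hE hi (by simp) (ball_subset_closedBall ha)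

theorem HasDiscs.eventually_connectedComponents_eq {Z : Type*} [TopologicalSpace Z]
    (hZ : HasDiscs Z) (z : Z) :
    ∀ᶠ z' in 𝓝 z, ConnectedComponents.mk z' = ConnectedComponents.mk z := by
  obtain ⟨E, hE, hi, h0, ho⟩ := hZ z
  have hmem : z ∈ E '' ball 0 1 := ⟨0, by simp, h0⟩
  filter_upwards [ho.mem_nhds hmem] with z' hz'
  have hp : IsPreconnected (E '' ball 0 1) :=
    (convex_ball _ _).isPreconnected.image E (hE.mono ball_subset_closedBall)
  exact ConnectedComponents.coe_eq_coe'.2 (hp.subset_connectedComponent hmem hz')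

/-- A free involution either moves some point along a simple arc, or it separates the components. -/
theorem exists_arc_or_choice {Z : Type*} [TopologicalSpace Z] [T2Space Z] (hZ : HasDiscs Z)
    {t : Z → Z} (ht : Continuous t) (htt : ∀ z, t (t z) = z) (hne : ∀ z, t z ≠ z) :
    (∃ z, ∃ α : ℝ → Z, ContinuousOn α (Icc 0 1) ∧ InjOn α (Icc 0 1) ∧ α 0 = z ∧ α 1 = t z) ∨
    ∃ P : Z → Prop, (∀ z, P (t z) ↔ ¬ P z) ∧ ∀ z, ∀ᶠ z' in 𝓝 z, (P z' ↔ P z) := by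
  classical
  by_cases h : ∃ z, ArcJoined z (t z)
  · obtain ⟨z, h | h⟩ := h
    · exact absurd h.symm (hne z)
    · exact Or.inl ⟨z, h⟩
  push Not at h
  right
  have hcc : ∀ z, ConnectedComponents.mk z ≠ ConnectedComponents.mk (t z) := by
    intro z heq
    have h1 : t z ∈ connectedComponent z := ConnectedComponents.coe_eq_coe'.1 heq.symm
    exact h z ((isClopen_arcJoined hZ z).connectedComponent_subset (Or.inl rfl) h1)
  let lo : LinearOrder (ConnectedComponents Z) := linearOrderOfSTO WellOrderingRel
  refine ⟨fun z => ConnectedComponents.mk z < ConnectedComponents.mk (t z), fun z => ?_,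
    fun z => ?_⟩
  · simp only [htt]
    rw [not_lt]
    exact ⟨le_of_lt, fun h => lt_of_le_of_ne h (hcc z).symm⟩
  · filter_upwards [hZ.eventually_connectedComponents_eq z,
      ht.continuousAt.eventually (hZ.eventually_connectedComponents_eq (t z))] with z' h1 h2
    simp only [h1, h2]

/-- Shortening an arc from `z` to `t z` to one that is simple modulo `t`. -/
theorem exists_minimal_subarc {Z : Type*} [TopologicalSpace Z] [T2Space Z] {t : Z → Z}
    (ht : Continuous t) (hne : ∀ z, t z ≠ z) {z : Z} {α : ℝ → Z}
    (hα : ContinuousOn α (Icc 0 1)) (hi : InjOn α (Icc 0 1)) (h0 : α 0 = z) (h1 : α 1 = t z) :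
    ∃ β : ℝ → Z, ContinuousOn β (Icc 0 1) ∧ β 1 = t (β 0) ∧
      ∀ s ∈ Icc (0 : ℝ) 1, ∀ s' ∈ Icc (0 : ℝ) 1, s < s' →
        β s' ≠ β s ∧ (β s' = t (β s) → s = 0 ∧ s' = 1) := by
  let Q : Set (ℝ × ℝ) := (Icc 0 1 ×ˢ Icc 0 1) ∩ {p | p.1 ≤ p.2} ∩ {p | α p.2 = t (α p.1)}
  have hcont1 : ContinuousOn (fun p : ℝ × ℝ => α p.2) ((Icc 0 1 ×ˢ Icc 0 1) ∩ {p | p.1 ≤ p.2}) :=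
    hα.comp (by fun_prop) fun p hp => hp.1.2
  have hcont2 : ContinuousOn (fun p : ℝ × ℝ => t (α p.1))
      ((Icc 0 1 ×ˢ Icc 0 1) ∩ {p | p.1 ≤ p.2}) :=
    ht.comp_continuousOn (hα.comp (by fun_prop) fun p hp => hp.1.1)
  have hQ0 : IsCompact ((Icc (0 : ℝ) 1 ×ˢ Icc (0 : ℝ) 1) ∩ {p : ℝ × ℝ | p.1 ≤ p.2}) :=
    (isCompact_Icc.prod isCompact_Icc).inter_right (isClosed_le continuous_fst continuous_snd)
  have hQ : IsCompact Q := by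
    refine hQ0.of_isClosed_subset ?_ inter_subset_left
    have := (hcont1.prodMk hcont2).preimage_isClosed_of_isClosed hQ0.isClosed
      (isClosed_diagonal (X := Z))
    exact this
  have hQn : Q.Nonempty := ⟨(0, 1), ⟨⟨⟨by simp, by simp⟩, by simp⟩, by simp [h0, h1]⟩⟩
  obtain ⟨⟨a, b⟩, ⟨⟨⟨ha, hb⟩, hab⟩, habt⟩, hmin⟩ := hQ.exists_isMinOn hQn
    (f := fun p : ℝ × ℝ => p.2 - p.1) (by fun_prop)
  simp only [mem_ofPred_eq] at hab habt ha hb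
  have hlt : a < b := by
    rcases hab.eq_or_lt with h | h
    · subst h
      exact absurd habt.symm (hne _)
    · exact h
  have hmem : ∀ s ∈ Icc (0 : ℝ) 1, a + s * (b - a) ∈ Icc (0 : ℝ) 1 := fun s hs =>
    ⟨by nlinarith [hs.1, ha.1], by nlinarith [hs.2, hb.2]⟩
  refine ⟨fun s => α (a + s * (b - a)), hα.comp (by fun_prop) hmem, by simpa using habt, ?_⟩
  intro s hs s' hs' hss
  refine ⟨fun heq => ?_, fun heq => ?_⟩
  · have := hi (hmem s' hs') (hmem s hs) heq
    nlinarith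
  · have h2 : (a + s * (b - a), a + s' * (b - a)) ∈ Q :=
      ⟨⟨⟨hmem s hs, hmem s' hs'⟩, by
        show a + s * (b - a) ≤ a + s' * (b - a)
        nlinarith⟩, heq⟩
    have h3 := hmin h2
    simp only [mem_ofPred_eq] at h3
    have h4 : (b - a) * 1 ≤ (b - a) * (s' - s) := by linarith
    have h5 := le_of_mul_le_mul_left h4 (by linarith)
    exact ⟨by linarith [hs.1, hs'.2], by linarith [hs.1, hs'.2]⟩

namespace SignCocycle

variable {ι W : Type*} [TopologicalSpace W]

theorem t2Space_tot [T2Space W] (c : SignCocycle ι W) (hc : ∀ w, w ∈ c.dom) : T2Space (c.Tot hc) := by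
  constructor
  intro x y hxy
  by_cases h : (c.core hc).proj x = (c.core hc).proj y
  · exact (c.isCoveringMap_proj hc).isSeparatedMap x y h hxy
  · obtain ⟨u, v, hu, hv, hxu, hyv, huv⟩ := t2_separation h
    have hp : Continuous (c.core hc).proj := (c.core hc).continuous_proj
    exact ⟨_, _, hu.preimage hp, hv.preimage hp, hxu, hyv, huv.preimage _⟩

theorem hasDiscs_tot (c : SignCocycle ι W) (hc : ∀ w, w ∈ c.dom)
    (hW : ∀ w : W, ∃ φ : OpenPartialHomeomorph W ℂ, w ∈ φ.source) : HasDiscs (c.Tot hc) := by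
  intro z
  obtain ⟨e, hze, he⟩ := (c.isCoveringMap_proj hc).isLocalHomeomorph z
  obtain ⟨φ, hφ⟩ := hW ((c.core hc).proj z)
  have hez : e z = (c.core hc).proj z := congrFun he.symm z
  let k := e.trans φ
  have hz : z ∈ k.source := by
    simp only [k, OpenPartialHomeomorph.trans_source]
    exact ⟨hze, by rw [mem_preimage, hez]; exact hφ⟩
  obtain ⟨r, hr, hball⟩ := Metric.nhds_basis_closedBall.mem_iff.1
    (k.open_target.mem_nhds (k.map_source hz))
  have hm : MapsTo (fun w : ℂ => k z + r * w) (closedBall 0 1) k.target := by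
    intro w hw
    apply hball
    simp only [mem_closedBall, dist_zero_right] at hw
    simp only [mem_closedBall, dist_eq_norm, add_sub_cancel_left, norm_mul, Complex.norm_real,
      Real.norm_eq_abs, abs_of_pos hr]
    nlinarith
  have hr' : (r : ℂ) ≠ 0 := by exact_mod_cast hr.ne'
  have hinj : Injective (fun w : ℂ => k z + r * w) := by
    intro a b hab
    simpa [hr'] using hab
  refine ⟨fun w => k.symm (k z + r * w), k.continuousOn_symm.comp (by fun_prop) hm,
    k.symm.injOn.comp hinj.injOn hm, by simp [k.left_inv hz], ?_⟩
  rw [show (fun w : ℂ => k.symm (k z + r * w)) = k.symm ∘ (fun w => k z + r * w) from rfl,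
    image_comp]
  refine k.symm.isOpen_image_of_subset_source ?_ ?_
  · have : (fun w : ℂ => k z + r * w) = (Homeomorph.addLeft (k z)) ∘ (Homeomorph.mulLeft₀ (r : ℂ) hr') := rfl
    rw [this]
    exact ((Homeomorph.addLeft (k z)).isOpenMap.comp (Homeomorph.mulLeft₀ (r : ℂ) hr').isOpenMap) _
      isOpen_ball
  · exact (hm.mono_left ball_subset_closedBall).image_subset

/-- A nontrivial cocycle on a surface is nontrivial along some simple closed curve. -/
theorem exists_loop [T2Space W] (c : SignCocycle ι W) (hc : ∀ w, w ∈ c.dom)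
    (hW : ∀ w : W, ∃ φ : OpenPartialHomeomorph W ℂ, w ∈ φ.source)
    (hno : ¬ ∃ σ, c.IsSection id σ) :
    ∃ (α : Icc (0 : ℝ) 1 → W) (σ : ι → Icc (0 : ℝ) 1 → ℤˣ), Continuous α ∧ α 0 = α 1 ∧
      (∀ s s', s < s' → α s = α s' → s = 0 ∧ s' = 1) ∧ c.IsSection α σ ∧
      ∀ i, α 0 ∈ c.U i → σ i 1 = -σ i 0 := by
  classical
  have := c.t2Space_tot hc
  rcases exists_arc_or_choice (c.hasDiscs_tot hc hW) (c.continuous_flip hc) (c.flip_flip hc)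
    (c.flip_ne hc) with ⟨z, α, hα, hi, h0, h1⟩ | ⟨P, hP, hPl⟩
  · obtain ⟨β, hβ, hβ1, hβi⟩ := exists_minimal_subarc (c.continuous_flip hc)
      (c.flip_ne hc) hα hi h0 h1
    have hβc : Continuous (fun s : Icc (0 : ℝ) 1 => β s) :=
      continuousOn_iff_continuous_domRestrict.1 hβ
    refine ⟨fun s => (c.core hc).proj (β s), fun i s => c.coord hc i (β s),
      (c.core hc).continuous_proj.comp hβc, ?_, ?_, c.isSection_coord hc hβc (fun _ => rfl), ?_⟩
    · simp only [Icc.coe_zero, Icc.coe_one, hβ1, proj_flip]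
    · intro s s' hss heq
      obtain ⟨h2, h3⟩ := hβi s s.2 s' s'.2 hss
      rcases c.eq_or_eq_flip hc heq with h4 | h4
      · exact absurd h4 h2
      · obtain ⟨h5, h6⟩ := h3 h4
        exact ⟨Subtype.ext h5, Subtype.ext h6⟩
    · intro i _
      simp only [Icc.coe_zero, Icc.coe_one, hβ1, coord_flip]
  · refine absurd ⟨fun i w => if P (c.pt hc i w 1) then 1 else -1, ⟨fun i w hw => ?_,
      fun i j w (hwi : w ∈ c.U i) (hwj : w ∈ c.U j) => ?_⟩⟩ hno
    · have h1 : ContinuousAt (fun w => c.pt hc i w 1) w :=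
        (c.continuousOn_pt hc i 1).continuousAt ((c.isOpen i).mem_nhds hw)
      filter_upwards [h1.eventually (hPl _)] with w' hw'
      simp only [hw']
    · have h1 : c.pt hc i w 1 = c.pt hc j w (c.g i j w) := by
        refine c.ext_coord hc (i := j) hwj rfl ?_
        rw [c.coord_compat hc (i := i) (z := c.pt hc i w 1) hwi hwj, coord_pt _ _ hwi,
          coord_pt _ _ hwj, mul_one]
        rfl
      simp only [id]
      rcases Int.units_eq_one_or (c.g i j w) with hg | hg
      · rw [hg] at h1
        rw [h1, hg, one_mul]
      · have h2 : c.pt hc i w 1 = c.flip hc (c.pt hc j w 1) := by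
          rw [h1, hg]
          refine c.ext_coord hc (i := j) hwj rfl ?_
          rw [coord_flip, coord_pt _ _ hwj, coord_pt _ _ hwj]
        rw [h2, hg]
        by_cases h3 : P (c.pt hc j w 1)
        · simp [hP, h3]
        · simp [hP, h3]

end SignCocycle

/-! ### Double covers -/

/-- A separated local homeomorphism with at most two points in every fibre. -/
structure IsDoubleCover {Y B : Type*} [TopologicalSpace Y] [TopologicalSpace B] (p : Y → B) :
    Prop where
  isLocalHomeomorph : IsLocalHomeomorph p
  isSeparatedMap : IsSeparatedMap p
  three : ∀ x y z, p x = p y → p x = p z → x = y ∨ x = z ∨ y = z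

namespace IsDoubleCover

variable {Y B A : Type*} [TopologicalSpace Y] [TopologicalSpace B] {p : Y → B}

theorem continuous (hp : IsDoubleCover p) : Continuous p := hp.isLocalHomeomorph.continuous

/-- Whether two lifts agree is locally constant. -/
theorem eventually_eq_iff [TopologicalSpace A] (hp : IsDoubleCover p) {u v : A → Y} {a : A} (hu : ContinuousAt u a)
    (hv : ContinuousAt v a) (huv : ∀ᶠ a' in 𝓝 a, p (u a') = p (v a')) :
    ∀ᶠ a' in 𝓝 a, (u a' = v a' ↔ u a = v a) := by
  by_cases h : u a = v a
  · obtain ⟨e, hue, rfl⟩ := hp.isLocalHomeomorph (u a)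
    filter_upwards [huv, hu (e.open_source.mem_nhds hue),
      hv (e.open_source.mem_nhds (h ▸ hue))] with a' h1 h2 h3
    exact iff_of_true (e.injOn h2 h3 h1) h
  · obtain ⟨s, t, hs, ht, hus, hvt, hst⟩ := hp.isSeparatedMap _ _ huv.self_of_nhds h
    filter_upwards [hu (hs.mem_nhds hus), hv (ht.mem_nhds hvt)] with a' h2 h3
    exact iff_of_false (fun h4 => hst.le_bot ⟨h2, by rw [h4]; exact h3⟩) h

/-- A local inverse of the projection around a point. -/
def chart (hp : IsDoubleCover p) (y : Y) : OpenPartialHomeomorph Y B :=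
  (hp.isLocalHomeomorph y).choose

theorem mem_chart_source (hp : IsDoubleCover p) (y : Y) : y ∈ (hp.chart y).source :=
  (hp.isLocalHomeomorph y).choose_spec.1

theorem chart_apply (hp : IsDoubleCover p) (y x : Y) : hp.chart y x = p x :=
  (congrFun (hp.isLocalHomeomorph y).choose_spec.2 x).symm

theorem mem_chart_target (hp : IsDoubleCover p) (y : Y) : p y ∈ (hp.chart y).target := by
  rw [← hp.chart_apply y y]
  exact (hp.chart y).map_source (hp.mem_chart_source y)

theorem proj_chart_symm (hp : IsDoubleCover p) {y : Y} {z : B} (hz : z ∈ (hp.chart y).target) :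
    p ((hp.chart y).symm z) = z := by
  rw [← hp.chart_apply y, (hp.chart y).right_inv hz]

theorem chart_symm_proj (hp : IsDoubleCover p) (y : Y) : (hp.chart y).symm (p y) = y := by
  rw [← hp.chart_apply y y, (hp.chart y).left_inv (hp.mem_chart_source y)]

theorem sign_eq (hp : IsDoubleCover p) {x y z : Y} (h : p x = p y) (h' : p x = p z)
    [Decidable (x = y)] [Decidable (x = z)] [Decidable (y = z)] :
    (if x = z then 1 else -1 : ℤˣ) = (if x = y then 1 else -1) * (if y = z then 1 else -1) := by
  have h3 := hp.three x y z h h'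
  split_ifs <;> simp_all

open Classical in
/-- The sign cocycle of a double cover. -/
def cocycle (hp : IsDoubleCover p) : SignCocycle Y B where
  U y := (hp.chart y).target
  isOpen y := (hp.chart y).open_target
  g y y' z := if (hp.chart y).symm z = (hp.chart y').symm z then 1 else -1
  locConst y y' z hz hz' := by
    filter_upwards [hp.eventually_eq_iff ((hp.chart y).continuousAt_symm hz)
      ((hp.chart y').continuousAt_symm hz') (by
        filter_upwards [(hp.chart y).open_target.mem_nhds hz,
          (hp.chart y').open_target.mem_nhds hz'] with z' h1 h2
        rw [hp.proj_chart_symm h1, hp.proj_chart_symm h2])] with z' h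
    simp only [h]
  cocycle x y z b hx hy hz := (hp.sign_eq
    ((hp.proj_chart_symm hx).trans (hp.proj_chart_symm hy).symm)
    ((hp.proj_chart_symm hx).trans (hp.proj_chart_symm hz).symm)).symm

theorem dom_cocycle (hp : IsDoubleCover p) : hp.cocycle.dom = range p := by
  ext b
  constructor
  · rintro ⟨y, hy⟩
    exact ⟨_, hp.proj_chart_symm hy⟩
  · rintro ⟨y, rfl⟩
    exact ⟨y, hp.mem_chart_target y⟩

open Classical in
/-- The section of the cocycle of a double cover determined by a lift. -/
def lifted (hp : IsDoubleCover p) (F : A → Y) (y : Y) (a : A) : ℤˣ :=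
  if (hp.chart y).symm (p (F a)) = F a then 1 else -1

theorem isSection_lifted [TopologicalSpace A] (hp : IsDoubleCover p) {F : A → Y} (hF : Continuous F) :
    hp.cocycle.IsSection (p ∘ F) (hp.lifted F) where
  locConst y a ha := by
    have hc := hp.continuous.comp hF
    have h1 : ContinuousAt (fun a => (hp.chart y).symm (p (F a))) a :=
      ContinuousAt.comp (f := fun a => p (F a)) ((hp.chart y).continuousAt_symm ha)
        hc.continuousAt
    filter_upwards [hp.eventually_eq_iff h1 hF.continuousAt (by
        filter_upwards [hc.continuousAt ((hp.chart y).open_target.mem_nhds ha)] with a' h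
        exact hp.proj_chart_symm h)] with a' h
    unfold lifted
    by_cases h5 : (hp.chart y).symm (p (F a)) = F a
    · rw [if_pos h5, if_pos (h.2 h5)]
    · rw [if_neg h5, if_neg (h5 ∘ h.1)]
  compat y y' a hy hy' := by
    have h1 := hp.proj_chart_symm hy
    have h2 := hp.proj_chart_symm hy'
    classical
    have h3 := hp.cocycle.g_symm (i := y) (j := y') hy hy'
    rw [← h3]
    unfold lifted cocycle
    exact hp.sign_eq (h2.trans h1.symm) h2

theorem lifted_self (hp : IsDoubleCover p) {F : A → Y} {y : Y} {a : A} (h : F a = y) :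
    hp.lifted F y a = 1 := by
  subst h
  exact if_pos (hp.chart_symm_proj _)

theorem lifted_eq_one_iff (hp : IsDoubleCover p) {F : A → Y} {y : Y} {a : A} :
    hp.lifted F y a = 1 ↔ (hp.chart y).symm (p (F a)) = F a := by
  unfold lifted
  split_ifs with h
  · simp [h]
  · simp only [h, iff_false]; decide

theorem lifted_neg (hp : IsDoubleCover p) {A' : Type*} {F : A → Y} {G : A' → Y} {y : Y} {a : A}
    {b : A'} (h : p (F a) = p (G b)) (hne : F a ≠ G b) (hy : p (F a) ∈ (hp.chart y).target) :
    hp.lifted G y b = -hp.lifted F y a := by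
  have h1 := hp.proj_chart_symm hy
  have h3 := hp.three _ (F a) (G b) h1 (h1.trans h)
  unfold lifted
  rw [← h]
  split_ifs <;> simp_all

/-- If the cocycle of a double cover is trivial over `S`, then the preimage of `S` is
disconnected. -/
theorem not_isPreconnected_preimage (hp : IsDoubleCover p) {S : Set B} {σ : Y → S → ℤˣ}
    (hσ : hp.cocycle.IsSection (Subtype.val : S → B) σ) {x x' : Y} (hx : p x ∈ S)
    (hxx : p x = p x') (hne : x ≠ x') : ¬ IsPreconnected (p ⁻¹' S) := by
  intro hpre
  have : PreconnectedSpace (p ⁻¹' S) := Subtype.preconnectedSpace hpre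
  have h1 := hp.isSection_lifted (F := (Subtype.val : p ⁻¹' S → Y)) continuous_subtype_val
  have h2 := hσ.comp (k := fun y : p ⁻¹' S => (⟨p y, y.2⟩ : S))
    ((hp.continuous.comp continuous_subtype_val).subtype_mk _)
  have hx' : p x' ∈ S := hxx ▸ hx
  obtain ⟨ε, hε⟩ := h2.exists_eq_mul h1 (hp.continuous.comp continuous_subtype_val)
    isPreconnected_univ (fun a _ => by
      rw [hp.dom_cocycle]; exact ⟨_, rfl⟩)
  have h3 := hε ⟨x, hx⟩ trivial x (hp.mem_chart_target x)
  have h4 := hε ⟨x', hx'⟩ trivial x (by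
    show p x' ∈ _
    rw [← hxx]; exact hp.mem_chart_target x)
  have h5 : hp.lifted (Subtype.val : p ⁻¹' S → Y) x ⟨x', hx'⟩ =
      -hp.lifted (Subtype.val : p ⁻¹' S → Y) x ⟨x, hx⟩ :=
    hp.lifted_neg hxx hne (hp.mem_chart_target x)
  have h6 : (⟨p x, hx⟩ : S) = ⟨p x', hx'⟩ := Subtype.ext hxx
  simp only at h3 h4
  rw [h5, ← h6, h3, mul_neg] at h4
  exact neg_ne_self_units _ h4.symm

/-- If the cocycle of a double cover changes sign along a closed curve, then the preimage of that
curve is connected. -/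
theorem isPreconnected_preimage (hp : IsDoubleCover p) {α : Icc (0 : ℝ) 1 → B}
    (hα : Continuous α) (h01 : α 0 = α 1) {σ : Y → Icc (0 : ℝ) 1 → ℤˣ}
    (hσ : hp.cocycle.IsSection α σ) (hflip : ∀ i, α 0 ∈ hp.cocycle.U i → σ i 1 = -σ i 0)
    (htwo : ∀ t, ∃ x x', x ≠ x' ∧ p x = α t ∧ p x' = α t) :
    IsPreconnected (p ⁻¹' range α) := by
  have hid := hp.isSection_lifted (F := (id : Y → Y)) continuous_id
  have step : ∀ (ε : ℤˣ) t, ∃ x, p x = α t ∧ ∀ y, α t ∈ (hp.chart y).target →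
      hp.lifted (id : Y → Y) y x = ε * σ y t := by
    intro ε t
    obtain ⟨x, x', hne, hx, hx'⟩ := htwo t
    have hxt : α t ∈ (hp.chart x).target := hx ▸ hp.mem_chart_target x
    have key : ∀ w, p w = α t → hp.lifted (id : Y → Y) x w = ε * σ x t →
        ∀ y, α t ∈ (hp.chart y).target → hp.lifted (id : Y → Y) y w = ε * σ y t := by
      intro w hw h y hy
      have h1 := hid.compat x y w (by rw [comp_apply, id, hw]; exact hxt)
        (by rw [comp_apply, id, hw]; exact hy)
      have h2 := hσ.compat x y t hxt hy
      rw [h1, h2, h, comp_apply, id, hw]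
      exact mul_left_comm _ _ _
    have hneg : hp.lifted (id : Y → Y) x x' = -hp.lifted (id : Y → Y) x x :=
      hp.lifted_neg (F := (id : Y → Y)) (G := (id : Y → Y)) (hx.trans hx'.symm) hne
        (hp.mem_chart_target x)
    have hone : hp.lifted (id : Y → Y) x x = 1 := hp.lifted_self rfl
    rcases Int.units_eq_one_or (ε * σ x t) with h | h
    · exact ⟨x, hx, key x hx (by rw [hone, h])⟩
    · exact ⟨x', hx', key x' hx' (by rw [hneg, hone, h])⟩
  choose L hL hLs using step
  have uniq : ∀ (t : Icc (0 : ℝ) 1) (x x' y : Y), p x = α t → p x' = α t →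
      α t ∈ (hp.chart y).target → hp.lifted (id : Y → Y) y x = hp.lifted (id : Y → Y) y x' →
      x = x' := by
    intro t x x' y hx hx' hy h
    by_contra hne
    have := hp.lifted_neg (F := (id : Y → Y)) (G := (id : Y → Y)) (y := y) (hx.trans hx'.symm) hne
      (by rw [id, hx]; exact hy)
    rw [← h] at this
    exact neg_ne_self_units _ this.symm
  have hLc : ∀ ε, Continuous (L ε) := by
    intro ε
    rw [continuous_iff_continuousAt]
    intro t
    set y := L ε t with hy
    have hyt : α t ∈ (hp.chart y).target := by
      rw [← hL ε t]; exact hp.mem_chart_target _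
    have h1 : ContinuousAt (fun t' => (hp.chart y).symm (α t')) t :=
      ContinuousAt.comp (f := α) ((hp.chart y).continuousAt_symm hyt) hα.continuousAt
    refine h1.congr ?_
    filter_upwards [hσ.locConst y t hyt, hα.continuousAt ((hp.chart y).open_target.mem_nhds hyt)]
      with t' h2 h3
    refine uniq t' _ _ y (hp.proj_chart_symm h3) (hL ε t') h3 ?_
    rw [hLs ε t' y h3, h2, ← hLs ε t y hyt, hp.lifted_self (F := (id : Y → Y)) (a := L ε t) hy.symm]
    rw [lifted_eq_one_iff, id, hp.proj_chart_symm h3]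
  have hjoin : L 1 1 = L (-1) 0 := by
    set y := L 1 1
    have h1 : α 1 ∈ (hp.chart y).target := by rw [← hL 1 1]; exact hp.mem_chart_target _
    have h0 : α 0 ∈ (hp.chart y).target := h01 ▸ h1
    refine uniq 1 _ _ y (hL 1 1) ((hL (-1) 0).trans h01) h1 ?_
    rw [hLs 1 1 y h1, hLs (-1) 0 y h0, hflip y h0]
    simp
  have hset : p ⁻¹' range α = range (L 1) ∪ range (L (-1)) := by
    ext x
    constructor
    · rintro ⟨t, ht⟩
      have hxt : α t ∈ (hp.chart x).target := ht ▸ hp.mem_chart_target x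
      have hone : hp.lifted (id : Y → Y) x x = 1 := hp.lifted_self rfl
      rcases Int.units_eq_one_or (σ x t) with h | h
      · exact Or.inl ⟨t, (uniq t _ _ x ht.symm (hL 1 t) hxt
          (by rw [hone, hLs 1 t x hxt, h]; rfl)).symm⟩
      · exact Or.inr ⟨t, (uniq t _ _ x ht.symm (hL (-1) t) hxt
          (by rw [hone, hLs (-1) t x hxt, h]; rfl)).symm⟩
    · rintro (⟨t, rfl⟩ | ⟨t, rfl⟩)
      · exact ⟨t, (hL 1 t).symm⟩
      · exact ⟨t, (hL (-1) t).symm⟩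
  rw [hset]
  exact IsPreconnected.union (L 1 1) ⟨1, rfl⟩ ⟨0, hjoin.symm⟩ (isPreconnected_range (hLc 1))
    (isPreconnected_range (hLc (-1)))

end IsDoubleCover

/-! ### The orientation cocycle of a surface -/

theorem OpenPartialHomeomorph.goodAt_symm {W : Type*} [TopologicalSpace W]
    (φ : OpenPartialHomeomorph W ℂ) {z : ℂ} (hz : z ∈ φ.target) : GoodAt φ.symm z :=
  goodAt_iff.2 ⟨_, φ.open_target.mem_nhds hz, φ.continuousOn_symm, φ.symm.injOn⟩

theorem GoodAt.chart_comp {W : Type*} [TopologicalSpace W] {q : ℂ → W} {z : ℂ} (hq : GoodAt q z)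
    (φ : OpenPartialHomeomorph W ℂ) (hz : q z ∈ φ.source) : GoodAt (φ ∘ q) z :=
  hq.comp (φ.open_source.mem_nhds hz) φ.continuousOn φ.injOn

/-- Change of charts multiplies the sign of the degree by that of the transition map. -/
theorem sdeg_chart_change {W : Type*} [TopologicalSpace W] {q : ℂ → W} {z : ℂ} (hq : GoodAt q z)
    (φ ψ : OpenPartialHomeomorph W ℂ) (hφ : q z ∈ φ.source) (hψ : q z ∈ ψ.source) :
    sdeg (ψ ∘ q) z = sdeg (ψ ∘ φ.symm) (φ (q z)) * sdeg (φ ∘ q) z := by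
  have h1 := hq.chart_comp φ hφ
  have h2 : GoodAt (ψ ∘ φ.symm) ((φ ∘ q) z) :=
    (φ.goodAt_symm (φ.map_source hφ)).chart_comp ψ (by
      rw [φ.left_inv hφ]; exact hψ)
  have h3 := sdeg_comp h1 h2
  rw [← comp_apply (f := φ) (g := q), ← h3]
  refine sdeg_congr (hq.chart_comp ψ hψ) ?_
  filter_upwards [hq.continuousAt (φ.open_source.mem_nhds hφ)] with w hw
  simp only [comp_apply]
  rw [φ.left_inv hw]

/-- The orientation cocycle of a surface. -/
def orCocycle (W : Type*) [TopologicalSpace W] : SignCocycle (OpenPartialHomeomorph W ℂ) W where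
  U φ := φ.source
  isOpen φ := φ.open_source
  g φ ψ w := sdeg (ψ ∘ φ.symm) (φ w)
  locConst φ ψ w hφ hψ := by
    have h : GoodAt (ψ ∘ φ.symm) (φ w) := (φ.goodAt_symm (φ.map_source hφ)).chart_comp ψ (by
      rw [φ.left_inv hφ]; exact hψ)
    exact (φ.continuousAt hφ).eventually h.eventually_sdeg_eq
  cocycle φ ψ χ w hφ hψ hχ := by
    have h := sdeg_chart_change (φ.goodAt_symm (φ.map_source hφ)) ψ χ
      (by rwa [φ.left_inv hφ]) (by rwa [φ.left_inv hφ])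
    rw [φ.left_inv hφ] at h
    rw [h, mul_comm]

/-- Local embeddings of planar sets carry the tautological section of the orientation cocycle. -/
theorem isSection_sdeg {W : Type*} [TopologicalSpace W] {q : ℂ → W} {Ω : Set ℂ}
    (hq : ∀ z ∈ Ω, GoodAt q z) :
    (orCocycle W).IsSection (fun z : Ω => q z) (fun φ z => sdeg (φ ∘ q) z) where
  locConst φ z hz := continuous_subtype_val.continuousAt.eventually
    ((hq z z.2).chart_comp φ hz).eventually_sdeg_eq
  compat φ ψ z hφ hψ := sdeg_chart_change (hq z z.2) φ ψ hφ hψ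

/-! ### Circles in the sphere -/

theorem one_lt_rank_E2 : 1 < Module.rank ℝ E2 := by
  rw [← Module.finrank_eq_rank, finrank_euclideanSpace_fin]
  norm_num

/-- The circle as a subset of the complex numbers. -/
def circleToComplex (x : Circle1) : ℂ := ⟨(x : E2) 0, (x : E2) 1⟩

theorem continuous_circleToComplex : Continuous circleToComplex := by
  have : circleToComplex = fun x : Circle1 =>
      (((x : E2) 0 : ℝ) : ℂ) + (((x : E2) 1 : ℝ) : ℂ) * Complex.I := by
    funext x
    apply Complex.ext <;> simp [circleToComplex]
  rw [this]
  fun_prop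

theorem injective_circleToComplex : Injective circleToComplex := by
  intro x y h
  have h0 := congrArg Complex.re h
  have h1 := congrArg Complex.im h
  apply Subtype.ext
  ext i
  fin_cases i
  · exact h0
  · exact h1

theorem normSq_circleToComplex (x : Circle1) : Complex.normSq (circleToComplex x) = 1 := by
  have h : ‖(x : E2)‖ = 1 := by simp
  rw [EuclideanSpace.norm_eq, Real.sqrt_eq_one] at h
  simp only [Fin.sum_univ_two, Real.norm_eq_abs, sq_abs] at h
  rw [Complex.normSq_apply]
  simp only [circleToComplex]
  linarith

/-- A circle does not contain a planar disc. -/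
theorem IsCircleSet.not_goodAt {A : Set S3} (hA : IsCircleSet A) {q : ℂ → S3} {z : ℂ}
    (hq : GoodAt q z) (hqA : ∀ᶠ z' in 𝓝 z, q z' ∈ A) : False := by
  classical
  obtain ⟨e⟩ := hA
  obtain ⟨s, hs, hc, hi⟩ := goodAt_iff.1 hq
  obtain ⟨t, hts, hto, hzt⟩ := _root_.mem_nhds_iff.1 (Filter.inter_mem hs hqA)
  let f : ℂ → ℂ := fun w => if hw : q w ∈ A then circleToComplex (e ⟨q w, hw⟩) else 0
  have hft : ∀ w (hw : w ∈ t), f w = circleToComplex (e ⟨q w, (hts hw).2⟩) := fun w hw => by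
    have : q w ∈ A := (hts hw).2
    simp only [f, this, dite_true]
  let g : ℂ → ℂ := fun w => (starRingEnd ℂ) (f z) * (f z - f w)
  have hfz : Complex.normSq (f z) = 1 := by rw [hft z hzt]; exact normSq_circleToComplex _
  have hfz0 : (starRingEnd ℂ) (f z) ≠ 0 := by
    intro h
    rw [← Complex.normSq_conj, h] at hfz
    simp at hfz
  have hfc : ContinuousOn f t := by
    rw [continuousOn_iff_continuous_domRestrict]
    have : t.domRestrict f = fun w : t => circleToComplex (e ⟨q w, (hts w.2).2⟩) := by
      funext w
      exact hft w w.2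
    rw [this]
    have hqt : Continuous fun w : t => q w :=
      continuousOn_iff_continuous_domRestrict.1 (hc.mono fun w hw => (hts hw).1)
    exact continuous_circleToComplex.comp (e.continuous.comp (hqt.subtype_mk _))
  have hfi : InjOn f t := by
    intro w hw w' hw' h
    rw [hft w hw, hft w' hw'] at h
    have := congrArg Subtype.val (e.injective (injective_circleToComplex h))
    exact hi (hts hw).1 (hts hw').1 this
  have hg : GoodAt g z := by
    refine goodAt_iff.2 ⟨t, hto.mem_nhds hzt, ?_, ?_⟩
    · exact continuousOn_const.mul (continuousOn_const.sub hfc)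
    · intro w hw w' hw' h
      have := mul_left_cancel₀ hfz0 h
      exact hfi hw hw' (sub_right_injective this)
  refine hg.not_eventually_re_nonneg (by simp [g]) ?_
  filter_upwards [hto.mem_nhds hzt] with w hw
  have hfw : Complex.normSq (f w) = 1 := by rw [hft w hw]; exact normSq_circleToComplex _
  rw [Complex.normSq_apply] at hfz hfw
  simp only [g, Complex.mul_re, Complex.conj_re, Complex.conj_im, Complex.sub_re, Complex.sub_im]
  nlinarith [sq_nonneg ((f z).re - (f w).re), sq_nonneg ((f z).im - (f w).im)]

instance connectedSpace_circle1 : ConnectedSpace Circle1 :=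
  Subtype.connectedSpace (isConnected_sphere one_lt_rank_E2 _ zero_le_one)

instance nontrivial_circle1 : Nontrivial Circle1 := by
  have h : ∀ i : Fin 2, EuclideanSpace.single i (1 : ℝ) ∈ Metric.sphere (0 : E2) 1 := by simp
  refine ⟨⟨⟨_, h 0⟩, ⟨_, h 1⟩, fun heq => ?_⟩⟩
  have := congrArg (fun x : Circle1 => (x : E2) 0) heq
  simp at this

/-- A circle has no isolated points. -/
theorem IsCircleSet.exists_ne {A : Set S3} (hA : IsCircleSet A) {x : S3} (hx : x ∈ A) {U : Set S3}
    (hU : U ∈ 𝓝 x) : ∃ y ∈ A, y ∈ U ∧ y ≠ x := by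
  obtain ⟨e⟩ := hA
  have : ConnectedSpace A := e.symm.surjective.connectedSpace e.symm.continuous
  have : Nontrivial A := e.toEquiv.nontrivial
  have hne : (𝓝[≠] (⟨x, hx⟩ : A)).NeBot := inferInstance
  have h1 : ∀ᶠ y : A in 𝓝[≠] (⟨x, hx⟩ : A), (y : S3) ∈ U :=
    (continuous_subtype_val.continuousAt (x := (⟨x, hx⟩ : A))).eventually hU |>.filter_mono
      nhdsWithin_le_nhds
  obtain ⟨y, hy, hyne⟩ := (h1.and self_mem_nhdsWithin).exists
  exact ⟨y, y.2, hy, fun h => hyne (Subtype.ext h)⟩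

/-! ### Linearization of smooth involutions -/

theorem exists_linearization {h : S3 → S3} (hs : ContMDiff (𝓡 3) (𝓡 3) (⊤ : ℕ∞) h)
    (hh : Involutive h) {p : S3} (hp : h p = p) :
    ∃ (Φ : OpenPartialHomeomorph S3 E3) (L : E3 →L[ℝ] E3), p ∈ Φ.source ∧ Φ p = 0 ∧
      (∀ v, L (L v) = v) ∧ ∀ᶠ y in 𝓝 (0 : E3), h (Φ.symm y) = Φ.symm (L y) := by
  let φ : OpenPartialHomeomorph S3 E3 := chartAt E3 p
  have hpφ : p ∈ φ.source := mem_chart_source E3 p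
  have hhc : Continuous h := hs.continuous
  let F : E3 → E3 := φ ∘ h ∘ φ.symm
  set a := φ p with ha
  have hat : a ∈ φ.target := φ.map_source hpφ
  have hsa : φ.symm a = p := φ.left_inv hpφ
  have hF : ContDiffAt ℝ (⊤ : ℕ∞) F a := by
    have h1 := (contMDiffAt_iff.1 (hs p)).2
    rw [hp] at h1
    simp only [mfld_simps] at h1
    exact contDiffWithinAt_univ.1 h1
  have hFa : F a = a := by simp only [F, comp_apply, hsa, hp]; exact ha.symm
  have hsc : ContinuousAt φ.symm a := φ.continuousAt_symm hat
  have hev1 : ∀ᶠ x in 𝓝 a, h (φ.symm x) ∈ φ.source := by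
    have : ContinuousAt (fun x => h (φ.symm x)) a := hhc.continuousAt.comp hsc
    exact this (φ.open_source.mem_nhds (by show h (φ.symm a) ∈ φ.source; rw [hsa, hp]; exact hpφ))
  have hFF : ∀ᶠ x in 𝓝 a, F (F x) = x := by
    filter_upwards [hev1, φ.open_target.mem_nhds hat] with x hx hxt
    simp only [F, comp_apply]
    rw [φ.left_inv hx, hh, φ.right_inv hxt]
  have hFs : HasStrictFDerivAt F (fderiv ℝ F a) a := hF.hasStrictFDerivAt (by simp)
  set L := fderiv ℝ F a with hL
  have hLL : ∀ v, L (L v) = v := by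
    have h1 : HasFDerivAt (F ∘ F) (L.comp L) a :=
      HasFDerivAt.comp a (by rw [hFa]; exact hFs.hasFDerivAt) hFs.hasFDerivAt
    have h2 : HasFDerivAt (F ∘ F) (ContinuousLinearMap.id ℝ E3) a :=
      (hasFDerivAt_id a).congr_of_eventuallyEq hFF
    have h3 := h1.unique h2
    intro v
    exact DFunLike.congr_fun h3 v
  let G : E3 → E3 := fun x => (1 / 2 : ℝ) • ((x - a) + L (F x - a))
  have hG : HasStrictFDerivAt G ((ContinuousLinearEquiv.refl ℝ E3 : E3 ≃L[ℝ] E3) : E3 →L[ℝ] E3)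
      a := by
    have h1 : HasStrictFDerivAt G ((1 / 2 : ℝ) • (ContinuousLinearMap.id ℝ E3 + L.comp L)) a := by
      refine HasStrictFDerivAt.fun_const_smul (HasStrictFDerivAt.fun_add ?_ ?_) _
      · exact (hasStrictFDerivAt_id a).sub_const a
      · exact L.hasStrictFDerivAt.comp a (hFs.sub_const a)
    convert h1 using 1
    ext1 v
    simp only [smul_apply, add_apply,
      ContinuousLinearMap.comp_apply, hLL, ContinuousLinearMap.id_apply,
      ContinuousLinearEquiv.coe_refl]
    rw [← two_smul ℝ v, smul_smul]
    norm_num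
  let Ge := hG.toOpenPartialHomeomorph G
  have hGe : ∀ x, Ge x = G x := fun x => rfl
  have haG : a ∈ Ge.source := hG.mem_toOpenPartialHomeomorph_source
  let Φ := φ.trans Ge
  have hpΦ : p ∈ Φ.source := by
    rw [OpenPartialHomeomorph.trans_source]
    exact ⟨hpφ, haG⟩
  have hΦ : ∀ x, Φ x = G (φ x) := fun x => rfl
  have hΦp : Φ p = 0 := by
    rw [hΦ, ← ha]
    simp [G, hFa]
  refine ⟨Φ, L, hpΦ, hΦp, hLL, ?_⟩
  have hsΦ : Φ.symm 0 = p := by rw [← hΦp, Φ.left_inv hpΦ]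
  have h0t : (0 : E3) ∈ Φ.target := hΦp ▸ Φ.map_source hpΦ
  have hc0 : ContinuousAt Φ.symm 0 := Φ.continuousAt_symm h0t
  have hc1 : ContinuousAt (fun y => h (Φ.symm y)) 0 := hhc.continuousAt.comp hc0
  filter_upwards [hc0 (Φ.open_source.mem_nhds (hsΦ ▸ hpΦ)), Φ.open_target.mem_nhds h0t,
    hc1 (Φ.open_source.mem_nhds (by show h (Φ.symm 0) ∈ Φ.source; rw [hsΦ, hp]; exact hpΦ))] with y h1 h2 h3
  have hx1 : Φ.symm y ∈ φ.source := by
    have h1' : Φ.symm y ∈ Φ.source := h1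
    rw [OpenPartialHomeomorph.trans_source] at h1'
    exact h1'.1
  have hx2 : h (Φ.symm y) ∈ φ.source := by
    have h1' : h (Φ.symm y) ∈ Φ.source := h3
    rw [OpenPartialHomeomorph.trans_source] at h1'
    exact h1'.1
  have key : Φ (h (Φ.symm y)) = L y := by
    conv_rhs => rw [← Φ.right_inv h2]
    rw [hΦ, hΦ]
    simp only [G, F, comp_apply, map_smul, map_add, hLL]
    rw [φ.left_inv hx1, φ.left_inv hx2, hh, add_comm]
  rw [← key, Φ.left_inv h3]

/-- Near a fixed point, a smooth involution whose fixed point set is a circle is a rotation by a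
half turn. -/
theorem exists_rotation_chart {h : S3 → S3} (hs : ContMDiff (𝓡 3) (𝓡 3) (⊤ : ℕ∞) h)
    (hh : Involutive h) (hfix : IsCircleSet (fixedPoints h)) {p : S3} (hp : h p = p) :
    ∃ (Ψ : OpenPartialHomeomorph (ℝ × ℂ) S3), (0, 0) ∈ Ψ.source ∧ Ψ (0, 0) = p ∧
      ∀ᶠ y in 𝓝 ((0, 0) : ℝ × ℂ), h (Ψ y) = Ψ (y.1, -y.2) := by
  obtain ⟨Φ, L, hpΦ, hΦp, hLL, hev⟩ := exists_linearization hs hh hp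
  have hsΦ : Φ.symm 0 = p := by rw [← hΦp, Φ.left_inv hpΦ]
  have h0t : (0 : E3) ∈ Φ.target := hΦp ▸ Φ.map_source hpΦ
  let P : Submodule ℝ E3 := LinearMap.ker ((L : E3 →ₗ[ℝ] E3) - LinearMap.id)
  let N : Submodule ℝ E3 := LinearMap.ker ((L : E3 →ₗ[ℝ] E3) + LinearMap.id)
  have hP : ∀ v, v ∈ P ↔ L v = v := fun v => by
    simp [P, LinearMap.mem_ker, sub_eq_zero]
  have hN : ∀ v, v ∈ N ↔ L v = -v := fun v => by
    simp [N, LinearMap.mem_ker, add_eq_zero_iff_eq_neg]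
  have hPN : IsCompl P N := by
    constructor
    · rw [Submodule.disjoint_def]
      intro v h1 h2
      rw [hP] at h1
      rw [hN, h1] at h2
      have h3 : (2 : ℝ) • v = 0 := by
        rw [two_smul]
        exact add_eq_zero_iff_eq_neg.2 h2
      exact (smul_eq_zero.1 h3).resolve_left two_ne_zero
    · rw [codisjoint_iff, eq_top_iff]
      intro v _
      rw [Submodule.mem_sup]
      refine ⟨(1 / 2 : ℝ) • (v + L v), (hP _).2 ?_, (1 / 2 : ℝ) • (v - L v), (hN _).2 ?_, ?_⟩
      · simp [hLL, add_comm]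
      · simp only [map_smul, map_sub, hLL]
        rw [← smul_neg, neg_sub]
      · rw [← smul_add, add_add_sub_cancel, ← two_smul ℝ v, smul_smul]
        norm_num
  have hfr : Module.finrank ℝ P + Module.finrank ℝ N = 3 := by
    have := Submodule.finrank_add_eq_of_isCompl hPN
    simpa using this
  have hlt : ¬ 2 ≤ Module.finrank ℝ P := by
    intro h2
    rw [← Complex.finrank_real_complex] at h2
    obtain ⟨j, hj⟩ := finrank_le_iff_exists_linearMap.1 h2
    let k : ℂ →ₗ[ℝ] E3 := P.subtype.comp j
    have hk : Injective k := (Submodule.injective_subtype P).comp hj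
    have hkc : Continuous k := k.continuous_of_finiteDimensional
    have hk0 : k 0 = 0 := map_zero k
    refine hfix.not_goodAt (q := Φ.symm ∘ k) (z := 0) ?_ ?_
    · refine (goodAt_of_injective hkc hk 0).comp (s := Φ.target) ?_ Φ.continuousOn_symm Φ.symm.injOn
      exact Φ.open_target.mem_nhds (by rw [hk0]; exact h0t)
    · have : ∀ᶠ z in 𝓝 (0 : ℂ), h (Φ.symm (k z)) = Φ.symm (L (k z)) :=
        (hkc.continuousAt (x := 0)).eventually (by rw [hk0]; exact hev)
      filter_upwards [this] with z hz
      have hz' : L (k z) = k z := (hP _).1 (j z).2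
      rw [hz'] at hz
      exact hz
  have hne : Module.finrank ℝ P ≠ 0 := by
    intro h0
    have hbot : P = ⊥ := Submodule.finrank_eq_zero.1 h0
    have hU : ∀ᶠ x in 𝓝 p, x ∈ Φ.source ∧ h (Φ.symm (Φ x)) = Φ.symm (L (Φ x)) ∧
        L (Φ x) ∈ Φ.target := by
      have hc : ContinuousAt Φ p := Φ.continuousAt hpΦ
      have hLc : ContinuousAt (fun x => L (Φ x)) p := L.continuous.continuousAt.comp hc
      have hev' : ∀ᶠ x in 𝓝 p, h (Φ.symm (Φ x)) = Φ.symm (L (Φ x)) :=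
        hc.eventually (by rw [hΦp]; exact hev)
      filter_upwards [Φ.open_source.mem_nhds hpΦ, hev', hLc (Φ.open_target.mem_nhds
        (by show L (Φ p) ∈ Φ.target; rw [hΦp, map_zero]; exact h0t))] with x h1 h2 h3
      exact ⟨h1, h2, h3⟩
    obtain ⟨y, hy, ⟨h1, h2, h3⟩, hyp⟩ := hfix.exists_ne (x := p) hp hU
    rw [Φ.left_inv h1, (hy : h y = y)] at h2
    have h4 : Φ y = L (Φ y) := by
      conv_lhs => rw [h2]
      exact Φ.right_inv h3
    have h5 : Φ y ∈ P := (hP _).2 h4.symm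
    rw [hbot, Submodule.mem_bot, ← hΦp] at h5
    exact hyp (Φ.injOn h1 hpΦ h5)
  have hP1 : Module.finrank ℝ ℝ = Module.finrank ℝ P := by
    rw [Module.finrank_self]; omega
  have hN2 : Module.finrank ℝ ℂ = Module.finrank ℝ N := by
    rw [Complex.finrank_real_complex]; rw [Module.finrank_self] at hP1; omega
  let e : (ℝ × ℂ) ≃ₗ[ℝ] E3 := ((LinearEquiv.ofFinrankEq ℝ P hP1).prodCongr
    (LinearEquiv.ofFinrankEq ℂ N hN2)).trans (Submodule.prodEquivOfIsCompl P N hPN)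
  have he : ∀ s w, e (s, w) = (LinearEquiv.ofFinrankEq ℝ P hP1 s : E3) +
      (LinearEquiv.ofFinrankEq ℂ N hN2 w : E3) := fun s w => rfl
  have hLe : ∀ s w, L (e (s, w)) = e (s, -w) := by
    intro s w
    rw [he, he, map_add, (hP _).1 (LinearEquiv.ofFinrankEq ℝ P hP1 s).2,
      (hN _).1 (LinearEquiv.ofFinrankEq ℂ N hN2 w).2, map_neg]
    rfl
  let eh : (ℝ × ℂ) ≃ₜ E3 := e.toContinuousLinearEquiv.toHomeomorph
  have heh : ∀ x, eh x = e x := fun x => rfl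
  have he0 : eh (0, 0) = 0 := map_zero e
  refine ⟨eh.toOpenPartialHomeomorph.trans Φ.symm, ?_, ?_, ?_⟩
  · simp only [OpenPartialHomeomorph.trans_source, Homeomorph.toOpenPartialHomeomorph_source,
      univ_inter, mem_preimage, OpenPartialHomeomorph.symm_source]
    show eh (0, 0) ∈ Φ.target
    rw [he0]; exact h0t
  · show Φ.symm (eh (0, 0)) = p
    rw [he0, hsΦ]
  · have h1 : ∀ᶠ y in 𝓝 ((0, 0) : ℝ × ℂ), h (Φ.symm (eh y)) = Φ.symm (L (eh y)) :=
      (eh.continuous.continuousAt (x := (0, 0))).eventually (by rw [he0]; exact hev)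
    filter_upwards [h1] with y hy
    show h (Φ.symm (eh y)) = Φ.symm (eh (y.1, -y.2))
    rw [hy, heh, heh]
    congr 1
    exact hLe y.1 y.2

/-! ### The quotient by an involution -/

namespace IsQuotProj

variable {h π : S3 → S3}

theorem continuous (hπ : IsQuotProj h π) : Continuous π := hπ.1

theorem surjective (hπ : IsQuotProj h π) : Surjective π := hπ.2.1

theorem eq_iff (hπ : IsQuotProj h π) {x y : S3} : π x = π y ↔ y = x ∨ y = h x := hπ.2.2 x y

theorem map_h (hπ : IsQuotProj h π) (x : S3) : π (h x) = π x := (hπ.eq_iff.2 (Or.inr rfl)).symm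

theorem eq_of_fixed (hπ : IsQuotProj h π) {x y : S3} (hx : h x = x) (hxy : π x = π y) : y = x := by
  rcases hπ.eq_iff.1 hxy with h1 | h1
  · exact h1
  · rw [h1, hx]

theorem isClosedMap (hπ : IsQuotProj h π) : IsClosedMap π := hπ.continuous.isClosedMap

theorem isOpenMap (hπ : IsQuotProj h π) (hc : Continuous h) : IsOpenMap π := by
  have hq : IsQuotientMap π := hπ.isClosedMap.isQuotientMap hπ.continuous hπ.surjective
  intro U hU
  rw [← hq.isOpen_preimage]
  have : π ⁻¹' (π '' U) = U ∪ h ⁻¹' U := by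
    ext y
    constructor
    · rintro ⟨x, hx, hxy⟩
      rcases hπ.eq_iff.1 hxy.symm with h1 | h1
      · exact Or.inl (h1 ▸ hx)
      · exact Or.inr (show h y ∈ U from h1 ▸ hx)
    · rintro (hy | hy)
      · exact ⟨y, hy, rfl⟩
      · exact ⟨h y, hy, hπ.map_h y⟩
  rw [this]
  exact hU.union (hU.preimage hc)

/-- The restriction of the projection to the complement of the fixed point set. -/
def proj (h π : S3 → S3) : ↥(fixedPoints h)ᶜ → S3 := fun x => π x

theorem isDoubleCover (hπ : IsQuotProj h π) (hc : Continuous h) :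
    IsDoubleCover (proj h π) where
  isLocalHomeomorph := by
    rw [isLocalHomeomorph_iff_isOpenEmbedding_restrict]
    intro x
    have hne : h x ≠ x := x.2
    obtain ⟨u, v, hu, hv, hxu, hxv, huv⟩ := t2_separation hne.symm
    have hO : IsOpen ((fixedPoints h)ᶜ) := (isClosed_fixedPoints hc).isOpen_compl
    have hUo : IsOpen (Subtype.val ⁻¹' (u ∩ h ⁻¹' v) : Set ↥(fixedPoints h)ᶜ) :=
      (hu.inter (hv.preimage hc)).preimage continuous_subtype_val
    refine ⟨Subtype.val ⁻¹' (u ∩ h ⁻¹' v), hUo.mem_nhds ⟨hxu, hxv⟩, ?_⟩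
    apply IsOpenEmbedding.of_continuous_injective_isOpenMap
    · exact (hπ.continuous.comp continuous_subtype_val).comp continuous_subtype_val
    · intro a b hab
      rcases hπ.eq_iff.1 hab with h1 | h1
      · exact Subtype.ext (Subtype.ext h1.symm)
      · have hb : (b : ↥(fixedPoints h)ᶜ).1 ∈ v := by rw [h1]; exact a.2.2
        exact absurd hb (disjoint_left.1 huv b.2.1)
    · exact ((hπ.isOpenMap hc).comp hO.isOpenMap_subtype_val).comp hUo.isOpenMap_subtype_val
  isSeparatedMap := T2Space.isSeparatedMap _
  three x y z hxy hxz := by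
    rcases hπ.eq_iff.1 hxy with h1 | h1
    · exact Or.inl (Subtype.ext h1.symm)
    · rcases hπ.eq_iff.1 hxz with h2 | h2
      · exact Or.inr (Or.inl (Subtype.ext h2.symm))
      · exact Or.inr (Or.inr (Subtype.ext (h1.trans h2.symm)))

theorem range_proj (hπ : IsQuotProj h π) : range (proj h π) = (π '' fixedPoints h)ᶜ := by
  ext y
  constructor
  · rintro ⟨x, rfl⟩ ⟨x', hx', hxx⟩
    exact x.2 (by rw [hπ.eq_of_fixed hx' hxx]; exact hx')
  · intro hy
    obtain ⟨x, rfl⟩ := hπ.surjective y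
    exact ⟨⟨x, fun hx => hy ⟨x, hx, rfl⟩⟩, rfl⟩

theorem mem_image_fixed (hπ : IsQuotProj h π) {x : S3} : π x ∈ π '' fixedPoints h ↔ h x = x := by
  constructor
  · rintro ⟨y, hy, hyx⟩
    rw [hπ.eq_of_fixed hy hyx]; exact hy
  · exact fun hx => ⟨x, hx, rfl⟩

end IsQuotProj

theorem IsCoveringMap.isDoubleCover {Y : Type*} [TopologicalSpace Y] {O : Set S3} (hO : IsClosed O)
    {p : Y → ↥(Oᶜ)} (hp : IsCoveringMap p) (h2 : ∀ x : ↥(Oᶜ), (p ⁻¹' {x}).ncard = 2) :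
    IsDoubleCover (fun y => (p y : S3)) where
  isLocalHomeomorph :=
    (hO.isOpen_compl.isOpenEmbedding_subtypeVal.isLocalHomeomorph).comp hp.isLocalHomeomorph
  isSeparatedMap x y hxy hne := hp.isSeparatedMap x y (Subtype.ext hxy) hne
  three x y z hxy hxz := by
    have hx : x ∈ p ⁻¹' {p x} := rfl
    have hy : y ∈ p ⁻¹' {p x} := (Subtype.ext hxy).symm
    have hz : z ∈ p ⁻¹' {p x} := (Subtype.ext hxz).symm
    obtain ⟨a, b, -, hab⟩ := Set.ncard_eq_two.1 (h2 (p x))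
    rw [hab] at hx hy hz
    rcases hx with rfl | rfl <;> rcases hy with rfl | rfl <;> rcases hz with rfl | rfl <;> simp

theorem exists_two_of_ncard {Y : Type*} {O : Set S3} {p : Y → ↥(Oᶜ)}
    (h2 : ∀ x : ↥(Oᶜ), (p ⁻¹' {x}).ncard = 2) {x : S3} (hx : x ∉ O) :
    ∃ y y', y ≠ y' ∧ (p y : S3) = x ∧ (p y' : S3) = x := by
  obtain ⟨a, b, hne, hab⟩ := Set.ncard_eq_two.1 (h2 ⟨x, hx⟩)
  have ha : a ∈ p ⁻¹' {⟨x, hx⟩} := by rw [hab]; simp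
  have hb : b ∈ p ⁻¹' {⟨x, hx⟩} := by rw [hab]; simp
  exact ⟨a, b, hne, congrArg Subtype.val ha, congrArg Subtype.val hb⟩

/-! ### Extending sections over a thin closed set -/

namespace SignCocycle

variable {ι κ W : Type*} [TopologicalSpace W]

/-- A section of the cocycle `d` over the set `S`. -/
def IsSecOn (d : SignCocycle ι W) (S : Set W) (σ : ι → W → ℤˣ) : Prop :=
  d.IsSection (Subtype.val : S → W) (fun i z => σ i z)

theorem IsSection.exists_isSecOn {d : SignCocycle ι W} {S : Set W} {τ : ι → S → ℤˣ}
    (h : d.IsSection (Subtype.val : S → W) τ) : ∃ σ, d.IsSecOn S σ := by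
  classical
  refine ⟨fun i z => if hz : z ∈ S then τ i ⟨z, hz⟩ else 1, ?_⟩
  have : (fun i (z : S) => if hz : (z : W) ∈ S then τ i ⟨z, hz⟩ else 1) = τ := by
    funext i z
    simp
  unfold IsSecOn
  rwa [this]

theorem IsSecOn.mono {d : SignCocycle ι W} {S S' : Set W} {σ : ι → W → ℤˣ} (h : d.IsSecOn S σ)
    (hS : S' ⊆ S) : d.IsSecOn S' σ :=
  IsSection.comp h (continuous_inclusion hS)

theorem IsSecOn.eventually {d : SignCocycle ι W} {S : Set W} {σ : ι → W → ℤˣ} (h : d.IsSecOn S σ)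
    (hS : IsOpen S) {i : ι} {z : W} (hz : z ∈ S) (hi : z ∈ d.U i) :
    ∀ᶠ z' in 𝓝 z, σ i z' = σ i z := by
  have h1 := h.locConst i ⟨z, hz⟩ hi
  have h2 := hS.isOpenEmbedding_subtypeVal.map_nhds_eq ⟨z, hz⟩
  rw [← h2, Filter.eventually_map]
  exact h1

theorem IsSecOn.exists_eq_mul {d : SignCocycle ι W} {S : Set W} {σ τ : ι → W → ℤˣ}
    (h : d.IsSecOn S σ) (h' : d.IsSecOn S τ) (hS : IsPreconnected S) (hd : S ⊆ d.dom) :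
    ∃ ε : ℤˣ, ∀ z ∈ S, ∀ i, z ∈ d.U i → σ i z = ε * τ i z := by
  have : PreconnectedSpace S := Subtype.preconnectedSpace hS
  obtain ⟨ε, hε⟩ := IsSection.exists_eq_mul h h' continuous_subtype_val isPreconnected_univ
    (fun a _ => hd a.2)
  exact ⟨ε, fun z hz i hi => hε ⟨z, hz⟩ trivial i hi⟩

theorem isOpen_dom (d : SignCocycle ι W) : IsOpen d.dom := by
  have : d.dom = ⋃ i, d.U i := by ext; simp [dom]
  rw [this]
  exact isOpen_iUnion d.isOpen

/-- The domain of the cocycle is dense and does not locally separate the space. -/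
structure IsThick (d : SignCocycle ι W) : Prop where
  dense : Dense d.dom
  exists_nhds : ∀ z, ∀ N ∈ 𝓝 z, ∃ V ⊆ N, V ∈ 𝓝 z ∧ IsPreconnected (V ∩ d.dom)

theorem IsThick.neBot {d : SignCocycle ι W} (hd : d.IsThick) (z : W) : (𝓝[d.dom] z).NeBot :=
  mem_closure_iff_nhdsWithin_neBot.1 (hd.dense z)

/-- The sections `σ` and `τ` differ by the sign `ε` near `z`. -/
def GermEq (d : SignCocycle ι W) (σ τ : ι → W → ℤˣ) (ε : ℤˣ) (z : W) : Prop :=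
  ∀ᶠ w in 𝓝[d.dom] z, ∀ i, w ∈ d.U i → σ i w = ε * τ i w

theorem GermEq.self {d : SignCocycle ι W} {σ τ : ι → W → ℤˣ} {ε : ℤˣ} {z : W}
    (h : d.GermEq σ τ ε z) {i : ι} (hi : z ∈ d.U i) : σ i z = ε * τ i z :=
  h.self_of_nhdsWithin ⟨i, hi⟩ i hi

theorem GermEq.eventually {d : SignCocycle ι W} {σ τ : ι → W → ℤˣ} {ε : ℤˣ} {z : W}
    (h : d.GermEq σ τ ε z) : ∀ᶠ z' in 𝓝 z, d.GermEq σ τ ε z' := by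
  unfold GermEq at h ⊢
  simp only [eventually_nhdsWithin_iff] at h ⊢
  exact eventually_eventually_nhds.2 h

theorem GermEq.trans {d : SignCocycle ι W} {σ τ υ : ι → W → ℤˣ} {ε ε' : ℤˣ} {z : W}
    (h : d.GermEq σ τ ε z) (h' : d.GermEq τ υ ε' z) : d.GermEq σ υ (ε * ε') z := by
  filter_upwards [h, h'] with w h1 h2 i hi
  rw [h1 i hi, h2 i hi, mul_assoc]

theorem GermEq.unique {d : SignCocycle ι W} (hd : d.IsThick) {σ τ : ι → W → ℤˣ} {ε ε' : ℤˣ} {z : W}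
    (h : d.GermEq σ τ ε z) (h' : d.GermEq σ τ ε' z) : ε = ε' := by
  have := hd.neBot z
  obtain ⟨w, h1, h2, i, hi⟩ := (h.and (h'.and self_mem_nhdsWithin)).exists
  exact mul_right_cancel ((h1 i hi).symm.trans (h2 i hi))

theorem IsThick.exists_germEq {d : SignCocycle ι W} (hd : d.IsThick) {σ τ : ι → W → ℤˣ} {V : Set W}
    {z : W} (hV : V ∈ 𝓝 z) (hσ : d.IsSecOn (V ∩ d.dom) σ) (hτ : d.IsSecOn (V ∩ d.dom) τ) :
    ∃ ε, d.GermEq σ τ ε z := by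
  obtain ⟨V', hV', hn, hc⟩ := hd.exists_nhds z V hV
  have hs := inter_subset_inter_left d.dom hV'
  obtain ⟨ε, hε⟩ := (hσ.mono hs).exists_eq_mul (hτ.mono hs) hc inter_subset_right
  refine ⟨ε, ?_⟩
  filter_upwards [nhdsWithin_le_nhds hn, self_mem_nhdsWithin] with w hw hwd i hi
  exact hε w ⟨hw, hwd⟩ i hi

open Classical in
/-- The cocycle comparing local sections of a thick cocycle. -/
def extend (d : SignCocycle ι W) (hd : d.IsThick) (V : κ → Set W) (hV : ∀ k, IsOpen (V k))
    (σ : κ → ι → W → ℤˣ) (hσ : ∀ k, d.IsSecOn (V k ∩ d.dom) (σ k)) : SignCocycle κ W where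
  U := V
  isOpen := hV
  g k l z := if h : ∃ ε, d.GermEq (σ k) (σ l) ε z then h.choose else 1
  locConst k l z hk hl := by
    have hVn : V k ∩ V l ∈ 𝓝 z := ((hV k).inter (hV l)).mem_nhds ⟨hk, hl⟩
    obtain ⟨ε, hε⟩ := hd.exists_germEq hVn
      ((hσ k).mono (inter_subset_inter_left _ inter_subset_left))
      ((hσ l).mono (inter_subset_inter_left _ inter_subset_right))
    have key : ∀ z', d.GermEq (σ k) (σ l) ε z' →
        (if h : ∃ ε, d.GermEq (σ k) (σ l) ε z' then h.choose else 1) = ε := fun z' hz' => by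
      have h : ∃ ε, d.GermEq (σ k) (σ l) ε z' := ⟨ε, hz'⟩
      rw [dif_pos h]
      exact h.choose_spec.unique hd hz'
    filter_upwards [hε.eventually] with z' hz'
    rw [key z hε, key z' hz']
  cocycle k l m z hk hl hm := by
    have main : ∀ k l, z ∈ V k → z ∈ V l → ∃ ε, d.GermEq (σ k) (σ l) ε z := fun k l hk hl =>
      hd.exists_germEq (((hV k).inter (hV l)).mem_nhds ⟨hk, hl⟩)
        ((hσ k).mono (inter_subset_inter_left _ inter_subset_left))
        ((hσ l).mono (inter_subset_inter_left _ inter_subset_right))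
    rw [dif_pos (main k l hk hl), dif_pos (main l m hl hm), dif_pos (main k m hk hm)]
    exact ((main k l hk hl).choose_spec.trans (main l m hl hm).choose_spec).unique hd
      (main k m hk hm).choose_spec

theorem extend_germEq (d : SignCocycle ι W) (hd : d.IsThick) (V : κ → Set W)
    (hV : ∀ k, IsOpen (V k)) (σ : κ → ι → W → ℤˣ) (hσ : ∀ k, d.IsSecOn (V k ∩ d.dom) (σ k))
    {k l : κ} {z : W} (hk : z ∈ V k) (hl : z ∈ V l) :
    d.GermEq (σ k) (σ l) ((d.extend hd V hV σ hσ).g k l z) z := by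
  have h : ∃ ε, d.GermEq (σ k) (σ l) ε z :=
    hd.exists_germEq (((hV k).inter (hV l)).mem_nhds ⟨hk, hl⟩)
      ((hσ k).mono (inter_subset_inter_left _ inter_subset_left))
      ((hσ l).mono (inter_subset_inter_left _ inter_subset_right))
  have : (d.extend hd V hV σ hσ).g k l z = h.choose := dif_pos h
  rw [this]
  exact h.choose_spec

/-- Local sections near every point give a global section if all cocycles on the whole space are
trivial. -/
theorem IsThick.exists_isSecOn {d : SignCocycle ι W} (hd : d.IsThick)
    (hloc : ∀ z, ∃ V, IsOpen V ∧ z ∈ V ∧ ∃ σ, d.IsSecOn (V ∩ d.dom) σ)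
    (htriv : ∀ c : SignCocycle W W, (∀ w, w ∈ c.dom) → ∃ σ, c.IsSection id σ) :
    ∃ σ, d.IsSecOn d.dom σ := by
  choose V hV hz σ hσ using hloc
  obtain ⟨s, hs⟩ := htriv (d.extend hd V hV σ hσ) (fun w => ⟨w, hz w⟩)
  have key : ∀ w p i, w ∈ V p → w ∈ d.U i → s w w * σ w i w = s p w * σ p i w := by
    intro w p i hp hi
    have h1 := hs.compat w p w (hz w) hp
    have h2 := (d.extend_germEq hd V hV σ hσ (hz w) hp).self hi
    simp only [id] at h1
    rw [h2, h1]
    rw [mul_left_comm, ← mul_assoc]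
  refine ⟨fun i w => s w w * σ w i w, ⟨fun i w hw => ?_, fun i j w hi hj => ?_⟩⟩
  · have ho : IsOpen (V w ∩ d.dom) := (hV w).inter d.isOpen_dom
    have h1 := (hσ w).eventually ho ⟨hz w, w.2⟩ hw
    have h2 := hs.locConst w w (hz w)
    suffices h : ∀ᶠ w' : W in 𝓝 (w : W), s w' w' * σ w' i w' = s w w * σ w i w from
      (continuous_subtype_val.continuousAt (x := w)).eventually h
    filter_upwards [h1, h2, (hV w).mem_nhds (hz w), (d.isOpen i).mem_nhds hw] with w' e1 e2 hw' hi
    rw [key w' w i hw' hi, e1, e2]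
  · have := (hσ w).compat i j ⟨w, hz w, w.2⟩ hi hj
    simp only at this ⊢
    rw [this, mul_left_comm]

/-- Two sections of a thick cocycle over a connected space differ by a sign. -/
theorem IsThick.exists_eq_mul [PreconnectedSpace W] {d : SignCocycle ι W} (hd : d.IsThick)
    {σ τ : ι → W → ℤˣ} (hσ : d.IsSecOn d.dom σ) (hτ : d.IsSecOn d.dom τ) :
    ∃ ε : ℤˣ, ∀ z i, z ∈ d.U i → σ i z = ε * τ i z := by
  have h : ∀ z, ∃ ε, d.GermEq σ τ ε z := fun z =>
    hd.exists_germEq (V := univ) Filter.univ_mem (by rwa [univ_inter]) (by rwa [univ_inter])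
  choose ε hε using h
  have hlc : IsLocallyConstant ε := by
    rw [IsLocallyConstant.iff_eventually_eq]
    intro z
    filter_upwards [(hε z).eventually] with z' hz'
    exact (hε z').unique hd hz'
  rcases isEmpty_or_nonempty W with hW | ⟨⟨z₀⟩⟩
  · exact ⟨1, fun z => hW.elim z⟩
  · refine ⟨ε z₀, fun z i hi => ?_⟩
    rw [← hlc.apply_eq_of_isPreconnected isPreconnected_univ trivial trivial (x := z)]
    exact (hε z).self hi

end SignCocycle

/-! ### Sign cocycles on the three-sphere -/

instance preconnectedSpace_S3 : PreconnectedSpace S3 :=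
  Subtype.preconnectedSpace (isPreconnected_sphere (by
    rw [← Module.finrank_eq_rank, finrank_euclideanSpace_fin]; norm_num) _ _)

instance fact_finrank_E4 : Fact (Module.finrank ℝ E4 = 3 + 1) := ⟨finrank_euclideanSpace_fin⟩

instance contractibleSpace_compl_singleton (v : S3) : ContractibleSpace ↥({v}ᶜ : Set S3) := by
  have e : ↥({v}ᶜ : Set S3) ≃ₜ E3 := by
    have h := (stereographic' 3 v).toHomeomorphSourceTarget
    rw [stereographic'_source, stereographic'_target] at h
    exact h.trans (Homeomorph.Set.univ E3)
  exact e.contractibleSpace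

theorem isPreconnected_compl_pair (v w : S3) : IsPreconnected ({v}ᶜ ∩ {w}ᶜ : Set S3) := by
  let φ := stereographic' 3 v
  have hs : φ.source = {v}ᶜ := stereographic'_source v
  have ht : φ.target = univ := stereographic'_target v
  have hr : 1 < Module.rank ℝ E3 := by
    rw [← Module.finrank_eq_rank, finrank_euclideanSpace_fin]; norm_num
  have h1 : IsPreconnected ({φ w}ᶜ : Set E3) := (isConnected_compl_singleton_of_one_lt_rank hr _).isPreconnected
  by_cases hw : w = v
  · subst hw
    rw [inter_self]
    exact isPreconnected_iff_preconnectedSpace.2 inferInstance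
  have : ({v}ᶜ ∩ {w}ᶜ : Set S3) = φ.symm '' {φ w}ᶜ := by
    ext x
    constructor
    · rintro ⟨h1, h2⟩
      refine ⟨φ x, fun h => h2 (φ.injOn (hs ▸ h1) (hs ▸ hw) h), φ.left_inv (hs ▸ h1)⟩
    · rintro ⟨y, hy, rfl⟩
      have hyt : y ∈ φ.target := by rw [ht]; trivial
      refine ⟨hs ▸ φ.map_target hyt, fun h => hy ?_⟩
      rw [← (h : φ.symm y = w), φ.right_inv hyt]
      rfl
  rw [this]
  exact h1.image _ (φ.continuousOn_symm.mono (by rw [ht]; exact subset_univ _))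

theorem SignCocycle.exists_section_S3 {κ : Type*} (c : SignCocycle κ S3) (hc : ∀ w, w ∈ c.dom) :
    ∃ σ, c.IsSection id σ := by
  classical
  have hv : ∃ v w : S3, v ≠ w := by
    have : Nontrivial S3 := by
      have h : ∀ i : Fin 4, EuclideanSpace.single i (1 : ℝ) ∈ Metric.sphere (0 : E4) 1 := by simp
      refine ⟨⟨⟨_, h 0⟩, ⟨_, h 1⟩, fun heq => ?_⟩⟩
      have := congrArg (fun x : S3 => (x : E4) 0) heq
      simp at this
    exact exists_pair_ne S3
  obtain ⟨v, w, hvw⟩ := hv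
  have hex : ∀ u : S3, ∃ σ, c.IsSecOn {u}ᶜ σ := fun u => by
    obtain ⟨σ, hσ⟩ := c.exists_section_of_contractible (f := (Subtype.val : ↥({u}ᶜ : Set S3) → S3))
      continuous_subtype_val (fun a => hc a)
    exact hσ.exists_isSecOn
  obtain ⟨σ, hσ⟩ := hex v
  obtain ⟨τ, hτ⟩ := hex w
  obtain ⟨ε, hε⟩ := (hσ.mono inter_subset_left).exists_eq_mul (hτ.mono inter_subset_right)
    (isPreconnected_compl_pair v w) (fun x _ => hc x)
  have hov : ∀ u : S3, IsOpen ({u}ᶜ : Set S3) := fun u => isOpen_compl_singleton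
  have hv' : ∀ z, z ≠ w → ∀ i, z ∈ c.U i →
      (if z = v then ε * τ i z else σ i z) = ε * τ i z := fun z hz i hi => by
    split_ifs with h
    · rfl
    · exact hε z ⟨h, hz⟩ i hi
  have hτ' : c.IsSecOn {w}ᶜ (fun i z => ε * τ i z) := IsSection.const_mul hτ ε
  refine ⟨fun i z => if z = v then ε * τ i z else σ i z, ⟨fun i z hz => ?_, fun i j z hi hj => ?_⟩⟩
  · by_cases h : z = v
    · have hzw : z ≠ w := h ▸ hvw
      filter_upwards [hτ'.eventually (hov w) hzw hz, (hov w).mem_nhds hzw, (c.isOpen i).mem_nhds hz]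
        with z' h1 h2 h3
      rw [hv' z' h2 i h3, hv' z hzw i hz]
      exact h1
    · filter_upwards [hσ.eventually (hov v) h hz, (hov v).mem_nhds h] with z' h1 h2
      rw [if_neg h, if_neg (show z' ≠ v from h2), h1]
  · by_cases h : z = v
    · have hzw : z ≠ w := h ▸ hvw
      rw [hv' z hzw i hi, hv' z hzw j hj]
      exact hτ'.compat i j ⟨z, hzw⟩ hi hj
    · rw [if_neg h, if_neg h]
      exact hσ.compat i j ⟨z, h⟩ hi hj

/-! ### Cocycles on the complement of the branch set -/

/-- The polar coordinate domain of radius `r`. -/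
def polarDomain (r : ℝ) : Set (ℝ × ℂ) := {a | |a.1| < r ∧ a.2.re < Real.log r}

theorem convex_polarDomain (r : ℝ) : Convex ℝ (polarDomain r) := by
  have h1 : Convex ℝ {a : ℝ × ℂ | a.1 ∈ ball (0 : ℝ) r} :=
    (convex_ball (0 : ℝ) r).is_linear_preimage (f := fun a : ℝ × ℂ => a.1) ⟨fun _ _ => rfl, fun _ _ => rfl⟩
  have h2 : Convex ℝ {a : ℝ × ℂ | a.2.re ∈ Iio (Real.log r)} :=
    (convex_Iio (Real.log r)).is_linear_preimage (f := fun a : ℝ × ℂ => a.2.re)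
      ⟨fun _ _ => rfl, fun c x => by simp⟩
  convert h1.inter h2 using 1
  ext a
  simp [polarDomain]

theorem isOpen_polarDomain (r : ℝ) : IsOpen (polarDomain r) :=
  IsOpen.inter (isOpen_lt (f := fun a : ℝ × ℂ => |a.1|) (g := fun _ => r) (by fun_prop) (by fun_prop))
    (isOpen_lt (f := fun a : ℝ × ℂ => a.2.re) (g := fun _ => Real.log r)
      (Complex.continuous_re.comp continuous_snd) continuous_const)

/-- Polar coordinates. -/
def polar (a : ℝ × ℂ) : ℝ × ℂ := (a.1, Complex.exp a.2)

theorem continuous_polar : Continuous polar := by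
  unfold polar; fun_prop

theorem isOpenMap_polar : IsOpenMap polar :=
  IsOpenMap.id.prodMap Complex.isOpenMap_exp

theorem norm_polar {r : ℝ} (hr : 0 < r) {a : ℝ × ℂ} (ha : a ∈ polarDomain r) :
    |(polar a).1| < r ∧ ‖(polar a).2‖ < r ∧ (polar a).2 ≠ 0 := by
  refine ⟨ha.1, ?_, Complex.exp_ne_zero _⟩
  simp only [polar, Complex.norm_exp]
  exact (Real.lt_log_iff_exp_lt hr).1 ha.2

theorem exists_polar {r : ℝ} {b : ℝ × ℂ} (h1 : |b.1| < r) (h2 : ‖b.2‖ < r) (h3 : b.2 ≠ 0) :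
    ∃ a ∈ polarDomain r, polar a = b := by
  have h0 : 0 < ‖b.2‖ := norm_pos_iff.2 h3
  refine ⟨(b.1, Complex.log b.2), ⟨h1, ?_⟩, ?_⟩
  · rw [Complex.log_re]
    exact Real.log_lt_log h0 h2
  · simp only [polar, Complex.exp_log h3]

theorem exists_fixed_nhds {h : S3 → S3} (hs : ContMDiff (𝓡 3) (𝓡 3) (⊤ : ℕ∞) h)
    (hh : Involutive h) (hfix : IsCircleSet (fixedPoints h)) {p : S3} (hp : h p = p)
    {N : Set S3} (hN : N ∈ 𝓝 p) :
    ∃ (r : ℝ) (Q : ℝ × ℂ → S3) (V : Set S3), 0 < r ∧ V ⊆ N ∧ IsOpen V ∧ p ∈ V ∧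
      ContinuousOn Q (polarDomain r) ∧ Q '' polarDomain r = V ∩ (fixedPoints h)ᶜ ∧
      (∀ a ∈ polarDomain r, h (Q a) = Q (a.1, a.2 + Real.pi * Complex.I)) ∧
      (∀ U ⊆ polarDomain r, IsOpen U → IsOpen (Q '' U)) ∧
      (∀ a ∈ polarDomain r, ∀ b ∈ polarDomain r, Q a = Q b →
        ∃ n : ℤ, b = (a.1, a.2 + n * (2 * Real.pi * Complex.I))) := by
  obtain ⟨Ψ, h0, hΨ0, hev⟩ := exists_rotation_chart hs hh hfix hp
  have hcΨ : ContinuousAt Ψ (0, 0) := Ψ.continuousAt h0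
  have hnb : {y | y ∈ Ψ.source ∧ Ψ y ∈ N ∧ h (Ψ y) = Ψ (y.1, -y.2)} ∈ 𝓝 ((0, 0) : ℝ × ℂ) := by
    filter_upwards [Ψ.open_source.mem_nhds h0, hcΨ (by rw [hΨ0]; exact hN), hev] with y a b c
    exact ⟨a, b, c⟩
  obtain ⟨r, hr, hball⟩ := Metric.mem_nhds_iff.1 hnb
  have hmem : ∀ y : ℝ × ℂ, y ∈ ball ((0, 0) : ℝ × ℂ) r ↔ |y.1| < r ∧ ‖y.2‖ < r := fun y => by
    rw [mem_ball, Prod.dist_eq, max_lt_iff, Real.dist_eq, sub_zero, dist_zero_right]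
  have hneg : ∀ y ∈ ball ((0, 0) : ℝ × ℂ) r, (y.1, -y.2) ∈ ball ((0, 0) : ℝ × ℂ) r := fun y hy => by
    rw [hmem] at hy ⊢
    simpa using hy
  have hsub : ball ((0, 0) : ℝ × ℂ) r ⊆ Ψ.source := fun y hy => (hball hy).1
  have hpol : ∀ a ∈ polarDomain r, polar a ∈ ball ((0, 0) : ℝ × ℂ) r := fun a ha =>
    (hmem _).2 ⟨(norm_polar hr ha).1, (norm_polar hr ha).2.1⟩
  refine ⟨r, Ψ ∘ polar, Ψ '' ball (0, 0) r, hr, ?_, ?_, ?_, ?_, ?_, ?_, ?_, ?_⟩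
  · rintro _ ⟨y, hy, rfl⟩
    exact (hball hy).2.1
  · exact Ψ.isOpen_image_of_subset_source isOpen_ball hsub
  · exact ⟨(0, 0), mem_ball_self hr, hΨ0⟩
  · exact Ψ.continuousOn.comp continuous_polar.continuousOn fun a ha => hsub (hpol a ha)
  · ext x
    constructor
    · rintro ⟨a, ha, rfl⟩
      refine ⟨⟨_, hpol a ha, rfl⟩, fun hx => ?_⟩
      have h1 : h (Ψ (polar a)) = Ψ (polar a) := hx
      rw [(hball (hpol a ha)).2.2] at h1
      have h2 := Ψ.injOn (hsub (hneg _ (hpol a ha))) (hsub (hpol a ha)) h1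
      have h3 := congrArg Prod.snd h2
      have h4 : -(polar a).2 = (polar a).2 := h3
      exact (norm_polar hr ha).2.2 (self_eq_neg.1 h4.symm)
    · rintro ⟨⟨y, hy, rfl⟩, hx⟩
      have hy2 : y.2 ≠ 0 := by
        intro h2
        apply hx
        show h (Ψ y) = Ψ y
        rw [(hball hy).2.2, h2, neg_zero, ← h2]
      obtain ⟨a, ha, rfl⟩ := exists_polar ((hmem y).1 hy).1 ((hmem y).1 hy).2 hy2
      exact ⟨a, ha, rfl⟩
  · intro a ha
    show h (Ψ (polar a)) = Ψ (polar (a.1, a.2 + Real.pi * Complex.I))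
    rw [(hball (hpol a ha)).2.2]
    congr 1
    simp [polar, Complex.exp_add, Complex.exp_pi_mul_I]
  · intro U hU ho
    rw [image_comp]
    refine Ψ.isOpen_image_of_subset_source (isOpenMap_polar U ho) ?_
    rintro _ ⟨a, ha, rfl⟩
    exact hsub (hpol a (hU ha))
  · intro a ha b hb hab
    have h1 : polar a = polar b := Ψ.injOn (hsub (hpol a ha)) (hsub (hpol b hb)) hab
    have h2 : (polar a).1 = (polar b).1 := congrArg Prod.fst h1
    have h3 : (polar a).2 = (polar b).2 := congrArg Prod.snd h1
    obtain ⟨n, hn⟩ := Complex.exp_eq_exp_iff_exists_int.1 h3.symm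
    exact ⟨n, Prod.ext h2.symm hn⟩

/-- Near a fixed point, the pullback of a cocycle has a section away from the fixed points. -/
theorem exists_local_section {ι : Type*} {h π : S3 → S3} (hs : ContMDiff (𝓡 3) (𝓡 3) (⊤ : ℕ∞) h)
    (hh : Involutive h) (hfix : IsCircleSet (fixedPoints h)) (hπ : IsQuotProj h π)
    (c : SignCocycle ι S3) (hc : c.dom = (π '' fixedPoints h)ᶜ) {p : S3} (hp : h p = p) :
    ∃ V, IsOpen V ∧ p ∈ V ∧ ∃ σ, (c.comap hπ.continuous).IsSecOn (V ∩ (fixedPoints h)ᶜ) σ := by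
  obtain ⟨r, Q, V, hr, -, hVo, hpV, hQc, hQi, hQh, hQo, hQe⟩ :=
    exists_fixed_nhds hs hh hfix hp Filter.univ_mem
  refine ⟨V, hVo, hpV, ?_⟩
  have hne : (polarDomain r).Nonempty := by
    refine ⟨(0, ((Real.log r - 1 : ℝ) : ℂ)), by simpa using hr, ?_⟩
    simp
  have : ContractibleSpace (polarDomain r) := (convex_polarDomain r).contractibleSpace hne
  have hQm : ∀ a : polarDomain r, Q a ∈ V ∩ (fixedPoints h)ᶜ := fun a => hQi ▸ mem_image_of_mem Q a.2
  let q : polarDomain r → ↥(V ∩ (fixedPoints h)ᶜ) := fun a => ⟨Q a, hQm a⟩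
  have hqc : Continuous q :=
    (continuousOn_iff_continuous_domRestrict.1 hQc).subtype_mk _
  have hqs : Surjective q := by
    rintro ⟨x, hx⟩
    obtain ⟨a, ha, hax⟩ := hQi.symm ▸ hx
    exact ⟨⟨a, ha⟩, Subtype.ext hax⟩
  have hqo : IsOpenMap q := by
    intro U hU
    have h1 : IsOpen (Q '' (Subtype.val '' U)) :=
      hQo _ (by rintro _ ⟨a, -, rfl⟩; exact a.2) ((isOpen_polarDomain r).isOpenMap_subtype_val U hU)
    convert h1.preimage continuous_subtype_val using 1
    ext x
    constructor
    · rintro ⟨a, ha, rfl⟩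
      exact ⟨a, ⟨a, ha, rfl⟩, rfl⟩
    · rintro ⟨_, ⟨a, ha, rfl⟩, hax⟩
      exact ⟨a, ha, Subtype.ext hax⟩
  have hqq : IsQuotientMap q := hqo.isQuotientMap hqc hqs
  let f : ↥(V ∩ (fixedPoints h)ᶜ) → S3 := fun x => π x
  have hf : Continuous f := hπ.continuous.comp continuous_subtype_val
  have hdom : ∀ a, f (q a) ∈ c.dom := fun a => by
    rw [hc]
    exact fun hx => (hQm a).2 (hπ.mem_image_fixed.1 hx)
  obtain ⟨σ, hσ⟩ := c.exists_section_of_contractible (f := f ∘ q) (hf.comp hqc) hdom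
  let T : polarDomain r → polarDomain r := fun a =>
    ⟨(a.1.1, a.1.2 + Real.pi * Complex.I), by
      obtain ⟨⟨s, ζ⟩, h1, h2⟩ := a
      exact ⟨h1, by simpa using h2⟩⟩
  have hT : Continuous T := by
    refine Continuous.subtype_mk ?_ _
    fun_prop
  have hfT : (f ∘ q) ∘ T = f ∘ q := by
    funext a
    show π (Q _) = π (Q a)
    rw [← hπ.map_h (Q a), hQh a a.2]
  have hσT : c.IsSection (f ∘ q) (fun i a => σ i (T a)) := by
    have := hσ.comp hT
    rwa [hfT] at this
  have : PreconnectedSpace (polarDomain r) := inferInstance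
  obtain ⟨ε, hε⟩ := hσT.exists_eq_mul hσ (hf.comp hqc) isPreconnected_univ (fun a _ => hdom a)
  have hTT : ∀ i a, f (q a) ∈ c.U i → σ i (T (T a)) = σ i a := by
    intro i a ha
    have ha' : f (q (T a)) ∈ c.U i := (congrArg (· ∈ c.U i) (congrFun hfT a)).mpr ha
    rw [hε (T a) trivial i ha', hε a trivial i ha, ← mul_assoc, Int.units_mul_self, one_mul]
  have hTf : ∀ a, f (q (T a)) = f (q a) := fun a => congrFun hfT a
  have hTTn : ∀ (n : ℕ) i a, f (q a) ∈ c.U i → σ i ((T ∘ T)^[n] a) = σ i a := by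
    intro n i
    induction n with
    | zero => intro a _; rfl
    | succ n ih =>
      intro a ha
      rw [iterate_succ_apply, ih _ (by simpa [hTf] using ha)]
      exact hTT i a ha
  have hTv : ∀ (n : ℕ) a, (((T ∘ T)^[n] a : polarDomain r) : ℝ × ℂ) =
      (a.1.1, a.1.2 + n * (2 * Real.pi * Complex.I)) := by
    intro n
    induction n with
    | zero => intro a; simp
    | succ n ih =>
      intro a
      rw [iterate_succ_apply, ih]
      simp only [T, comp_apply, Nat.cast_succ, Prod.mk.injEq, true_and]
      ring
  have hinv : ∀ i a a', q a = q a' → f (q a) ∈ c.U i → σ i a = σ i a' := by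
    intro i a a' haa ha
    obtain ⟨n, hn⟩ := hQe a a.2 a' a'.2 (congrArg Subtype.val haa)
    obtain ⟨m, rfl | rfl⟩ := n.eq_nat_or_neg
    · have : a' = (T ∘ T)^[m] a := Subtype.ext (by rw [hn, hTv]; simp)
      rw [this, hTTn m i a ha]
    · have : a = (T ∘ T)^[m] a' := by
        apply Subtype.ext
        rw [hTv, hn]
        exact Prod.ext rfl (by simp)
      rw [this, hTTn m i a' (haa ▸ ha)]
  obtain ⟨τ, hτ, -⟩ := hσ.descend hf hqq hinv
  exact SignCocycle.IsSection.exists_isSecOn (d := c.comap hπ.continuous) (τ := τ)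
    ⟨hτ.locConst, hτ.compat⟩

theorem dom_comap_proj {ι : Type*} {h π : S3 → S3} (hπ : IsQuotProj h π)
    (c : SignCocycle ι S3) (hc : c.dom = (π '' fixedPoints h)ᶜ) :
    (c.comap hπ.continuous).dom = (fixedPoints h)ᶜ := by
  ext x
  have : x ∈ (c.comap hπ.continuous).dom ↔ π x ∈ c.dom := Iff.rfl
  rw [this, hc, mem_compl_iff, hπ.mem_image_fixed]
  rfl

theorem isThick_comap_proj {ι : Type*} {h π : S3 → S3} (hs : ContMDiff (𝓡 3) (𝓡 3) (⊤ : ℕ∞) h)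
    (hh : Involutive h) (hfix : IsCircleSet (fixedPoints h)) (hπ : IsQuotProj h π)
    (c : SignCocycle ι S3) (hc : c.dom = (π '' fixedPoints h)ᶜ) :
    (c.comap hπ.continuous).IsThick where
  dense := by
    rw [dom_comap_proj hπ c hc]
    intro p
    by_cases hp : h p = p
    · rw [mem_closure_iff_nhds]
      intro N hN
      obtain ⟨r, Q, V, hr, hVN, -, -, -, hQi, -⟩ := exists_fixed_nhds hs hh hfix hp hN
      have hne : (0, ((Real.log r - 1 : ℝ) : ℂ)) ∈ polarDomain r := ⟨by simpa using hr, by simp⟩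
      have := hQi ▸ mem_image_of_mem Q hne
      exact ⟨_, hVN this.1, this.2⟩
    · exact subset_closure hp
  exists_nhds p N hN := by
    rw [dom_comap_proj hπ c hc]
    by_cases hp : h p = p
    · obtain ⟨r, Q, V, hr, hVN, hVo, hpV, hQc, hQi, -⟩ := exists_fixed_nhds hs hh hfix hp hN
      exact ⟨V, hVN, hVo.mem_nhds hpV, hQi ▸ (convex_polarDomain r).isPreconnected.image Q hQc⟩
    · have ho : IsOpen ((fixedPoints h)ᶜ) := (isClosed_fixedPoints hs.continuous).isOpen_compl
      have : LocallyConnectedSpace S3 := ChartedSpace.locallyConnectedSpace E3 S3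
      obtain ⟨V, ⟨hVo, hpV, hVc⟩, hVN⟩ :=
        (LocallyConnectedSpace.open_connected_basis p).mem_iff.1 (Filter.inter_mem hN (ho.mem_nhds hp))
      refine ⟨V, fun x hx => (hVN hx).1, hVo.mem_nhds hpV, ?_⟩
      rw [inter_eq_left.2 (show V ⊆ _ from fun x hx => (hVN hx).2)]
      exact hVc.isPreconnected

/-- A cocycle on the complement of the branch set is trivial, or becomes so when multiplied with the
cocycle of the quotient projection. -/
theorem exists_section_or_mul {ι : Type*} {h π : S3 → S3} (hs : ContMDiff (𝓡 3) (𝓡 3) (⊤ : ℕ∞) h)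
    (hh : Involutive h) (hfix : IsCircleSet (fixedPoints h)) (hπ : IsQuotProj h π)
    (c : SignCocycle ι S3) (hc : c.dom = (π '' fixedPoints h)ᶜ) :
    (∃ σ, c.IsSection (Subtype.val : ↥(π '' fixedPoints h)ᶜ → S3) σ) ∨
    ∃ σ, ((hπ.isDoubleCover hs.continuous).cocycle.mul c).IsSection
      (Subtype.val : ↥(π '' fixedPoints h)ᶜ → S3) σ := by
  have hD := hπ.isDoubleCover hs.continuous
  let d := c.comap hπ.continuous
  have hd : d.dom = (fixedPoints h)ᶜ := dom_comap_proj hπ c hc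
  have hthick : d.IsThick := isThick_comap_proj hs hh hfix hπ c hc
  have hO : IsOpen ((fixedPoints h)ᶜ) := (isClosed_fixedPoints hs.continuous).isOpen_compl
  obtain ⟨s, hsec⟩ : ∃ s, d.IsSecOn d.dom s := by
    refine hthick.exists_isSecOn (fun p => ?_) (fun c' hc' => c'.exists_section_S3 hc')
    by_cases hp : h p = p
    · obtain ⟨V, h1, h2, σ, h3⟩ := exists_local_section hs hh hfix hπ c hc hp
      exact ⟨V, h1, h2, σ, by rw [hd]; exact h3⟩
    · obtain ⟨i, hi⟩ : p ∈ d.dom := hd ▸ hp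
      refine ⟨d.U i, d.isOpen i, hi, fun j z => d.g i j z, ⟨fun j z hz => ?_, fun j k z hj hk => ?_⟩⟩
      · exact continuous_subtype_val.continuousAt.eventually (d.locConst i j z z.2.1 hz)
      · rw [mul_comm]
        exact (d.cocycle i j k z z.2.1 hj hk).symm
  have hsh : d.IsSecOn d.dom (fun i z => s i (h z)) := by
    have hm : ∀ z : d.dom, h z ∈ d.dom := fun z => by
      have hz : π z ∈ c.dom := z.2
      show π (h z) ∈ c.dom
      rwa [hπ.map_h]
    constructor
    · intro i z hz
      have hz' : h z ∈ d.U i := by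
        show π (h z) ∈ c.U i
        rw [hπ.map_h]; exact hz
      have h1 := hsec.eventually d.isOpen_dom (hm z) hz'
      exact (hs.continuous.comp continuous_subtype_val).continuousAt.eventually h1
    · intro i j z hi hj
      have h1 := hsec.compat i j ⟨h z, hm z⟩ (show π (h z) ∈ c.U i by rw [hπ.map_h]; exact hi)
        (show π (h z) ∈ c.U j by rw [hπ.map_h]; exact hj)
      have h2 : d.g i j (h z) = d.g i j z := by
        show c.g i j (π (h z)) = c.g i j (π z)
        rw [hπ.map_h]
      simp only at h1
      rw [h2] at h1
      exact h1
  obtain ⟨ε, hε⟩ := hthick.exists_eq_mul hsh hsec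
  let q : ↥(fixedPoints h)ᶜ → ↥(π '' fixedPoints h)ᶜ := fun x =>
    ⟨π x, hπ.range_proj ▸ mem_range_self (f := IsQuotProj.proj h π) x⟩
  have hqc : Continuous q := (hπ.continuous.comp continuous_subtype_val).subtype_mk _
  have hqq : IsQuotientMap q := by
    refine IsOpenMap.isQuotientMap ?_ hqc ?_
    · intro U hU
      have h1 : IsOpen (π '' (Subtype.val '' U)) :=
        hπ.isOpenMap hs.continuous _ (hO.isOpenMap_subtype_val U hU)
      convert h1.preimage continuous_subtype_val using 1
      ext x
      constructor
      · rintro ⟨a, ha, rfl⟩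
        exact ⟨a, ⟨a, ha, rfl⟩, rfl⟩
      · rintro ⟨_, ⟨a, ha, rfl⟩, hax⟩
        exact ⟨a, ha, Subtype.ext hax⟩
    · rintro ⟨y, hy⟩
      obtain ⟨x, rfl⟩ := hπ.range_proj.symm ▸ hy
      exact ⟨x, rfl⟩
  have hsX : c.IsSection (Subtype.val ∘ q) (fun i (x : ↥(fixedPoints h)ᶜ) => s i x) := by
    have h1 := hsec.mono (S' := (fixedPoints h)ᶜ) hd.ge
    exact ⟨h1.locConst, h1.compat⟩
  have hqe : ∀ a a', q a = q a' → a' = a ∨ (a' : S3) = h a := fun a a' haa => by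
    rcases hπ.eq_iff.1 (congrArg Subtype.val haa) with h1 | h1
    · exact Or.inl (Subtype.ext h1)
    · exact Or.inr h1
  rcases Int.units_eq_one_or ε with rfl | rfl
  · left
    obtain ⟨τ, hτ, -⟩ := hsX.descend continuous_subtype_val hqq (fun i a a' haa hi => by
      rcases hqe a a' haa with rfl | h1
      · rfl
      · have := hε a i hi
        rw [one_mul] at this
        rw [h1, this])
    exact ⟨τ, hτ⟩
  · right
    have hl := hD.isSection_lifted (F := id) continuous_id
    have hm : (hD.cocycle.mul c).IsSection (Subtype.val ∘ q) _ := SignCocycle.IsSection.mul hl hsX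
    obtain ⟨τ, hτ, -⟩ := hm.descend continuous_subtype_val hqq (fun i a a' haa hi => by
      rcases hqe a a' haa with rfl | h1
      · rfl
      · have h2 := hε a i.2 hi.2
        have h3 : (id a : ↥(fixedPoints h)ᶜ) ≠ id a' := fun h => a.2 (by
          have : (a : S3) = a' := congrArg Subtype.val h
          rw [← this] at h1
          exact h1.symm)
        have h4 := hD.lifted_neg (F := id) (G := id) (a := a) (b := a') (y := i.1)
          (congrArg Subtype.val haa) h3 hi.1
        rw [h4, h1, h2, neg_one_mul, neg_mul_neg])
    exact ⟨τ, hτ⟩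

/-! ### Sections along loops and linking -/

/-- The sign of a section around a closed path. -/
theorem SignCocycle.IsSection.exists_monodromy {ι W : Type*} [TopologicalSpace W]
    {c : SignCocycle ι W} {α : Icc (0 : ℝ) 1 → W} {σ : ι → Icc (0 : ℝ) 1 → ℤˣ}
    (hσ : c.IsSection α σ) (h01 : α 0 = α 1) :
    ∃ ε : ℤˣ, ∀ i, α 0 ∈ c.U i → σ i 1 = ε * σ i 0 := by
  by_cases h : α 0 ∈ c.dom
  · obtain ⟨i, hi⟩ := h
    refine ⟨σ i 1 * σ i 0, fun j hj => ?_⟩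
    rw [hσ.compat i j 1 (h01 ▸ hi) (h01 ▸ hj), hσ.compat i j 0 hi hj, ← h01]
    rcases Int.units_eq_one_or (σ i 0) with h | h <;> simp [h, mul_comm]
  · exact ⟨1, fun i hi => absurd ⟨i, hi⟩ h⟩

theorem SignCocycle.IsSection.descend_loop {ι W : Type*} [TopologicalSpace W] [T2Space W]
    {c : SignCocycle ι W} {α : Icc (0 : ℝ) 1 → W} {σ : ι → Icc (0 : ℝ) 1 → ℤˣ}
    (hσ : c.IsSection α σ) (hα : Continuous α)
    (hinj : ∀ s s', s < s' → α s = α s' → s = 0 ∧ s' = 1)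
    (h : ∀ i, α 0 ∈ c.U i → σ i 1 = σ i 0) :
    ∃ τ, c.IsSection (Subtype.val : range α → W) τ := by
  let q : Icc (0 : ℝ) 1 → range α := rangeFactorization α
  have hq : IsQuotientMap q := by
    have hc : Continuous q := hα.subtype_mk _
    exact hc.isClosedMap.isQuotientMap hc rangeFactorization_surjective
  have key : ∀ i s s', s < s' → α s = α s' → α s ∈ c.U i → σ i s = σ i s' := by
    intro i s s' hss he hi
    obtain ⟨rfl, rfl⟩ := hinj s s' hss he
    exact (h i hi).symm
  obtain ⟨τ, hτ, -⟩ := SignCocycle.IsSection.descend (q := q) (f := Subtype.val) hσ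
    continuous_subtype_val hq (fun i a a' haa hi => by
      have haa' : α a = α a' := congrArg Subtype.val haa
      have hi' : α a ∈ c.U i := hi
      rcases lt_trichotomy a a' with hlt | rfl | hlt
      · exact key i a a' hlt haa' hi'
      · rfl
      · exact (key i a' a hlt haa'.symm (haa' ▸ hi')).symm)
  exact ⟨τ, hτ⟩

section Linking

variable {h π : S3 → S3}

theorem isClosed_branch (hs : ContMDiff (𝓡 3) (𝓡 3) (⊤ : ℕ∞) h) (hπ : IsQuotProj h π) :
    IsClosed (π '' fixedPoints h) :=
  hπ.isClosedMap _ (isClosed_fixedPoints hs.continuous)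

/-- Every connected double cover of the complement of the branch set has the cocycle of the quotient
projection. -/
theorem exists_section_mul_cover
    (hs : ContMDiff (𝓡 3) (𝓡 3) (⊤ : ℕ∞) h) (hh : Involutive h)
    (hfix : IsCircleSet (fixedPoints h)) (hπ : IsQuotProj h π)
    {Y : Type*} [TopologicalSpace Y] {p : Y → ↥(π '' fixedPoints h)ᶜ}
    (hD : IsDoubleCover (fun y => (p y : S3))) (hY : ConnectedSpace Y)
    (h2 : ∀ x : ↥(π '' fixedPoints h)ᶜ, (p ⁻¹' {x}).ncard = 2) :
    ∃ σ, ((hπ.isDoubleCover hs.continuous).cocycle.mul hD.cocycle).IsSection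
      (Subtype.val : ↥(π '' fixedPoints h)ᶜ → S3) σ := by
  have hdom : hD.cocycle.dom = (π '' fixedPoints h)ᶜ := by
    rw [hD.dom_cocycle]
    ext x
    constructor
    · rintro ⟨y, rfl⟩
      exact (p y).2
    · intro hx
      obtain ⟨y, -, -, hy, -⟩ := exists_two_of_ncard h2 hx
      exact ⟨y, hy⟩
  rcases exists_section_or_mul hs hh hfix hπ hD.cocycle hdom with ⟨σ, hσ⟩ | hσ
  · exfalso
    obtain ⟨y₀⟩ := hY.toNonempty
    obtain ⟨y, y', hne, hy, hy'⟩ := exists_two_of_ncard h2 (p y₀).2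
    refine hD.not_isPreconnected_preimage hσ (x := y) (x' := y') (p y).2 (hy.trans hy'.symm) hne ?_
    have : (fun y => (p y : S3)) ⁻¹' (π '' fixedPoints h)ᶜ = univ :=
      eq_univ_of_forall fun y => (p y).2
    rw [this]
    exact isPreconnected_univ
  · exact hσ

theorem evenLinking_of_section
    (hs : ContMDiff (𝓡 3) (𝓡 3) (⊤ : ℕ∞) h) (hh : Involutive h)
    (hfix : IsCircleSet (fixedPoints h)) (hπ : IsQuotProj h π)
    {γ : Set S3} (hγ : γ ⊆ (π '' fixedPoints h)ᶜ) (hne : γ.Nonempty)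
    {κ : ↥(fixedPoints h)ᶜ → γ → ℤˣ}
    (hκ : (hπ.isDoubleCover hs.continuous).cocycle.IsSection (Subtype.val : γ → S3) κ) :
    EvenLinking (π '' fixedPoints h) γ := by
  refine ⟨hγ, fun Y _ p hp hY h2 => ?_⟩
  have hD := IsCoveringMap.isDoubleCover (isClosed_branch hs hπ) hp h2
  obtain ⟨ρ, hρ⟩ := exists_section_mul_cover hs hh hfix hπ hD hY h2
  have hρ' := hρ.comp (continuous_inclusion hγ)
  obtain ⟨τ, hτ, -⟩ := SignCocycle.IsSection.div_left (f := (Subtype.val : γ → S3))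
    continuous_subtype_val hρ' hκ (fun a => by
      rw [(hπ.isDoubleCover hs.continuous).dom_cocycle, hπ.range_proj]; exact hγ a.2)
  obtain ⟨x, hx⟩ := hne
  obtain ⟨y, y', hne, hy, hy'⟩ := exists_two_of_ncard h2 (hγ hx)
  exact hD.not_isPreconnected_preimage hτ (x := y) (x' := y')
    (show (p y : S3) ∈ γ from hy.symm ▸ hx) (hy.trans hy'.symm) hne

theorem oddLinking_of_section
    (hs : ContMDiff (𝓡 3) (𝓡 3) (⊤ : ℕ∞) h) (hh : Involutive h)
    (hfix : IsCircleSet (fixedPoints h)) (hπ : IsQuotProj h π)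
    {α : Icc (0 : ℝ) 1 → S3} (hα : Continuous α) (h01 : α 0 = α 1)
    (hγ : range α ⊆ (π '' fixedPoints h)ᶜ) {κ : ↥(fixedPoints h)ᶜ → Icc (0 : ℝ) 1 → ℤˣ}
    (hκ : (hπ.isDoubleCover hs.continuous).cocycle.IsSection α κ)
    (hflip : ∀ i, α 0 ∈ (hπ.isDoubleCover hs.continuous).cocycle.U i → κ i 1 = -κ i 0) :
    OddLinking (π '' fixedPoints h) (range α) := by
  refine ⟨hγ, fun Y _ p hp hY h2 => ?_⟩
  have hD := IsCoveringMap.isDoubleCover (isClosed_branch hs hπ) hp h2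
  obtain ⟨ρ, hρ⟩ := exists_section_mul_cover hs hh hfix hπ hD hY h2
  let α' : Icc (0 : ℝ) 1 → ↥(π '' fixedPoints h)ᶜ := fun t => ⟨α t, hγ ⟨t, rfl⟩⟩
  have hα' : Continuous α' := hα.subtype_mk _
  have h01' : α' 0 = α' 1 := Subtype.ext h01
  have hρ' := hρ.comp hα'
  have hdom : ∀ t, α t ∈ (hπ.isDoubleCover hs.continuous).cocycle.dom := fun t => by
    rw [(hπ.isDoubleCover hs.continuous).dom_cocycle, hπ.range_proj]; exact hγ ⟨t, rfl⟩
  obtain ⟨τ, hτ, hτe⟩ := SignCocycle.IsSection.div_left (f := α) hα hρ' hκ hdom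
  refine hD.isPreconnected_preimage hα h01 hτ (fun j hj => ?_) (fun t => ?_)
  · obtain ⟨i, hi⟩ := hdom 0
    rw [hτe i j 0 hi hj, hτe i j 1 (h01 ▸ hi) (h01 ▸ hj), hflip i hi, ← h01', mul_neg]
  · exact exists_two_of_ncard h2 (hγ ⟨t, rfl⟩)

end Linking

/-! ### The circle as a quotient of the line -/

/-- The standard parametrization of the circle by the line. -/
def circlePt (s : ℝ) : Circle1 :=
  ⟨!₂[Real.cos (2 * Real.pi * s), Real.sin (2 * Real.pi * s)], by
    rw [mem_sphere_zero_iff_norm, EuclideanSpace.norm_eq]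
    simp [Fin.sum_univ_two]⟩

theorem circlePt_zero_coord (s : ℝ) : (circlePt s : E2) 0 = Real.cos (2 * Real.pi * s) := rfl

theorem circlePt_one_coord (s : ℝ) : (circlePt s : E2) 1 = Real.sin (2 * Real.pi * s) := rfl

theorem continuous_circlePt : Continuous circlePt := by
  refine Continuous.subtype_mk ?_ _
  refine (PiLp.continuous_toLp 2 _).comp (continuous_pi fun i => ?_)
  fin_cases i
  · exact Real.continuous_cos.comp (continuous_const.mul continuous_id)
  · exact Real.continuous_sin.comp (continuous_const.mul continuous_id)

theorem circlePt_eq_iff {s t : ℝ} : circlePt s = circlePt t ↔ ∃ n : ℤ, t = s + n := by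
  have hpi := Real.pi_pos
  constructor
  · intro h
    have hc : Real.cos (2 * Real.pi * t) = Real.cos (2 * Real.pi * s) := by
      rw [← circlePt_zero_coord, ← circlePt_zero_coord, h]
    have hs : Real.sin (2 * Real.pi * t) = Real.sin (2 * Real.pi * s) := by
      rw [← circlePt_one_coord, ← circlePt_one_coord, h]
    have := Real.Angle.cos_sin_inj hc hs
    rw [Real.Angle.angle_eq_iff_two_pi_dvd_sub] at this
    obtain ⟨n, hn⟩ := this
    refine ⟨n, ?_⟩
    have : 2 * Real.pi * (t - (s + n)) = 0 := by linear_combination hn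
    have := (mul_eq_zero.1 this).resolve_left (by positivity)
    linarith
  · rintro ⟨n, rfl⟩
    have : 2 * Real.pi * (s + n) = 2 * Real.pi * s + n * (2 * Real.pi) := by ring
    refine Subtype.ext ?_
    ext i
    fin_cases i
    · simp [circlePt, this, Real.cos_add_int_mul_two_pi]
    · simp [circlePt, this, Real.sin_add_int_mul_two_pi]

theorem exists_circlePt (x : Circle1) : ∃ s ∈ Icc (0 : ℝ) 1, circlePt s = x := by
  have hx := normSq_circleToComplex x
  have hn : ‖circleToComplex x‖ = 1 := by
    rw [Complex.normSq_eq_norm_sq] at hx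
    nlinarith [norm_nonneg (circleToComplex x)]
  set θ := (circleToComplex x).arg with hθ
  have hpi := Real.pi_pos
  have key : circlePt (θ / (2 * Real.pi)) = x := by
    have h2 : 2 * Real.pi * (θ / (2 * Real.pi)) = θ := by field_simp
    have h0 : circleToComplex x ≠ 0 := fun h => by simp [h] at hn
    refine Subtype.ext ?_
    ext i
    fin_cases i
    · change Real.cos _ = (x : E2) 0
      rw [h2, hθ, Complex.cos_arg h0, hn, div_one]; rfl
    · change Real.sin _ = (x : E2) 1
      rw [h2, hθ, Complex.sin_arg, hn, div_one]; rfl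
  refine ⟨Int.fract (θ / (2 * Real.pi)), ⟨Int.fract_nonneg _, (Int.fract_lt_one _).le⟩, ?_⟩
  rw [← key, circlePt_eq_iff]
  exact ⟨⌊θ / (2 * Real.pi)⌋, (Int.fract_add_floor _).symm⟩

/-- The image of a simple closed path is a circle. -/
theorem isCircleSet_range {α : Icc (0 : ℝ) 1 → S3} (hα : Continuous α) (h01 : α 0 = α 1)
    (hinj : ∀ s s', s < s' → α s = α s' → s = 0 ∧ s' = 1) : IsCircleSet (range α) := by
  let q : Icc (0 : ℝ) 1 → range α := rangeFactorization α
  have hqc : Continuous q := hα.subtype_mk _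
  have hq : IsQuotientMap q := hqc.isClosedMap.isQuotientMap hqc rangeFactorization_surjective
  let r : Icc (0 : ℝ) 1 → Circle1 := fun s => circlePt s
  have hrc : Continuous r := continuous_circlePt.comp continuous_subtype_val
  have hr : IsQuotientMap r := hrc.isClosedMap.isQuotientMap hrc fun x => by
    obtain ⟨s, hs, h⟩ := exists_circlePt x
    exact ⟨⟨s, hs⟩, h⟩
  have key : ∀ s s', s < s' → (q s = q s' ↔ r s = r s') := by
    intro s s' hss
    have hval : (s : ℝ) < s' := hss
    have h1 : q s = q s' ↔ s = 0 ∧ s' = 1 :=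
      ⟨fun h => hinj s s' hss (congrArg Subtype.val h), fun h => Subtype.ext <| by
        rw [h.1, h.2]; exact h01⟩
    rw [h1, show r s = r s' ↔ _ from circlePt_eq_iff]
    constructor
    · rintro ⟨rfl, rfl⟩; exact ⟨1, by simp⟩
    · rintro ⟨n, hn⟩
      have h2 : (n : ℝ) ≤ 1 := by linarith [s.2.1, s'.2.2]
      have h3 : (0 : ℝ) < n := by linarith
      have : n = 1 := by
        have : n ≤ 1 := by exact_mod_cast h2
        have : 0 < n := by exact_mod_cast h3
        omega
      subst this
      have hs0 : (s : ℝ) = 0 := by push_cast at hn; linarith [s.2.1, s'.2.2]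
      exact ⟨Subtype.ext hs0, Subtype.ext (by rw [hn, hs0]; simp)⟩
  have hk : Setoid.ker q = Setoid.ker r := by
    ext s s'
    simp only [Setoid.ker_def]
    rcases lt_trichotomy s s' with h | rfl | h
    · exact key s s' h
    · simp
    · rw [eq_comm, key s' s h, eq_comm]
  let q' : C(Icc (0 : ℝ) 1, range α) := ⟨q, hqc⟩
  let r' : C(Icc (0 : ℝ) 1, Circle1) := ⟨r, hrc⟩
  have hk' : Setoid.ker q' = Setoid.ker r' := hk
  have e : Quotient (Setoid.ker q') ≃ₜ Quotient (Setoid.ker r') := hk' ▸ Homeomorph.refl _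
  exact ⟨(IsQuotientMap.homeomorph (f := q') hq).symm.trans
    (e.trans (IsQuotientMap.homeomorph (f := r') hr))⟩

/-! ### Bands -/

/-- The quotient maps defining the annulus (`ε = 1`) and the Möbius band (`ε = -1`). -/
structure IsBandMap {N : Type*} [TopologicalSpace N] (ε : ℤˣ) (p : ℝ × Icc (-1 : ℝ) 1 → N) :
    Prop where
  quot : IsQuotientMap p
  eq_iff : ∀ a b, p a = p b ↔
    ∃ n : ℤ, b.1 = a.1 + n ∧ (b.2 : ℝ) = (((ε ^ n : ℤˣ) : ℤ) : ℝ) * a.2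

theorem IsBandMap.homeomorph {N N' : Type*} [TopologicalSpace N] [TopologicalSpace N'] {ε : ℤˣ}
    {p : ℝ × Icc (-1 : ℝ) 1 → N} (hp : IsBandMap ε p) (e : N ≃ₜ N') : IsBandMap ε (e ∘ p) :=
  ⟨e.isQuotientMap.comp hp.quot, fun a b => by
    rw [comp_apply, comp_apply, e.injective.eq_iff, hp.eq_iff]⟩

theorem isBandMap_annulus :
    IsBandMap 1 (fun a : ℝ × Icc (-1 : ℝ) 1 => (circlePt a.1, a.2)) := by
  constructor
  · let i : Icc (0 : ℝ) 1 × Icc (-1 : ℝ) 1 → ℝ × Icc (-1 : ℝ) 1 := fun a => (a.1, a.2)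
    have hi : Continuous i := by fun_prop
    have hc : Continuous (fun a : ℝ × Icc (-1 : ℝ) 1 => (circlePt a.1, a.2)) :=
      (continuous_circlePt.comp continuous_fst).prodMk continuous_snd
    refine IsQuotientMap.of_comp hi hc ?_
    refine (hc.comp hi).isClosedMap.isQuotientMap (hc.comp hi) fun x => ?_
    obtain ⟨s, hs, h⟩ := exists_circlePt x.1
    exact ⟨(⟨s, hs⟩, x.2), Prod.ext h rfl⟩
  · intro a b
    simp only [Prod.mk.injEq, circlePt_eq_iff, one_zpow, Units.val_one, Int.cast_one, one_mul]
    constructor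
    · rintro ⟨⟨n, hn⟩, h⟩; exact ⟨n, hn, by rw [h]⟩
    · rintro ⟨n, hn, h⟩; exact ⟨⟨n, hn⟩, Subtype.ext h.symm⟩

theorem isBandMap_mobius : IsBandMap (-1) (Quot.mk mobiusRel : _ → MobiusBand) := by
  constructor
  · exact isQuotientMap_quot_mk
  · intro a b
    constructor
    · intro h
      have := Quot.eqvGen_exact h
      induction this with
      | rel a b hab => exact ⟨1, by simpa using hab.1, by simpa using hab.2⟩
      | refl a => exact ⟨0, by simp, by simp⟩
      | symm a b _ ih =>
        obtain ⟨n, h1, h2⟩ := ih (Quot.eqvGen_sound ‹_›)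
        refine ⟨-n, by rw [h1]; push_cast; ring, ?_⟩
        rw [h2, ← mul_assoc, ← Int.cast_mul, ← Units.val_mul, ← zpow_add, neg_add_cancel]
        simp
      | trans a b c _ _ ih ih' =>
        obtain ⟨n, h1, h2⟩ := ih (Quot.eqvGen_sound ‹_›)
        obtain ⟨m, h3, h4⟩ := ih' (Quot.eqvGen_sound ‹_›)
        refine ⟨m + n, by rw [h3, h1]; push_cast; ring, ?_⟩
        rw [h4, h2, ← mul_assoc, ← Int.cast_mul, ← Units.val_mul, ← zpow_add]
    · rintro ⟨n, h1, h2⟩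
      induction n using Int.induction_on generalizing a b with
      | zero => 
        rw [show a = b from Prod.ext (by simpa using h1.symm) (Subtype.ext (by simpa using h2.symm))]
      | succ n ih =>
        have hm : -(a.2 : ℝ) ∈ Icc (-1 : ℝ) 1 := ⟨by linarith [a.2.2.2], by linarith [a.2.2.1]⟩
        refine (Quot.sound (b := (a.1 + 1, ⟨_, hm⟩)) ⟨rfl, rfl⟩).trans (ih _ _ ?_ ?_)
        · simp only [h1]; push_cast; ring
        · rw [h2, zpow_add_one]; push_cast; ring
      | pred n ih =>
        have hm : -(a.2 : ℝ) ∈ Icc (-1 : ℝ) 1 := ⟨by linarith [a.2.2.2], by linarith [a.2.2.1]⟩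
        refine (Quot.sound (a := (a.1 - 1, ⟨_, hm⟩)) (b := a)
          ⟨by simp, by simp⟩).symm.trans (ih _ _ ?_ ?_)
        · simp only [h1]; push_cast; ring
        · rw [h2, zpow_sub_one]; simp

/-! ### Strips -/

/-- The open strip of half-width one around the real axis. -/
def strip : Set ℂ := {z | |z.im| < 1}

theorem isOpen_strip : IsOpen strip := isOpen_lt (by fun_prop) continuous_const

theorem isPreconnected_strip : IsPreconnected strip := by
  have : strip = Complex.im ⁻¹' Ioo (-1) 1 := by
    ext z; exact abs_lt (a := z.im)
  rw [this]
  exact ((convex_Ioo (-1 : ℝ) 1).linear_preimage Complex.imLm).isPreconnected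

theorem zero_mem_strip : (0 : ℂ) ∈ strip := by simp [strip]

/-- The deck transformations of the strip over the band. -/
def stripShift (ε : ℤˣ) (n : ℤ) (z : ℂ) : ℂ := ⟨z.re + n, (((ε ^ n : ℤˣ) : ℤ) : ℝ) * z.im⟩

theorem abs_units_cast (u : ℤˣ) : |((u : ℤ) : ℝ)| = 1 := by
  rcases Int.units_eq_one_or u with rfl | rfl <;> simp

theorem stripShift_mem {ε : ℤˣ} {n : ℤ} {z : ℂ} (hz : z ∈ strip) : stripShift ε n z ∈ strip := by
  change |(((ε ^ n : ℤˣ) : ℤ) : ℝ) * z.im| < 1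
  rw [abs_mul, abs_units_cast, one_mul]; exact hz

theorem stripShift_zero (ε : ℤˣ) (z : ℂ) : stripShift ε 0 z = z := by
  apply Complex.ext <;> simp [stripShift]

theorem stripShift_add (ε : ℤˣ) (n m : ℤ) (z : ℂ) :
    stripShift ε (n + m) z = stripShift ε n (stripShift ε m z) := by
  apply Complex.ext
  · simp [stripShift]; ring
  · simp [stripShift, zpow_add, mul_assoc]

theorem stripShift_eq_affine (n : ℤ) : stripShift 1 n = fun z => 1 * z + (n : ℂ) := by
  ext z; apply Complex.ext <;> simp [stripShift]

theorem stripShift_eq_conj : stripShift (-1) 1 = (fun z => 1 * z + 1) ∘ starRingEnd ℂ := by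
  ext z; apply Complex.ext <;> simp [stripShift]

theorem continuous_stripShift (ε : ℤˣ) (n : ℤ) : Continuous (stripShift ε n) := by
  have : stripShift ε n = fun z => ((z.re + n : ℝ) : ℂ) +
      (((((ε ^ n : ℤˣ) : ℤ) : ℝ) * z.im : ℝ) : ℂ) * Complex.I := by
    ext z; apply Complex.ext <;> simp [stripShift]
  rw [this]; fun_prop

theorem injective_stripShift (ε : ℤˣ) (n : ℤ) : Injective (stripShift ε n) := by
  intro z w h
  rw [← stripShift_zero ε z, ← stripShift_zero ε w, ← neg_add_cancel n, stripShift_add,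
    stripShift_add, h]

theorem goodAt_stripShift (ε : ℤˣ) (n : ℤ) (z : ℂ) : GoodAt (stripShift ε n) z :=
  goodAt_of_injective (continuous_stripShift ε n) (injective_stripShift ε n) z

theorem sdeg_stripShift (ε : ℤˣ) (z : ℂ) : sdeg (stripShift ε 1) z = ε := by
  rcases Int.units_eq_one_or ε with rfl | rfl
  · rw [stripShift_eq_affine]; exact sdeg_affine one_ne_zero _ _
  · rw [stripShift_eq_conj, sdeg_comp, sdeg_affine one_ne_zero, sdeg_conj, one_mul]
    · exact goodAt_of_injective Complex.continuous_conj (RingHom.injective _) z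
    · exact goodAt_of_injective (by fun_prop) (fun a b h => by simpa using h) _

/-- A local embedding of the strip, equivariant for the deck transformations of the annulus
(`ε = 1`) or the Möbius band (`ε = -1`), which is a quotient map onto its image. -/
structure IsStripMap {W : Type*} [TopologicalSpace W] (ε : ℤˣ) (q : ℂ → W) : Prop where
  good : ∀ z ∈ strip, GoodAt q z
  quot : IsQuotientMap (fun z : strip => (⟨q z, mem_image_of_mem q z.2⟩ : q '' strip))
  eq_iff : ∀ z ∈ strip, ∀ z' ∈ strip, q z = q z' ↔ ∃ n : ℤ, z' = stripShift ε n z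

namespace IsStripMap

variable {W ι : Type*} [TopologicalSpace W] {ε : ℤˣ} {q : ℂ → W}

theorem shift (hq : IsStripMap ε q) {z : ℂ} (hz : z ∈ strip) (n : ℤ) :
    q (stripShift ε n z) = q z :=
  ((hq.eq_iff z hz _ (stripShift_mem hz)).2 ⟨n, rfl⟩).symm

/-- The sign of the degree changes by `ε` under the generating deck transformation. -/
theorem sdeg_shift (hq : IsStripMap ε q) {z : ℂ} (hz : z ∈ strip)
    (φ : OpenPartialHomeomorph W ℂ) (hφ : q z ∈ φ.source) :
    sdeg (φ ∘ q) (stripShift ε 1 z) = ε * sdeg (φ ∘ q) z := by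
  have hz' : stripShift ε 1 z ∈ strip := stripShift_mem hz
  have h1 : GoodAt (φ ∘ q) (stripShift ε 1 z) :=
    (hq.good _ hz').chart_comp φ (by rwa [hq.shift hz])
  have h2 := sdeg_comp (goodAt_stripShift ε 1 z) h1
  rw [sdeg_stripShift] at h2
  have h3 : sdeg (φ ∘ q) z = sdeg ((φ ∘ q) ∘ stripShift ε 1) z := by
    refine sdeg_congr ((hq.good z hz).chart_comp φ hφ) ?_
    filter_upwards [isOpen_strip.mem_nhds hz] with w hw
    simp only [comp_apply]; rw [hq.shift hw]
  rw [h3, h2, mul_left_comm, Int.units_mul_self, mul_one]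

/-- A section along the strip is either invariant or anti-invariant. -/
theorem exists_sign (hq : IsStripMap ε q) {c : SignCocycle ι W} {σ : ι → strip → ℤˣ}
    (hσ : c.IsSection (fun z : strip => q z) σ) (hdom : ∀ z ∈ strip, q z ∈ c.dom) :
    ∃ η : ℤˣ, ∀ z : strip, ∀ i, q z ∈ c.U i → σ i ⟨stripShift ε 1 z, stripShift_mem z.2⟩ =
      η * σ i z := by
  have hk : Continuous (fun z : strip =>
      (⟨stripShift ε 1 z, stripShift_mem z.2⟩ : strip)) :=
    ((continuous_stripShift ε 1).comp continuous_subtype_val).subtype_mk _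
  have h1 := hσ.comp hk
  have h2 : ((fun z : strip => q z) ∘ fun z : strip =>
      (⟨stripShift ε 1 z, stripShift_mem z.2⟩ : strip)) = fun z : strip => q z :=
    funext fun z => hq.shift z.2 1
  rw [h2] at h1
  have hc : Continuous (fun z : strip => q z) := continuous_iff_continuousAt.2 fun z =>
    (hq.good z z.2).continuousAt.comp continuous_subtype_val.continuousAt
  obtain ⟨η, hη⟩ := h1.exists_eq_mul hσ hc (S := univ)
    (isPreconnected_iff_preconnectedSpace.1 isPreconnected_strip).isPreconnected_univ
    (fun a _ => hdom a a.2)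
  exact ⟨η, fun z i hi => hη z (mem_univ _) i hi⟩

/-- An invariant section along the strip descends to the band. -/
theorem exists_section (hq : IsStripMap ε q) {c : SignCocycle ι W} {σ : ι → strip → ℤˣ}
    (hσ : c.IsSection (fun z : strip => q z) σ)
    (hinv : ∀ z : strip, ∀ i, q z ∈ c.U i →
      σ i ⟨stripShift ε 1 z, stripShift_mem z.2⟩ = σ i z) :
    ∃ τ, c.IsSection (Subtype.val : q '' strip → W) τ := by
  have key : ∀ (n : ℤ) (z : strip) i, q z ∈ c.U i →
      σ i ⟨stripShift ε n z, stripShift_mem z.2⟩ = σ i z := by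
    intro n
    induction n using Int.induction_on with
    | zero => intro z i _; congr 1; exact Subtype.ext (stripShift_zero ε z)
    | succ n ih =>
      intro z i hi
      rw [← ih z i hi, ← hinv ⟨stripShift ε n z, stripShift_mem z.2⟩ i
        (by rw [hq.shift z.2]; exact hi)]
      congr 1
      exact Subtype.ext ((congrArg (stripShift ε · z) (add_comm _ _)).trans (stripShift_add _ _ _ _))
    | pred n ih =>
      intro z i hi
      rw [← ih z i hi, ← hinv ⟨stripShift ε (-n - 1) z, stripShift_mem z.2⟩ i
        (by rw [hq.shift z.2]; exact hi)]
      congr 1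
      exact Subtype.ext ((stripShift_add _ _ _ _).symm.trans
        (congrArg (stripShift ε · z) (by ring)))
  obtain ⟨τ, hτ, -⟩ := SignCocycle.IsSection.descend
    (q := fun z : strip => (⟨q z, mem_image_of_mem q z.2⟩ : q '' strip)) (f := Subtype.val) hσ
    continuous_subtype_val hq.quot (fun i a a' haa hi => by
      obtain ⟨n, hn⟩ := (hq.eq_iff a a.2 a' a'.2).1 (congrArg Subtype.val haa)
      rw [← key n a i hi]
      congr 1
      exact Subtype.ext hn.symm)
  exact ⟨τ, hτ⟩

end IsStripMap

namespace IsBandMap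

variable {N : Type*} [TopologicalSpace N] {ε : ℤˣ} {p : ℝ × Icc (-1 : ℝ) 1 → N}

theorem isOpenMap (hp : IsBandMap ε p) : IsOpenMap p := by
  intro U hU
  rw [← hp.quot.isOpen_preimage]
  have hmem : ∀ (n : ℤ) (a : Icc (-1 : ℝ) 1), (((ε ^ n : ℤˣ) : ℤ) : ℝ) * a ∈ Icc (-1 : ℝ) 1 := by
    intro n a
    rw [mem_Icc, ← abs_le, abs_mul, abs_units_cast, one_mul, abs_le]; exact a.2
  have : p ⁻¹' (p '' U) = ⋃ n : ℤ,
      (fun a : ℝ × Icc (-1 : ℝ) 1 => ((a.1 + n, ⟨_, hmem n a.2⟩) : ℝ × Icc (-1 : ℝ) 1)) ⁻¹' U := by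
    ext a
    simp only [mem_preimage, mem_image, mem_iUnion]
    constructor
    · rintro ⟨b, hb, h⟩
      obtain ⟨n, h1, h2⟩ := (hp.eq_iff a b).1 h.symm
      refine ⟨n, ?_⟩
      convert hb using 1
      exact Prod.ext h1.symm (Subtype.ext h2.symm)
    · rintro ⟨n, hn⟩
      exact ⟨_, hn, ((hp.eq_iff _ _).2 ⟨n, rfl, rfl⟩).symm⟩
  rw [this]
  refine isOpen_iUnion fun n => hU.preimage ?_
  refine (continuous_fst.add continuous_const).prodMk (Continuous.subtype_mk ?_ _)
  exact continuous_const.mul (continuous_subtype_val.comp continuous_snd)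

theorem injOn (hp : IsBandMap ε p) (s : ℝ) : InjOn p {a | |a.1 - s| < 1 / 2} := by
  intro a ha b hb h
  obtain ⟨n, h1, h2⟩ := (hp.eq_iff a b).1 h
  have ha' := abs_lt.1 (show |a.1 - s| < 1 / 2 from ha)
  have hb' := abs_lt.1 (show |b.1 - s| < 1 / 2 from hb)
  have h3 : (n : ℝ) < 1 := by linarith
  have h4 : (-1 : ℝ) < n := by linarith
  have : n = 0 := by
    have : n < 1 := by exact_mod_cast h3
    have : -1 < n := by exact_mod_cast h4
    omega
  subst this
  exact Prod.ext (by simpa using h1.symm) (Subtype.ext (by simpa using h2.symm))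

/-- The product coordinates on the strip. -/
def stripPt (z : ℂ) : ℝ × Icc (-1 : ℝ) 1 := (z.re, projIcc (-1) 1 (by norm_num) z.im)

theorem continuous_stripPt : Continuous stripPt :=
  Complex.continuous_re.prodMk (continuous_projIcc.comp Complex.continuous_im)

theorem stripPt_snd {z : ℂ} (hz : z ∈ strip) : ((stripPt z).2 : ℝ) = z.im := by
  have := abs_lt.1 (show |z.im| < 1 from hz)
  simp [stripPt, projIcc_of_mem (show (-1 : ℝ) ≤ 1 by norm_num) ⟨this.1.le, this.2.le⟩]

theorem goodAt (hp : IsBandMap ε p) {z : ℂ} (hz : z ∈ strip) :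
    GoodAt (fun z => p (stripPt z)) z := by
  have h1 : GoodAt stripPt z := goodAt_iff.2 ⟨strip, isOpen_strip.mem_nhds hz,
    continuous_stripPt.continuousOn, fun a ha b hb h => Complex.ext (congrArg Prod.fst h) (by
      rw [← stripPt_snd ha, ← stripPt_snd hb, h])⟩
  refine h1.comp (s := {a | |a.1 - z.re| < 1 / 2}) ?_ hp.quot.continuous.continuousOn (hp.injOn _)
  refine (isOpen_lt (by fun_prop) continuous_const).mem_nhds ?_
  simp [stripPt]

/-- A locally embedded plane cannot pass through the boundary of a band. -/
theorem exists_mem_strip (hp : IsBandMap ε p) {e : ℂ → N} {w : ℂ} (he : GoodAt e w) :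
    ∃ z ∈ strip, p (stripPt z) = e w := by
  obtain ⟨a, ha⟩ := hp.quot.surjective (e w)
  by_cases h : |(a.2 : ℝ)| < 1
  · exact ⟨⟨a.1, a.2⟩, h, by
      rw [← ha]; congr 1; exact Prod.ext rfl (Subtype.ext (stripPt_snd h))⟩
  exfalso
  have ha2 := a.2.2
  obtain ⟨u, hu, hu1⟩ : ∃ u : ℝ, (u = 1 ∨ u = -1) ∧ u * a.2 = 1 := by
    rcases le_abs.1 (not_lt.1 h) with h' | h'
    · exact ⟨1, Or.inl rfl, by linarith [ha2.2]⟩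
    · exact ⟨-1, Or.inr rfl, by linarith [ha2.1]⟩
  have hu0 : u ≠ 0 := by rcases hu with rfl | rfl <;> norm_num
  let V : Set (ℝ × Icc (-1 : ℝ) 1) := {b | |b.1 - a.1| < 1 / 2}
  have hV : IsOpen V := isOpen_lt (by fun_prop) continuous_const
  have haV : a ∈ V := by simp [V]
  have : Nonempty (ℝ × Icc (-1 : ℝ) 1) := ⟨a⟩
  let ψ := OpenPartialHomeomorph.ofContinuousOpen (hp.injOn a.1).toPartialEquiv
    hp.quot.continuous.continuousOn hp.isOpenMap hV
  have hψs : ψ.source = V := rfl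
  have hψa : ∀ b, ψ b = p b := fun b => rfl
  have hwt : e w ∈ ψ.target := by rw [← ha, ← hψa]; exact ψ.map_source haV
  have h1 : GoodAt (ψ.symm ∘ e) w :=
    he.comp (ψ.open_target.mem_nhds hwt) ψ.continuousOn_symm ψ.symm.injOn
  let m : ℝ × Icc (-1 : ℝ) 1 → ℂ := fun b => ⟨1 - u * b.2, b.1⟩
  have hm : Continuous m := by
    have : m = fun b => ((1 - u * b.2 : ℝ) : ℂ) + (b.1 : ℂ) * Complex.I := by
      ext b; apply Complex.ext <;> simp [m]
    rw [this]; fun_prop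
  have hmi : Injective m := by
    intro b b' h
    have h1 := congrArg Complex.re h
    have h2 := congrArg Complex.im h
    refine Prod.ext h2 (Subtype.ext (mul_left_cancel₀ hu0 ?_))
    simp only [m] at h1
    linarith
  have h2 : GoodAt (m ∘ (ψ.symm ∘ e)) w := h1.comp Filter.univ_mem hm.continuousOn hmi.injOn
  refine h2.not_eventually_re_nonneg ?_ (Filter.Eventually.of_forall fun w' => ?_)
  · have : ψ.symm (e w) = a := by rw [← ha, ← hψa]; exact ψ.left_inv haV
    simp [m, this, hu1]
  · have := ((ψ.symm ∘ e) w').2.2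
    rcases hu with rfl | rfl <;> simp only [m, comp_apply] at this ⊢ <;> linarith [this.1, this.2]

/-- The strip map of a band with interior in a given set. -/
theorem exists_isStripMap {X : Type*} [TopologicalSpace X] {N V : Set X}
    {p : ℝ × Icc (-1 : ℝ) 1 → N} (hp : IsBandMap ε p)
    (hV : ∀ z ∈ strip, (p (stripPt z) : X) ∈ V) :
    ∃ q : ℂ → V, IsStripMap ε q ∧ ∀ z ∈ strip, (q z : X) = p (stripPt z) := by
  classical
  let q : ℂ → V := fun z => if hz : z ∈ strip then ⟨p (stripPt z), hV z hz⟩ else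
    ⟨p (stripPt 0), hV 0 zero_mem_strip⟩
  have hq : ∀ z ∈ strip, (q z : X) = p (stripPt z) := fun z hz => by simp only [q, dif_pos hz]
  refine ⟨q, ⟨fun z hz => ?_, ?_, fun z hz z' hz' => ?_⟩, hq⟩
  · obtain ⟨s, hs, hc, hi⟩ := goodAt_iff.1 (hp.goodAt hz)
    refine goodAt_iff.2 ⟨s ∩ strip, Filter.inter_mem hs (isOpen_strip.mem_nhds hz), ?_, ?_⟩
    · rw [Topology.IsInducing.subtypeVal.continuousOn_iff]
      exact (continuous_subtype_val.comp_continuousOn (hc.mono inter_subset_left)).congr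
        fun w hw => hq w hw.2
    · intro a ha b hb h
      refine hi ha.1 hb.1 (Subtype.ext ?_)
      rw [← hq a ha.2, ← hq b hb.2, h]
  · have hcont : Continuous (fun z : strip => (⟨q z, mem_image_of_mem q z.2⟩ : q '' strip)) := by
      refine Continuous.subtype_mk (Continuous.subtype_mk (f := fun z : strip => (q z : X)) ?_ _) _
      have : (fun z : strip => (q z : X)) = fun z : strip => (p (stripPt z) : X) :=
        funext fun z => hq z z.2
      rw [this]
      exact continuous_subtype_val.comp (hp.quot.continuous.comp
        (continuous_stripPt.comp continuous_subtype_val))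
    refine IsOpenMap.isQuotientMap ?_ hcont ?_
    · intro U hU
      obtain ⟨U', hU', rfl⟩ := isOpen_induced_iff.1 hU
      let m : ℝ × Icc (-1 : ℝ) 1 → ℂ := fun b => ⟨b.1, b.2⟩
      have hm : Continuous m := by
        have : m = fun b => (b.1 : ℂ) + ((b.2 : ℝ) : ℂ) * Complex.I := by
          ext b; apply Complex.ext <;> simp [m]
        rw [this]; fun_prop
      obtain ⟨O, hO, hOe⟩ := isOpen_induced_iff.1
        (hp.isOpenMap _ ((hU'.inter isOpen_strip).preimage hm))
      refine isOpen_induced_iff.2 ⟨Subtype.val ⁻¹' O, hO.preimage continuous_subtype_val, ?_⟩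
      ext ⟨x, hx⟩
      constructor
      · intro hxO
        obtain ⟨z, hz, rfl⟩ := hx
        have h1 : p (stripPt z) ∈ (Subtype.val ⁻¹' O : Set N) := by
          change (q z : X) ∈ O at hxO
          rw [hq z hz] at hxO; exact hxO
        rw [hOe] at h1
        obtain ⟨b, hb, hbe⟩ := h1
        have hbm : stripPt (m b) = b := Prod.ext rfl (Subtype.ext (stripPt_snd hb.2))
        exact ⟨⟨m b, hb.2⟩, hb.1, Subtype.ext (Subtype.ext (by
          change (q (m b) : X) = q z
          rw [hq _ hb.2, hq z hz, hbm, hbe]))⟩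
      · rintro ⟨z, hz, hzx⟩
        have h1 : m (stripPt z) = z := Complex.ext rfl (stripPt_snd z.2)
        have h2 : p (stripPt z) ∈ (Subtype.val ⁻¹' O : Set N) := by
          rw [hOe]
          exact ⟨stripPt z, by rw [mem_preimage, h1]; exact ⟨hz, z.2⟩, rfl⟩
        rw [← hzx]
        change (q z : X) ∈ O
        rw [hq z z.2]; exact h2
    · rintro ⟨_, z, hz, rfl⟩; exact ⟨⟨z, hz⟩, rfl⟩
  · rw [Subtype.ext_iff, hq z hz, hq z' hz', ← Subtype.ext_iff, hp.eq_iff]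
    refine exists_congr fun n => ?_
    rw [stripPt_snd hz, stripPt_snd hz', Complex.ext_iff]
    rfl

end IsBandMap

/-! ### Interior and boundary points -/

theorem GoodAt.exists_codRestrict {X : Type*} [TopologicalSpace X] {q : ℂ → X} {z : ℂ}
    (hq : GoodAt q z) {A : Set X} (hA : ∀ᶠ z' in 𝓝 z, q z' ∈ A) :
    ∃ q' : ℂ → A, GoodAt q' z ∧ ∀ᶠ z' in 𝓝 z, (q' z' : X) = q z' := by
  classical
  let q' : ℂ → A := fun w => if hw : q w ∈ A then ⟨q w, hw⟩ else ⟨q z, hA.self_of_nhds⟩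
  have hq' : ∀ w, q w ∈ A → (q' w : X) = q w := fun w hw => by simp only [q', dif_pos hw]
  refine ⟨q', ?_, hA.mono hq'⟩
  obtain ⟨s, hs, hc, hi⟩ := goodAt_iff.1 hq
  refine goodAt_iff.2 ⟨s ∩ {w | q w ∈ A}, Filter.inter_mem hs hA, ?_, ?_⟩
  · rw [Topology.IsInducing.subtypeVal.continuousOn_iff]
    exact (hc.mono inter_subset_left).congr fun w hw => hq' w hw.2
  · intro a ha b hb h
    refine hi ha.1 hb.1 ?_
    rw [← hq' a ha.2, ← hq' b hb.2, h]

/-- A locally embedded plane in a surface avoids the boundary. -/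
theorem IsBoundaryPointOf.not_goodAt {S : Set S3} {x : S3} (h : IsBoundaryPointOf S x)
    {q : ℂ → S3} {z : ℂ} (hq : GoodAt q z) (hz : q z = x) (hS : ∀ᶠ z' in 𝓝 z, q z' ∈ S) :
    False := by
  obtain ⟨U, hU, hx, φ, hφ⟩ := h
  have hev : ∀ᶠ z' in 𝓝 z, q z' ∈ U ∩ S :=
    Filter.Eventually.and (hq.continuousAt.eventually_mem (hU.mem_nhds (hz.symm ▸ hx.1))) hS
  obtain ⟨q', hq', he⟩ := hq.exists_codRestrict hev
  have hz' : q' z = ⟨x, hx⟩ := Subtype.ext (he.self_of_nhds.trans hz)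
  let m : (U ∩ S : Set S3) → ℂ := fun y => ⟨(φ y : ℝ × ℝ).1, (φ y : ℝ × ℝ).2⟩
  have hm : Continuous m := Complex.equivRealProdCLM.symm.continuous.comp
    (continuous_subtype_val.comp φ.continuous)
  have hmi : Injective m := fun a b hab => φ.injective (Subtype.ext
    (Prod.ext (congrArg Complex.re hab) (congrArg Complex.im hab)))
  refine (hq'.comp Filter.univ_mem hm.continuousOn hmi.injOn).not_eventually_re_nonneg ?_
    (Filter.Eventually.of_forall fun w => (φ (q' w)).2)
  simp only [comp_apply, hz']
  exact hφ

theorem IsInteriorPointOf.exists_embedding {S : Set S3} {x : S3} (h : IsInteriorPointOf S x) :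
    ∃ (U : Set S3) (e : ℂ → S3), IsOpen U ∧ x ∈ U ∧ IsEmbedding e ∧
      range e = U ∩ S := by
  obtain ⟨U, hU, hxU, ⟨φ⟩⟩ := h
  let ψ : ℂ ≃ₜ (U ∩ S : Set S3) := Complex.equivRealProdCLM.toHomeomorph.trans φ.symm
  refine ⟨U, fun z => ψ z, hU, hxU, IsEmbedding.subtypeVal.comp ψ.isEmbedding, ?_⟩
  rw [show (fun z => (ψ z : S3)) = Subtype.val ∘ ψ from rfl, range_comp, ψ.surjective.range_eq,
    image_univ, Subtype.range_coe]

namespace IsSurfaceWithBoundary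

variable {S B : Set S3}

theorem not_goodAt (hS : IsSurfaceWithBoundary S B) {q : ℂ → S3} {z : ℂ} (hq : GoodAt q z)
    (hev : ∀ᶠ z' in 𝓝 z, q z' ∈ S) : q z ∉ B :=
  fun hB => (hS.2.2.2.2 _ hB).not_goodAt hq rfl hev

theorem exists_chart (hS : IsSurfaceWithBoundary S B) (w : ↥(S \ B)) :
    ∃ φ : OpenPartialHomeomorph ↥(S \ B) ℂ, w ∈ φ.source := by
  obtain ⟨U, e, hU, hw, he, hr⟩ := (hS.2.2.2.1 w w.2).exists_embedding
  have hmem : ∀ z, e z ∈ U ∩ S := fun z => hr ▸ mem_range_self z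
  have hB : ∀ z, e z ∈ S \ B := fun z => ⟨(hmem z).2,
    hS.not_goodAt (goodAt_of_injective he.continuous he.injective z)
      (Filter.Eventually.of_forall fun z' => (hmem z').2)⟩
  let ψ : ℂ → ↥(S \ B) := fun z => ⟨e z, hB z⟩
  have hψ : IsOpenEmbedding ψ := by
    refine ⟨IsEmbedding.of_comp (he.continuous.subtype_mk _) continuous_subtype_val he, ?_⟩
    have : range ψ = Subtype.val ⁻¹' U := by
      ext y
      constructor
      · rintro ⟨z, rfl⟩; exact (hmem z).1
      · intro hy
        have : (y : S3) ∈ range e := hr ▸ ⟨hy, y.2.1⟩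
        obtain ⟨z, hz⟩ := this
        exact ⟨z, Subtype.ext hz⟩
    rw [this]
    exact hU.preimage continuous_subtype_val
  refine ⟨(hψ.toOpenPartialHomeomorph ψ).symm, ?_⟩
  have : (w : S3) ∈ range e := hr ▸ ⟨hw, w.2.1⟩
  obtain ⟨z, hz⟩ := this
  simp only [OpenPartialHomeomorph.symm_source, IsOpenEmbedding.toOpenPartialHomeomorph_target]
  exact ⟨z, Subtype.ext hz⟩

/-- Band neighbourhoods of loops in the interior of a surface yield strip maps. -/
theorem exists_isStripMap (hS : IsSurfaceWithBoundary S B) {N γ : Set S3} {ε : ℤˣ}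
    {p : ℝ × Icc (-1 : ℝ) 1 → N} (hp : IsBandMap ε p) (hN : N ⊆ S)
    (hγN : ∀ x ∈ γ, N ∈ 𝓝[S] x) :
    ∃ q : ℂ → ↥(S \ B), IsStripMap ε q ∧ ∀ x : ↥(S \ B), (x : S3) ∈ γ → x ∈ q '' strip := by
  obtain ⟨q, hq, hqp⟩ := hp.exists_isStripMap (V := S \ B) fun z hz => ⟨hN (Subtype.coe_prop _),
    hS.not_goodAt ((hp.goodAt hz).comp Filter.univ_mem continuous_subtype_val.continuousOn
      Subtype.val_injective.injOn) (Filter.Eventually.of_forall fun z' => hN (Subtype.coe_prop _))⟩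
  refine ⟨q, hq, fun x hx => ?_⟩
  obtain ⟨φ, hφ⟩ := hS.exists_chart x
  have hg : GoodAt φ.symm (φ x) := φ.goodAt_symm (φ.map_source hφ)
  have hg' : GoodAt (Subtype.val ∘ φ.symm) (φ x) := hg.comp Filter.univ_mem
    continuous_subtype_val.continuousOn Subtype.val_injective.injOn
  have hgx : (Subtype.val ∘ φ.symm) (φ x) = (x : S3) := by simp [φ.left_inv hφ]
  have hev : ∀ᶠ w in 𝓝 (φ x), (Subtype.val ∘ φ.symm) w ∈ N := by
    obtain ⟨O, hO, hON⟩ := mem_nhdsWithin_iff_exists_mem_nhds_inter.1 (hγN x hx)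
    rw [← hgx] at hO
    filter_upwards [hg'.continuousAt hO] with w hw
    exact hON ⟨hw, (φ.symm w).2.1⟩
  obtain ⟨e, he, hee⟩ := hg'.exists_codRestrict hev
  obtain ⟨z, hz, hze⟩ := hp.exists_mem_strip he
  refine ⟨z, hz, Subtype.ext ?_⟩
  rw [hqp z hz, hze, hee.self_of_nhds, hgx]

end IsSurfaceWithBoundary

/-! ### Triviality of the product of the orientation and covering cocycles -/

theorem SignCocycle.isSection_comap {ι W A A' : Type*} [TopologicalSpace W] [TopologicalSpace A]
    [TopologicalSpace A'] {c : SignCocycle ι W} {f : A → W} (hf : Continuous f) {k : A' → A}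
    {σ : ι → A' → ℤˣ} : (c.comap hf).IsSection k σ ↔ c.IsSection (f ∘ k) σ :=
  ⟨fun h => ⟨h.1, h.2⟩, fun h => ⟨h.1, h.2⟩⟩

/-- A section flipping around a loop is incompatible with a section on a set containing it. -/
theorem SignCocycle.IsSection.not_flip {ι W : Type*} [TopologicalSpace W] {c : SignCocycle ι W}
    {α : Icc (0 : ℝ) 1 → W} (hα : Continuous α) (h01 : α 0 = α 1) {σ : ι → Icc (0 : ℝ) 1 → ℤˣ}
    (hσ : c.IsSection α σ) (hflip : ∀ i, α 0 ∈ c.U i → σ i 1 = -σ i 0) {V : Set W}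
    (hV : ∀ t, α t ∈ V) {τ : ι → V → ℤˣ} (hτ : c.IsSection (Subtype.val : V → W) τ)
    (hdom : ∀ t, α t ∈ c.dom) : False := by
  have h1 := hτ.comp (k := fun t => (⟨α t, hV t⟩ : V)) (hα.subtype_mk _)
  obtain ⟨η, hη⟩ := hσ.exists_eq_mul h1 hα isPreconnected_univ (fun t _ => hdom t)
  obtain ⟨i, hi⟩ := hdom 0
  have h2 := hη 0 (mem_univ _) i hi
  have h3 := hη 1 (mem_univ _) i (h01 ▸ hi)
  have h4 : (⟨α 1, hV 1⟩ : V) = ⟨α 0, hV 0⟩ := Subtype.ext h01.symm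
  rw [h4, ← h2, hflip i hi] at h3
  exact neg_ne_self_units _ h3

instance contractibleSpace_strip : ContractibleSpace strip :=
  Convex.contractibleSpace (by
    have : strip = Complex.im ⁻¹' Ioo (-1) 1 := by
      ext z; exact abs_lt (a := z.im)
    rw [this]
    exact (convex_Ioo (-1 : ℝ) 1).linear_preimage Complex.imLm) ⟨0, zero_mem_strip⟩

section Triviality

variable {h π : S3 → S3} (hs : ContMDiff (𝓡 3) (𝓡 3) (⊤ : ℕ∞) h) (hπ : IsQuotProj h π)

/-- The product of the covering cocycle and the orientation cocycle on a subset. -/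
def prodCocycle (W : Set S3) :
    SignCocycle (↥(fixedPoints h)ᶜ × OpenPartialHomeomorph W ℂ) W :=
  ((hπ.isDoubleCover hs.continuous).cocycle.comap
    (continuous_subtype_val : Continuous (Subtype.val : W → S3))).mul (orCocycle W)

/-- Under Condition (C) the orientation cocycle of the interior of the surface is the cocycle of the
branched cover. -/
theorem exists_section_prodCocycle (hh : Involutive h) (hfix : IsCircleSet (fixedPoints h))
    {S B : Set S3} (hS : IsSurfaceWithBoundary S B) (hO : S \ B ⊆ (π '' fixedPoints h)ᶜ)
    (hC : ConditionC (π '' fixedPoints h) S B) :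
    ∃ σ, (prodCocycle hs hπ (S \ B)).IsSection id σ := by
  by_contra hno
  let cX := (hπ.isDoubleCover hs.continuous).cocycle
  let cW := cX.comap (continuous_subtype_val : Continuous (Subtype.val : ↥(S \ B) → S3))
  have hdX : ∀ w : ↥(S \ B), w ∈ cW.dom := fun w => by
    have : (w : S3) ∈ cX.dom := by
      rw [(hπ.isDoubleCover hs.continuous).dom_cocycle, hπ.range_proj]; exact hO w.2
    exact this
  have hdO : ∀ w : ↥(S \ B), w ∈ (orCocycle ↥(S \ B)).dom := hS.exists_chart
  have hdom : ∀ w, w ∈ (prodCocycle hs hπ (S \ B)).dom := fun w => by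
    obtain ⟨i, hi⟩ := hdX w
    obtain ⟨j, hj⟩ := hdO w
    exact ⟨(i, j), hi, hj⟩
  obtain ⟨α, σ, hα, h01, hinj, hσ, hflip⟩ :=
    (prodCocycle hs hπ (S \ B)).exists_loop hdom hS.exists_chart hno
  have : ContractibleSpace (Icc (0 : ℝ) 1) :=
    (convex_Icc (0 : ℝ) 1).contractibleSpace ⟨0, by simp⟩
  obtain ⟨κ, hκ⟩ := cW.exists_section_of_contractible hα (fun t => hdX _)
  have hκ' : cX.IsSection (Subtype.val ∘ α) κ := (SignCocycle.isSection_comap _).1 hκ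
  have hβ : Continuous (Subtype.val ∘ α) := continuous_subtype_val.comp hα
  have h01' : (Subtype.val ∘ α) 0 = (Subtype.val ∘ α) 1 := congrArg Subtype.val h01
  have hinj' : ∀ s s', s < s' → (Subtype.val ∘ α) s = (Subtype.val ∘ α) s' → s = 0 ∧ s' = 1 :=
    fun s s' hss he => hinj s s' hss (Subtype.ext he)
  have hγ : range (Subtype.val ∘ α) ⊆ S \ B := by
    rintro _ ⟨t, rfl⟩; exact (α t).2
  obtain ⟨hCe, hCo⟩ := hC _ hγ (isCircleSet_range hβ h01' hinj')
  obtain ⟨ε, hε⟩ := hκ'.exists_monodromy h01'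
  rcases Int.units_eq_one_or ε with rfl | rfl
  · obtain ⟨τ, hτ⟩ := hκ'.descend_loop hβ hinj' (fun i hi => by rw [hε i hi, one_mul])
    obtain ⟨N, -, hNS, hN, ⟨e⟩⟩ := hCe
      (evenLinking_of_section hs hh hfix hπ (hγ.trans hO) (range_nonempty _) hτ)
    obtain ⟨q, hq, hγq⟩ := hS.exists_isStripMap (isBandMap_annulus.homeomorph e.symm) hNS hN
    obtain ⟨ρ, hρ⟩ := hq.exists_section (isSection_sdeg hq.good) (fun z φ hφ => by
      rw [hq.sdeg_shift z.2 φ hφ, one_mul])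
    have hV : ∀ t, α t ∈ q '' strip := fun t => hγq _ ⟨t, rfl⟩
    have hA : ∀ t : range α, ((t : ↥(S \ B)) : S3) ∈ range (Subtype.val ∘ α) := by
      rintro ⟨_, s, rfl⟩; exact ⟨s, rfl⟩
    have hB : ∀ t : range α, (t : ↥(S \ B)) ∈ q '' strip := by
      rintro ⟨_, s, rfl⟩; exact hV s
    have h1 := hτ.comp (k := fun t : range α => ⟨((t : ↥(S \ B)) : S3), hA t⟩)
      ((continuous_subtype_val.comp continuous_subtype_val).subtype_mk hA)
    have h1' : cW.IsSection (Subtype.val : range α → ↥(S \ B)) _ := ⟨h1.1, h1.2⟩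
    have h2 := hρ.comp (k := fun t : range α => ⟨(t : ↥(S \ B)), hB t⟩)
      (continuous_subtype_val.subtype_mk hB)
    exact SignCocycle.IsSection.not_flip hα h01 hσ hflip (V := range α) (fun t => ⟨t, rfl⟩)
      (h1'.mul h2) (fun t => hdom _)
  · have hκf : ∀ i, (Subtype.val ∘ α) 0 ∈ cX.U i → κ i 1 = -κ i 0 := fun i hi => by
      rw [hε i hi, neg_one_mul]
    obtain ⟨N, -, hNS, hN, ⟨e⟩⟩ := hCo
      (oddLinking_of_section hs hh hfix hπ hβ h01' (hγ.trans hO) hκ' hκf)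
    obtain ⟨q, hq, hγq⟩ := hS.exists_isStripMap (isBandMap_mobius.homeomorph e.symm) hNS hN
    have hV : ∀ t, α t ∈ q '' strip := fun t => hγq _ ⟨t, rfl⟩
    have hqc : Continuous (fun z : strip => q z) := continuous_iff_continuousAt.2 fun z =>
      (hq.good z z.2).continuousAt.comp continuous_subtype_val.continuousAt
    obtain ⟨τ, hτ⟩ := cW.exists_section_of_contractible hqc (fun z => hdX _)
    obtain ⟨η, hη⟩ := hq.exists_sign hτ (fun z _ => hdX _)
    rcases Int.units_eq_one_or η with rfl | rfl
    · obtain ⟨ρ, hρ⟩ := hq.exists_section hτ (fun z i hi => by rw [hη z i hi, one_mul])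
      exact SignCocycle.IsSection.not_flip hα h01 hκ hκf hV hρ (fun t => hdX _)
    · obtain ⟨ρ, hρ⟩ := hq.exists_section (hτ.mul (isSection_sdeg hq.good)) (fun z i hi => by
        rw [hη z i.1 hi.1, hq.sdeg_shift z.2 i.2 hi.2, neg_one_mul, neg_one_mul, neg_mul_neg])
      exact SignCocycle.IsSection.not_flip hα h01 hσ hflip hV hρ (fun t => hdom _)

end Triviality

/-! ### Charts on compact discs and half discs -/

/-- A closed cone, used as the model of a surface near a point. -/
structure IsClosedCone (P : Set ℂ) : Prop where
  isClosed : IsClosed P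
  zero_mem : 0 ∈ P
  smul_mem : ∀ t : ℝ, 0 < t → ∀ z ∈ P, t • z ∈ P

theorem isClosedCone_univ : IsClosedCone univ := ⟨isClosed_univ, mem_univ _, fun _ _ _ _ => mem_univ _⟩

/-- The closed right half plane in `ℂ`. -/
def rightHalf : Set ℂ := {z | 0 ≤ z.re}

theorem isClosedCone_rightHalf : IsClosedCone rightHalf :=
  ⟨isClosed_le continuous_const Complex.continuous_re, le_refl (0 : ℝ), fun t ht z hz => by
    have hz' : 0 ≤ z.re := hz
    change 0 ≤ (t • z).re
    rw [Complex.smul_re]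
    exact mul_nonneg ht.le hz'⟩

/-- `e` is a parametrization of a neighbourhood of `x` in `S` by the unit ball of `P`. -/
structure IsChartAt (S : Set S3) (x : S3) (P : Set ℂ) (e : ℂ → S3) : Prop where
  cont : ContinuousOn e (closedBall 0 1 ∩ P)
  inj : InjOn e (closedBall 0 1 ∩ P)
  map_zero : e 0 = x
  subset : e '' (closedBall 0 1 ∩ P) ⊆ S
  mem_nhds : e '' (closedBall 0 1 ∩ P) ∈ 𝓝[S] x

theorem IsClosedCone.isCompact_inter {P : Set ℂ} (hP : IsClosedCone P) (r : ℝ) :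
    IsCompact (closedBall (0 : ℂ) r ∩ P) := (isCompact_closedBall 0 r).inter_right hP.isClosed

theorem IsClosedCone.zero_mem_inter {P : Set ℂ} (hP : IsClosedCone P) :
    (0 : ℂ) ∈ closedBall (0 : ℂ) 1 ∩ P := ⟨by simp, hP.zero_mem⟩

namespace IsChartAt

variable {S : Set S3} {x : S3} {P : Set ℂ} {e : ℂ → S3}

theorem image_inter_mem (he : IsChartAt S x P e) (hP : IsClosedCone P) {N : Set ℂ}
    (hN : N ∈ 𝓝 0) : e '' ((closedBall 0 1 ∩ P) ∩ N) ∈ 𝓝[S] x := by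
  have hc : IsCompact (e '' ((closedBall 0 1 ∩ P) \ interior N)) :=
    ((hP.isCompact_inter 1).diff isOpen_interior).image_of_continuousOn (he.cont.mono sdiff_subset)
  have hx : (e '' ((closedBall 0 1 ∩ P) \ interior N))ᶜ ∈ 𝓝 x := by
    refine hc.isClosed.isOpen_compl.mem_nhds ?_
    rintro ⟨z, hz, hzx⟩
    have : z = 0 := he.inj hz.1 hP.zero_mem_inter (hzx.trans he.map_zero.symm)
    exact hz.2 (this ▸ mem_interior_iff_mem_nhds.2 hN)
  filter_upwards [he.mem_nhds, mem_nhdsWithin_of_mem_nhds hx]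
  rintro _ ⟨z, hz, rfl⟩ hz'
  refine ⟨z, ⟨hz, ?_⟩, rfl⟩
  by_contra hzN
  exact hz' ⟨z, ⟨hz, fun h => hzN (interior_subset h)⟩, rfl⟩

theorem scale (he : IsChartAt S x P e) (hP : IsClosedCone P) {r : ℝ} (hr : 0 < r) (hr1 : r ≤ 1) :
    IsChartAt S x P (fun z => e (r • z)) := by
  have hm : MapsTo (fun z : ℂ => r • z) (closedBall 0 1 ∩ P) (closedBall 0 1 ∩ P) := by
    rintro z ⟨hz, hzP⟩
    refine ⟨?_, hP.smul_mem r hr z hzP⟩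
    rw [mem_closedBall_zero_iff] at hz ⊢
    rw [norm_smul, Real.norm_of_nonneg hr.le]
    exact mul_le_one₀ hr1 (norm_nonneg _) hz
  refine ⟨he.cont.comp (continuous_const_smul r).continuousOn hm,
    he.inj.comp (fun a _ b _ hab => smul_right_injective ℂ hr.ne' hab) hm,
    by simpa using he.map_zero, ?_, ?_⟩
  · rintro _ ⟨z, hz, rfl⟩
    exact he.subset ⟨_, hm hz, rfl⟩
  · refine Filter.mem_of_superset (he.image_inter_mem hP (ball_mem_nhds 0 hr)) ?_
    rintro _ ⟨z, ⟨hz, hzr⟩, rfl⟩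
    refine ⟨r⁻¹ • z, ⟨?_, hP.smul_mem _ (inv_pos.2 hr) z hz.2⟩, ?_⟩
    · rw [mem_ball_zero_iff] at hzr
      rw [mem_closedBall_zero_iff, norm_smul, Real.norm_of_nonneg (inv_pos.2 hr).le,
        inv_mul_le_one₀ hr]
      exact hzr.le
    · simp only [smul_inv_smul₀ hr.ne']

/-- Restriction of a chart to a small ball gives a parametrization by the whole model. -/
theorem exists_homeomorph (he : IsChartAt S x P e) (hP : IsClosedCone P) :
    ∃ (U : Set S3) (_ : IsOpen U) (hx : x ∈ U ∩ S) (φ : (U ∩ S : Set S3) ≃ₜ P),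
      (φ ⟨x, hx⟩ : ℂ) = 0 := by
  obtain ⟨W, hW, hxW, hWS⟩ := mem_nhdsWithin.1 he.mem_nhds
  have hev : ∀ᶠ z in 𝓝[closedBall 0 1 ∩ P] (0 : ℂ), e z ∈ W :=
    (he.cont 0 hP.zero_mem_inter).eventually_mem (hW.mem_nhds (he.map_zero.symm ▸ hxW))
  obtain ⟨r, hr, hrW⟩ := Metric.mem_nhdsWithin_iff.1 hev
  obtain ⟨s, hs, hs1, hsr⟩ : ∃ s : ℝ, 0 < s ∧ s ≤ 1 ∧ s ≤ r :=
    ⟨min r 1, lt_min hr one_pos, min_le_right _ _, min_le_left _ _⟩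
  have hsub : ball (0 : ℂ) s ∩ P ⊆ closedBall 0 1 ∩ P :=
    inter_subset_inter_left _ ((ball_subset_ball hs1).trans ball_subset_closedBall)
  let C := e '' ((closedBall 0 1 ∩ P) \ ball 0 s)
  have hC : IsClosed C := (((hP.isCompact_inter 1).diff isOpen_ball).image_of_continuousOn
    (he.cont.mono sdiff_subset)).isClosed
  have hUS : (W \ C) ∩ S = e '' (ball 0 s ∩ P) := by
    ext p
    constructor
    · rintro ⟨⟨hpW, hpC⟩, hpS⟩
      obtain ⟨z, hz, rfl⟩ := hWS ⟨hpW, hpS⟩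
      refine ⟨z, ⟨?_, hz.2⟩, rfl⟩
      by_contra hzs
      exact hpC ⟨z, ⟨hz, hzs⟩, rfl⟩
    · rintro ⟨z, hz, rfl⟩
      refine ⟨⟨hrW ⟨ball_subset_ball hsr hz.1, hsub hz⟩, ?_⟩, he.subset ⟨z, hsub hz, rfl⟩⟩
      rintro ⟨w, hw, hwz⟩
      exact hw.2 (he.inj hw.1 (hsub hz) hwz ▸ hz.1)
  let u : OpenPartialHomeomorph ℂ ℂ := OpenPartialHomeomorph.univUnitBall
  have hu : IsEmbedding u := (u.isOpenEmbedding rfl).isEmbedding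
  have hus : IsEmbedding (fun z : ℂ => s • u z) :=
    (Homeomorph.smulOfNeZero s hs.ne').isEmbedding.comp hu
  have hu' : ∀ z, s • u z ∈ ball (0 : ℂ) s := fun z => by
    have : u z ∈ ball (0 : ℂ) 1 := u.map_source (mem_univ z)
    rw [mem_ball_zero_iff] at this ⊢
    rw [norm_smul, Real.norm_of_nonneg hs.le]
    exact mul_lt_of_lt_one_right hs this
  have hpos : ∀ z : ℂ, 0 < (√(1 + ‖z‖ ^ 2))⁻¹ := fun z => by positivity
  have huP : ∀ z : ℂ, z ∈ P ↔ s • u z ∈ P := fun z => by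
    refine ⟨fun hz => hP.smul_mem s hs _ (hP.smul_mem _ (hpos z) z hz), fun hz => ?_⟩
    have h1 := hP.smul_mem _ (inv_pos.2 (hpos z)) _ (hP.smul_mem _ (inv_pos.2 hs) _ hz)
    rw [inv_smul_smul₀ hs.ne'] at h1
    have h2 : u z = (√(1 + ‖z‖ ^ 2))⁻¹ • z := rfl
    rwa [h2, inv_smul_smul₀ (hpos z).ne'] at h1
  have hD : ∀ z : P, s • u (z : ℂ) ∈ closedBall (0 : ℂ) 1 ∩ P := fun z =>
    hsub ⟨hu' z, (huP z).1 z.2⟩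
  have h1 : IsEmbedding (fun z : P => (⟨s • u (z : ℂ), hD z⟩ : ↥(closedBall (0 : ℂ) 1 ∩ P))) :=
    (hus.comp IsEmbedding.subtypeVal).codRestrict _ hD
  have : CompactSpace ↥(closedBall (0 : ℂ) 1 ∩ P) :=
    isCompact_iff_compactSpace.1 (hP.isCompact_inter 1)
  have h2 : IsEmbedding (fun z : ↥(closedBall (0 : ℂ) 1 ∩ P) => e z) :=
    ((continuousOn_iff_continuous_domRestrict.1 he.cont).isClosedEmbedding
      (injOn_iff_injective.1 he.inj)).isEmbedding
  let j : P → S3 := fun z => e (s • u (z : ℂ))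
  have hj : IsEmbedding j := h2.comp h1
  have hjr : range j = (W \ C) ∩ S := by
    rw [hUS]
    ext p
    constructor
    · rintro ⟨z, rfl⟩
      exact ⟨_, ⟨hu' z, (huP z).1 z.2⟩, rfl⟩
    · rintro ⟨z, hz, rfl⟩
      have hz1 : s⁻¹ • z ∈ u.target := by
        change _ ∈ ball (0 : ℂ) 1
        have := mem_ball_zero_iff.1 hz.1
        rw [mem_ball_zero_iff, norm_smul, Real.norm_of_nonneg (inv_pos.2 hs).le,
          inv_mul_lt_one₀ hs]
        exact this
      have hz2 : s • u (u.symm (s⁻¹ • z)) = z := by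
        rw [u.right_inv hz1, smul_inv_smul₀ hs.ne']
      exact ⟨⟨u.symm (s⁻¹ • z), (huP _).2 (hz2.symm ▸ hz.2)⟩, congrArg e hz2⟩
  have hj0 : j ⟨0, hP.zero_mem⟩ = x := by
    have : u 0 = 0 := by simp [u]
    simp only [j, this, smul_zero, he.map_zero]
  have hx : x ∈ (W \ C) ∩ S := hjr ▸ ⟨_, hj0⟩
  let φ := (hj.toHomeomorph.trans (Homeomorph.setCongr hjr)).symm
  refine ⟨W \ C, hW.sdiff hC, hx, φ, ?_⟩
  have : φ ⟨x, hx⟩ = ⟨0, hP.zero_mem⟩ := by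
    rw [← φ.apply_symm_apply ⟨0, hP.zero_mem⟩]
    exact congrArg φ (Subtype.ext hj0.symm)
  rw [this]

theorem of_homeomorph (hP : IsClosedCone P) {U : Set S3} (hU : IsOpen U) (hx : x ∈ U ∩ S)
    (φ : (U ∩ S : Set S3) ≃ₜ P) (hφ : (φ ⟨x, hx⟩ : ℂ) = 0) : ∃ e, IsChartAt S x P e := by
  classical
  let e : ℂ → S3 := fun z => if hz : z ∈ P then φ.symm ⟨z, hz⟩ else x
  have he : ∀ z : P, e z = φ.symm z := fun z => dif_pos z.2
  have hec : ContinuousOn e P := by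
    rw [continuousOn_iff_continuous_domRestrict]
    have : P.domRestrict e = fun z => (φ.symm z : S3) := funext he
    rw [this]
    exact continuous_subtype_val.comp φ.symm.continuous
  have hei : InjOn e P := by
    intro a ha b hb hab
    have h1 : φ.symm ⟨a, ha⟩ = φ.symm ⟨b, hb⟩ :=
      Subtype.ext ((he ⟨a, ha⟩).symm.trans (hab.trans (he ⟨b, hb⟩)))
    exact congrArg Subtype.val (φ.symm.injective h1)
  refine ⟨e, hec.mono inter_subset_right, hei.mono inter_subset_right, ?_, ?_, ?_⟩
  · have : φ.symm ⟨0, hP.zero_mem⟩ = ⟨x, hx⟩ := by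
      rw [Homeomorph.symm_apply_eq]; exact Subtype.ext hφ.symm
    exact (he ⟨0, hP.zero_mem⟩).trans (congrArg Subtype.val this)
  · rintro _ ⟨z, hz, rfl⟩
    rw [he ⟨z, hz.2⟩]
    exact (φ.symm ⟨z, hz.2⟩).2.2
  · have h1 : ∀ᶠ p in 𝓝 (⟨x, hx⟩ : (U ∩ S : Set S3)), (φ p : ℂ) ∈ closedBall (0 : ℂ) 1 :=
      (continuous_subtype_val.comp φ.continuous).continuousAt.eventually_mem
        (by simp only [comp_apply, hφ]; exact closedBall_mem_nhds _ one_pos)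
    rw [nhds_subtype_eq_comap, Filter.eventually_comap] at h1
    have h2 : ∀ᶠ p in 𝓝[S] x, p ∈ U ∩ S :=
      Filter.inter_mem (mem_nhdsWithin_of_mem_nhds (hU.mem_nhds hx.1)) self_mem_nhdsWithin
    filter_upwards [mem_nhdsWithin_of_mem_nhds h1, h2] with p hp hpU
    refine ⟨φ ⟨p, hpU⟩, ⟨hp ⟨p, hpU⟩ rfl, (φ ⟨p, hpU⟩).2⟩, ?_⟩
    rw [he, φ.symm_apply_apply]

theorem isInteriorPointOf (he : IsChartAt S x univ e) : IsInteriorPointOf S x := by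
  obtain ⟨U, hU, hx, φ, -⟩ := he.exists_homeomorph isClosedCone_univ
  exact ⟨U, hU, hx.1, ⟨(φ.trans (Homeomorph.Set.univ ℂ)).trans
    Complex.equivRealProdCLM.toHomeomorph⟩⟩

end IsChartAt

/-- The half plane in `ℝ × ℝ` and in `ℂ`. -/
def halfPlaneHomeomorph : rightHalf ≃ₜ halfPlane :=
  Complex.equivRealProdCLM.toHomeomorph.sets rfl

theorem IsChartAt.isBoundaryPointOf {S : Set S3} {x : S3} {e : ℂ → S3}
    (he : IsChartAt S x rightHalf e) : IsBoundaryPointOf S x := by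
  obtain ⟨U, hU, hx, φ, hφ⟩ := he.exists_homeomorph isClosedCone_rightHalf
  refine ⟨U, hU, hx, φ.trans halfPlaneHomeomorph, ?_⟩
  change (φ ⟨x, hx⟩ : ℂ).re = 0
  rw [hφ, Complex.zero_re]

theorem IsInteriorPointOf.exists_isChartAt {S : Set S3} {x : S3} (h : IsInteriorPointOf S x)
    (hx : x ∈ S) : ∃ e, IsChartAt S x univ e := by
  obtain ⟨U, hU, hxU, ⟨φ⟩⟩ := h
  let ψ := φ.trans Complex.equivRealProdCLM.toHomeomorph.symm
  let χ := (ψ.trans (Homeomorph.addRight (-ψ ⟨x, hxU, hx⟩))).trans (Homeomorph.Set.univ ℂ).symm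
  refine IsChartAt.of_homeomorph isClosedCone_univ hU ⟨hxU, hx⟩ χ ?_
  change ψ ⟨x, hxU, hx⟩ + -ψ ⟨x, hxU, hx⟩ = 0
  exact add_neg_cancel _

theorem IsBoundaryPointOf.exists_isChartAt {S : Set S3} {x : S3} (h : IsBoundaryPointOf S x) :
    ∃ e, IsChartAt S x rightHalf e := by
  obtain ⟨U, hU, hx, φ, hφ⟩ := h
  let ψ := φ.trans halfPlaneHomeomorph.symm
  let v : ℂ := -(ψ ⟨x, hx⟩ : ℂ)
  have hv : v.re = 0 := by
    change -(ψ ⟨x, hx⟩ : ℂ).re = 0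
    rw [neg_eq_zero]
    exact hφ
  let τ : rightHalf ≃ₜ rightHalf := (Homeomorph.addRight v).sets (by
    ext z
    change 0 ≤ z.re ↔ 0 ≤ (z + v).re
    rw [Complex.add_re, hv, add_zero])
  refine IsChartAt.of_homeomorph isClosedCone_rightHalf hU hx (ψ.trans τ) ?_
  change (ψ ⟨x, hx⟩ : ℂ) + -(ψ ⟨x, hx⟩ : ℂ) = 0
  exact add_neg_cancel _

/-! ### Lifting charts through the branched double cover -/

theorem ContinuousOn.continuousOn_invFunOn {D : Set ℂ} (hD : IsCompact D) {e : ℂ → S3}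
    (hc : ContinuousOn e D) (hi : InjOn e D) : ContinuousOn (invFunOn e D) (e '' D) := by
  have : CompactSpace D := isCompact_iff_compactSpace.1 hD
  have h2 : IsClosedEmbedding (D.domRestrict e) :=
    (continuousOn_iff_continuous_domRestrict.1 hc).isClosedEmbedding (injOn_iff_injective.1 hi)
  rw [continuousOn_iff_isClosed]
  intro t ht
  refine ⟨e '' (D ∩ t), ((hD.inter_right ht).image_of_continuousOn
    (hc.mono inter_subset_left)).isClosed, ?_⟩
  ext p
  constructor
  · rintro ⟨hp, z, hz, rfl⟩
    refine ⟨⟨z, ⟨hz, ?_⟩, rfl⟩, ⟨z, hz, rfl⟩⟩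
    rw [mem_preimage, hi.leftInvOn_invFunOn hz] at hp
    exact hp
  · rintro ⟨⟨z, ⟨hz, hzt⟩, rfl⟩, hp⟩
    refine ⟨?_, hp⟩
    rw [mem_preimage, hi.leftInvOn_invFunOn hz]
    exact hzt

theorem invFunOn_mem_of_mem {D : Set ℂ} {e : ℂ → S3} {p : S3} (hp : p ∈ e '' D) :
    invFunOn e D p ∈ D ∧ e (invFunOn e D p) = p := ⟨invFunOn_mem hp, invFunOn_eq hp⟩

/-- Near a boundary chart's centre, the boundary corresponds to the imaginary axis. -/
theorem IsSurfaceWithBoundary.eventually_mem_iff {S B : Set S3} (hS : IsSurfaceWithBoundary S B)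
    {y : S3} {e : ℂ → S3} (he : IsChartAt S y rightHalf e) :
    ∀ᶠ z in 𝓝 (0 : ℂ), z ∈ rightHalf → (e z ∈ B ↔ z.re = 0) := by
  let D := closedBall (0 : ℂ) 1 ∩ rightHalf
  have hD : IsCompact D := isClosedCone_rightHalf.isCompact_inter 1
  obtain ⟨W, hW, hyW, hWS⟩ := mem_nhdsWithin.1 he.mem_nhds
  have hev : ∀ᶠ z in 𝓝[D] (0 : ℂ), e z ∈ W :=
    (he.cont 0 isClosedCone_rightHalf.zero_mem_inter).eventually_mem
      (hW.mem_nhds (he.map_zero.symm ▸ hyW))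
  filter_upwards [eventually_nhdsWithin_iff.1 hev, ball_mem_nhds (0 : ℂ) one_pos] with z hzW hz1 hzP
  have hzD : z ∈ D := ⟨ball_subset_closedBall hz1, hzP⟩
  have hzS : e z ∈ S := he.subset ⟨z, hzD, rfl⟩
  constructor
  · intro hzB
    by_contra hre
    have hpos : 0 < z.re := lt_of_le_of_ne hzP (Ne.symm hre)
    have hDz : D ∈ 𝓝 z := by
      filter_upwards [isOpen_ball.mem_nhds hz1,
        (isOpen_lt continuous_const Complex.continuous_re).mem_nhds hpos] with w hw hw'
      exact ⟨ball_subset_closedBall hw, le_of_lt hw'⟩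
    refine hS.not_goodAt (goodAt_iff.2 ⟨D, hDz, he.cont, he.inj⟩) ?_ hzB
    filter_upwards [hDz] with w hw
    exact he.subset ⟨w, hw, rfl⟩
  · intro hre
    by_contra hzB
    obtain ⟨U, g, -, hzU, hg, hgr⟩ := (hS.2.2.2.1 _ ⟨hzS, hzB⟩).exists_embedding
    have : e z ∈ range g := hgr ▸ ⟨hzU, hzS⟩
    obtain ⟨w, hw⟩ := this
    have hgD : ∀ᶠ w' in 𝓝 w, g w' ∈ e '' D := by
      filter_upwards [hg.continuous.continuousAt.eventually_mem
        (hW.mem_nhds (hw.symm ▸ hzW hzD))] with w' hw'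
      refine hWS ⟨hw', ?_⟩
      have : g w' ∈ U ∩ S := hgr ▸ mem_range_self w'
      exact this.2
    have hgood : GoodAt (invFunOn e D ∘ g) w := by
      refine goodAt_iff.2 ⟨{w' | g w' ∈ e '' D}, hgD, ?_, ?_⟩
      · exact (he.cont.continuousOn_invFunOn hD he.inj).comp hg.continuous.continuousOn
          (fun w' hw' => hw')
      · intro a ha b hb hab
        have h1 := (invFunOn_mem_of_mem ha).2
        have h2 := (invFunOn_mem_of_mem hb).2
        simp only [comp_apply] at hab
        exact hg.injective (by rw [← h1, ← h2, hab])
    refine hgood.not_eventually_re_nonneg ?_ ?_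
    · have : invFunOn e D (e z) = z := he.inj.leftInvOn_invFunOn hzD
      simp only [comp_apply, hw, this, hre]
    · filter_upwards [hgD] with w' hw'
      exact (invFunOn_mem_of_mem hw').1.2

namespace IsQuotProj

variable {h π : S3 → S3}

theorem exists_injOn (hπ : IsQuotProj h π) (hc : Continuous h) {x : S3} (hx : h x ≠ x) :
    ∃ V, IsOpen V ∧ x ∈ V ∧ InjOn π V := by
  obtain ⟨u, v, hu, hv, hxu, hxv, huv⟩ := t2_separation hx.symm
  refine ⟨u ∩ h ⁻¹' v, hu.inter (hv.preimage hc), ⟨hxu, hxv⟩, fun a ha b hb hab => ?_⟩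
  rcases hπ.eq_iff.1 hab with h1 | h1
  · exact h1.symm
  · have hb' : b ∈ v := by rw [h1]; exact ha.2
    exact absurd hb' (disjoint_left.1 huv hb.1)

/-- Away from the fixed point set, charts lift. -/
theorem exists_isChartAt_of_ne (hπ : IsQuotProj h π) (hc : Continuous h) {x : S3} (hx : h x ≠ x)
    {S : Set S3} {P : Set ℂ} (hP : IsClosedCone P) {e : ℂ → S3} (he : IsChartAt S (π x) P e) :
    ∃ E, IsChartAt (π ⁻¹' S) x P E := by
  have : Nonempty S3 := ⟨x⟩
  obtain ⟨V, hV, hxV, hVi⟩ := hπ.exists_injOn hc hx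
  have hVo : IsOpen (π '' V) := hπ.isOpenMap hc V hV
  have hev : ∀ᶠ z in 𝓝[closedBall 0 1 ∩ P] (0 : ℂ), e z ∈ π '' V :=
    (he.cont 0 hP.zero_mem_inter).eventually_mem
      (hVo.mem_nhds (he.map_zero.symm ▸ mem_image_of_mem π hxV))
  obtain ⟨r, hr, hrV⟩ := Metric.mem_nhdsWithin_iff.1 hev
  obtain ⟨s, hs, hs1, hsr⟩ : ∃ s : ℝ, 0 < s ∧ s ≤ 1 ∧ s < r :=
    ⟨min (r / 2) 1, lt_min (half_pos hr) one_pos, min_le_right _ _,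
      (min_le_left _ _).trans_lt (half_lt_self hr)⟩
  have he' := he.scale hP hs hs1
  set f : ℂ → S3 := fun z => e (s • z) with hf
  have hfV : ∀ z ∈ closedBall (0 : ℂ) 1 ∩ P, f z ∈ π '' V := fun z hz => by
    have hz1 : ‖z‖ ≤ 1 := mem_closedBall_zero_iff.1 hz.1
    have hn : ‖s • z‖ ≤ s := by
      rw [norm_smul, Real.norm_of_nonneg hs.le]
      exact mul_le_of_le_one_right hs.le hz1
    exact hrV ⟨mem_ball_zero_iff.2 (hn.trans_lt hsr),
      mem_closedBall_zero_iff.2 (hn.trans hs1), hP.smul_mem s hs z hz.2⟩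
  let g := invFunOn π V
  have hg : ContinuousOn g (π '' V) := by
    refine IsOpenMap.continuousOn_image_of_leftInvOn ?_ hVi.leftInvOn_invFunOn
    exact (hπ.isOpenMap hc).comp hV.isOpenMap_subtype_val
  have hgπ : ∀ p ∈ π '' V, π (g p) = p := fun p hp => invFunOn_eq hp
  refine ⟨fun z => g (f z), hg.comp he'.cont hfV, fun a ha b hb hab => he'.inj ha hb ?_, ?_, ?_, ?_⟩
  · rw [← hgπ _ (hfV a ha), ← hgπ _ (hfV b hb)]
    exact congrArg π hab
  · rw [he'.map_zero]
    exact hVi.leftInvOn_invFunOn hxV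
  · rintro _ ⟨z, hz, rfl⟩
    change π (g (f z)) ∈ S
    rw [hgπ _ (hfV z hz)]
    exact he'.subset ⟨z, hz, rfl⟩
  · have h1 : π ⁻¹' (f '' (closedBall 0 1 ∩ P)) ∈ 𝓝[π ⁻¹' S] x :=
      (hπ.continuous.continuousWithinAt.tendsto_nhdsWithin (mapsTo_preimage π S)) he'.mem_nhds
    filter_upwards [h1, mem_nhdsWithin_of_mem_nhds (hV.mem_nhds hxV)]
    rintro p ⟨z, hz, hzp⟩ hpV
    refine ⟨z, hz, ?_⟩
    simp only [hzp]
    exact hVi.leftInvOn_invFunOn hpV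

/-- Maps from contractible spaces into the complement of the branch set lift. -/
theorem exists_lift (hπ : IsQuotProj h π) (hc : Continuous h) {A : Type*} [TopologicalSpace A]
    [ContractibleSpace A] {f : A → S3} (hf : Continuous f) (hO : ∀ a, f a ∉ π '' fixedPoints h) :
    ∃ F : A → S3, Continuous F ∧ ∀ a, π (F a) = f a := by
  classical
  let hp := hπ.isDoubleCover hc
  obtain ⟨σ, hσ⟩ := hp.cocycle.exists_section_of_contractible hf (fun a => by
    rw [hp.dom_cocycle, hπ.range_proj]; exact hO a)
  have hy : ∀ a, ∃ y : ↥(fixedPoints h)ᶜ, proj h π y = f a := fun a => by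
    have : f a ∈ range (proj h π) := by rw [hπ.range_proj]; exact hO a
    exact this
  choose y hy using hy
  let F : A → S3 := fun a => if σ (y a) a = 1 then y a else h (y a)
  have hF : ∀ a, π (F a) = f a := fun a => by
    by_cases h1 : σ (y a) a = 1
    · simp only [F, if_pos h1]; exact hy a
    · simp only [F, if_neg h1, hπ.map_h]; exact hy a
  have key : ∀ i a, f a ∈ hp.cocycle.U i →
      F a = if σ i a = 1 then ((hp.chart i).symm (f a) : S3) else h ((hp.chart i).symm (f a)) := by
    intro i a hi
    have hya : f a ∈ hp.cocycle.U (y a) := by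
      rw [← hy a]; exact hp.mem_chart_target (y a)
    have h1 := hσ.compat (y a) i a hya hi
    have h2 : (hp.chart (y a)).symm (f a) = y a := by
      rw [← hy a]; exact hp.chart_symm_proj (y a)
    have h3 : hp.cocycle.g (y a) i (f a) =
        if (hp.chart (y a)).symm (f a) = (hp.chart i).symm (f a) then 1 else -1 := by
      simp only [IsDoubleCover.cocycle]
      congr
    rw [h2] at h3
    have h4 : π (y a) = π ((hp.chart i).symm (f a)) :=
      (hy a).trans (hp.proj_chart_symm hi).symm
    by_cases h5 : y a = (hp.chart i).symm (f a)
    · rw [h3, if_pos h5, one_mul] at h1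
      simp only [F, h1, ← h5]
    · have h6 : ((hp.chart i).symm (f a) : S3) = h (y a) :=
        (hπ.eq_iff.1 h4).resolve_left fun h => h5 (Subtype.ext h.symm)
      have h7 : h ((hp.chart i).symm (f a)) = (y a : S3) :=
        (((hπ.eq_iff.1 h4.symm).resolve_left fun h => h5 (Subtype.ext h))).symm
      rw [h3, if_neg h5, neg_one_mul] at h1
      rw [h7, h6]
      rcases Int.units_eq_one_or (σ (y a) a) with h8 | h8
      · rw [h8] at h1
        simp only [F, h8, h1]
        simp
      · rw [h8, neg_neg] at h1
        simp only [F, h8, h1]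
        simp
  refine ⟨F, continuous_iff_continuousAt.2 fun a => ?_, hF⟩
  have hya : f a ∈ hp.cocycle.U (y a) := by
    rw [← hy a]; exact hp.mem_chart_target (y a)
  have hcs : ContinuousAt (fun a' => ((hp.chart (y a)).symm (f a') : S3)) a :=
    continuous_subtype_val.continuousAt.comp
      (ContinuousAt.comp ((hp.chart (y a)).continuousAt_symm hya) hf.continuousAt)
  have hev : ∀ᶠ a' in 𝓝 a, f a' ∈ hp.cocycle.U (y a) :=
    hf.continuousAt.eventually_mem ((hp.cocycle.isOpen (y a)).mem_nhds hya)
  by_cases h1 : σ (y a) a = 1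
  · refine hcs.congr ?_
    filter_upwards [hev, hσ.locConst (y a) a hya] with a' h2 h3
    rw [key _ _ h2, h3, if_pos h1]
  · refine (hc.continuousAt.comp hcs).congr ?_
    filter_upwards [hev, hσ.locConst (y a) a hya] with a' h2 h3
    rw [key _ _ h2, h3, if_neg h1]
    rfl

/-- Over a branch point, the projection induces the topology. -/
theorem nhds_eq_comap (hπ : IsQuotProj h π) {x : S3} (hx : h x = x) :
    𝓝 x = Filter.comap π (𝓝 (π x)) := by
  refine le_antisymm hπ.continuous.continuousAt.le_comap ?_
  intro U hU
  obtain ⟨V, hVU, hV, hxV⟩ := _root_.mem_nhds_iff.1 hU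
  refine Filter.mem_comap.2 ⟨(π '' Vᶜ)ᶜ,
    (hπ.isClosedMap _ hV.isClosed_compl).isOpen_compl.mem_nhds ?_, ?_⟩
  · rintro ⟨y, hy, hyx⟩
    exact hy (hπ.eq_of_fixed hx hyx.symm ▸ hxV)
  · intro y hy
    by_contra hyU
    exact hy ⟨y, fun hyV => hyU (hVU hyV), rfl⟩

/-- A half disc touching the branch set only along its diameter lifts. -/
theorem exists_lift_halfDisc (hπ : IsQuotProj h π) (hc : Continuous h) {e : ℂ → S3}
    (he : ContinuousOn e (closedBall 0 1 ∩ rightHalf))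
    (hO : ∀ z ∈ closedBall (0 : ℂ) 1 ∩ rightHalf, e z ∈ π '' fixedPoints h → z.re = 0) :
    ∃ F : ℂ → S3, ContinuousOn F (closedBall 0 1 ∩ rightHalf) ∧
      ∀ z ∈ closedBall (0 : ℂ) 1 ∩ rightHalf, π (F z) = e z := by
  classical
  set D := closedBall (0 : ℂ) 1 ∩ rightHalf with hD
  have hDc : Convex ℝ D := (convex_closedBall 0 1).inter (convex_halfSpace_re_ge 0)
  let C : Set ℂ := {z ∈ D | e z ∉ π '' fixedPoints h}
  have h1D : (1 : ℂ) ∈ D := ⟨by simp, by simp [rightHalf]⟩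
  have h1C : (1 : ℂ) ∈ C := ⟨h1D, fun hO1 => by simpa using hO 1 h1D hO1⟩
  have hstar : StarConvex ℝ 1 C := by
    intro z hz a b ha hb hab
    rcases ha.eq_or_lt with rfl | ha'
    · have : b = 1 := by linarith
      subst this
      simpa using hz
    · have hm := hDc h1D hz.1 ha hb hab
      refine ⟨hm, fun hO1 => ?_⟩
      have h2 := hO _ hm hO1
      have hz0 : 0 ≤ z.re := hz.1.2
      simp only [Complex.add_re, Complex.smul_re, Complex.one_re, smul_eq_mul, mul_one] at h2
      nlinarith [mul_nonneg hb hz0]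
  have : ContractibleSpace C := hstar.contractibleSpace ⟨1, h1C⟩
  have hCD : C ⊆ D := fun z hz => hz.1
  obtain ⟨G, hGc, hG⟩ := hπ.exists_lift hc (f := C.domRestrict e)
    (continuousOn_iff_continuous_domRestrict.1 (he.mono hCD)) (fun a => a.2.2)
  let F : ℂ → S3 := fun z => if hz : z ∈ C then G ⟨z, hz⟩ else (hπ.surjective (e z)).choose
  have hF : ∀ z, π (F z) = e z := fun z => by
    by_cases hz : z ∈ C
    · simp only [F, dif_pos hz]; exact hG ⟨z, hz⟩
    · simp only [F, dif_neg hz]; exact (hπ.surjective (e z)).choose_spec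
  refine ⟨F, fun z hz => ?_, fun z _ => hF z⟩
  by_cases hzC : z ∈ C
  · have hFC : ContinuousOn F C := by
      rw [continuousOn_iff_continuous_domRestrict]
      have : C.domRestrict F = G := funext fun a => dif_pos a.2
      rw [this]
      exact hGc
    refine (hFC z hzC).mono_of_mem_nhdsWithin ?_
    have hOc : IsClosed (π '' fixedPoints h) := hπ.isClosedMap _ (isClosed_fixedPoints hc)
    filter_upwards [(he z hz).eventually_mem (hOc.isOpen_compl.mem_nhds hzC.2),
      self_mem_nhdsWithin] with w hw hwD
    exact ⟨hwD, hw⟩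
  · have hzO : e z ∈ π '' fixedPoints h := by
      by_contra hzO
      exact hzC ⟨hz, hzO⟩
    have hfix : h (F z) = F z := hπ.mem_image_fixed.1 ((hF z).symm ▸ hzO)
    rw [ContinuousWithinAt, hπ.nhds_eq_comap hfix, Filter.tendsto_comap_iff, hF z]
    exact (he z hz).tendsto.congr fun w => (hF w).symm

end IsQuotProj

/-! ### Charts over the branch set -/

namespace IsQuotProj

variable {h π : S3 → S3}

/-- A chart of the double branched cover obtained by unfolding a boundary chart. -/
theorem exists_isChartAt_fold (hπ : IsQuotProj h π) (hc : Continuous h) (hh : Involutive h)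
    {S : Set S3} {x : S3} (hx : h x = x) {e : ℂ → S3} (he : IsChartAt S (π x) rightHalf e)
    (hO : ∀ z ∈ closedBall (0 : ℂ) 1 ∩ rightHalf, e z ∈ π '' fixedPoints h → z.re = 0)
    {P Q : Set ℂ} (hP : IsClosedCone P) (hQ : IsClosed Q) {F ρ : ℂ → ℂ} (hF : Continuous F)
    (hρ : Continuous ρ) (hF0 : F 0 = 0)
    (hFm : MapsTo F (closedBall 0 1 ∩ P) (closedBall 0 1 ∩ rightHalf))
    (hρm : MapsTo ρ (closedBall 0 1 ∩ P) (closedBall 0 1 ∩ P)) (hFρ : ∀ z, F (ρ z) = F z)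
    (hcov : ∀ z, z ∈ Q ∨ ρ z ∈ Q) (hQρ : ∀ z ∈ Q, ρ z ∈ Q → ρ z = z)
    (hinj : ∀ z ∈ closedBall (0 : ℂ) 1 ∩ P, ∀ w ∈ closedBall (0 : ℂ) 1 ∩ P,
      F z = F w → w = z ∨ w = ρ z)
    (hfix : ∀ z ∈ closedBall (0 : ℂ) 1 ∩ P, (e (F z) ∈ π '' fixedPoints h ↔ ρ z = z))
    (hsurj : SurjOn F (closedBall 0 1 ∩ P) (closedBall 0 1 ∩ rightHalf)) :
    ∃ E, IsChartAt (π ⁻¹' S) x P E ∧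
      ∀ z ∈ closedBall (0 : ℂ) 1 ∩ P, π (E z) = e (F z) ∧ E (ρ z) = h (E z) := by
  classical
  obtain ⟨G, hGc, hG⟩ := hπ.exists_lift_halfDisc hc he.cont hO
  set D := closedBall (0 : ℂ) 1 ∩ P with hD
  have hGfix : ∀ z ∈ D, ρ z = z → h (G (F z)) = G (F z) := fun z hz hz' =>
    hπ.mem_image_fixed.1 (by rw [hG _ (hFm hz)]; exact (hfix z hz).2 hz')
  let E : ℂ → S3 := fun z => if z ∈ Q then G (F z) else h (G (F z))
  have hE1 : ∀ z ∈ Q, E z = G (F z) := fun z hz => if_pos hz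
  have hE2 : ∀ z ∈ D, ρ z ∈ Q → E z = h (G (F z)) := fun z hz hz' => by
    by_cases hzQ : z ∈ Q
    · rw [hE1 z hzQ, hGfix z hz (hQρ z hzQ hz')]
    · exact if_neg hzQ
  have hπE : ∀ z ∈ D, π (E z) = e (F z) := fun z hz => by
    rcases hcov z with h1 | h1
    · rw [hE1 z h1, hG _ (hFm hz)]
    · rw [hE2 z hz h1, hπ.map_h, hG _ (hFm hz)]
  have hEρ : ∀ z ∈ D, E (ρ z) = h (E z) := fun z hz => by
    by_cases h1 : ρ z ∈ Q
    · rw [hE1 _ h1, hE2 z hz h1, hFρ, hh]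
    · rw [hE1 z ((hcov z).resolve_right h1)]
      simp only [E, if_neg h1, hFρ]
  have hEc : ContinuousOn E D := by
    have h1 : ContinuousOn (fun z => G (F z)) D := hGc.comp hF.continuousOn hFm
    have h2 : ContinuousOn E (D ∩ Q) :=
      (h1.mono inter_subset_left).congr fun z hz => hE1 z hz.2
    have h3 : ContinuousOn E (D ∩ ρ ⁻¹' Q) :=
      ((hc.comp_continuousOn h1).mono inter_subset_left).congr fun z hz => hE2 z hz.1 hz.2
    have hDc : IsClosed D := (hP.isCompact_inter 1).isClosed
    refine (h2.union_of_isClosed h3 (hDc.inter hQ) (hDc.inter (hQ.preimage hρ))).mono ?_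
    intro z hz
    exact (hcov z).imp (fun h => ⟨hz, h⟩) (fun h => ⟨hz, h⟩)
  refine ⟨E, ⟨hEc, ?_, ?_, ?_, ?_⟩, fun z hz => ⟨hπE z hz, hEρ z hz⟩⟩
  · intro z hz w hw hzw
    have h1 : e (F z) = e (F w) := by rw [← hπE z hz, ← hπE w hw, hzw]
    rcases hinj z hz w hw (he.inj (hFm hz) (hFm hw) h1) with h2 | h2
    · exact h2.symm
    · have h3 : h (E z) = E z := by rw [← hEρ z hz, ← h2, hzw]
      rw [h2, (hfix z hz).1 (by rw [← hπE z hz]; exact hπ.mem_image_fixed.2 h3)]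
  · refine hπ.eq_of_fixed hx ?_
    rw [hπE 0 hP.zero_mem_inter, hF0, he.map_zero]
  · rintro _ ⟨z, hz, rfl⟩
    change π (E z) ∈ S
    rw [hπE z hz]
    exact he.subset ⟨_, hFm hz, rfl⟩
  · have h1 : π ⁻¹' (e '' (closedBall 0 1 ∩ rightHalf)) ∈ 𝓝[π ⁻¹' S] x :=
      (hπ.continuous.continuousWithinAt.tendsto_nhdsWithin (mapsTo_preimage π S)) he.mem_nhds
    refine Filter.mem_of_superset h1 ?_
    rintro p ⟨w, hw, hwp⟩
    obtain ⟨z, hz, rfl⟩ := hsurj hw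
    rcases hπ.eq_iff.1 ((hπE z hz).trans hwp) with h2 | h2
    · exact ⟨z, hz, h2.symm⟩
    · exact ⟨ρ z, hρm hz, by rw [hEρ z hz, h2]⟩

end IsQuotProj

theorem norm_le_one_iff (z : ℂ) : ‖z‖ ≤ 1 ↔ z.re * z.re + z.im * z.im ≤ 1 := by
  rw [← Complex.normSq_apply, Complex.normSq_eq_norm_sq]
  exact (sq_le_one_iff₀ (norm_nonneg z)).symm

/-- The reflection in the imaginary axis. -/
def reflect (z : ℂ) : ℂ := ⟨-z.re, z.im⟩

theorem continuous_reflect : Continuous reflect :=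
  Complex.equivRealProdCLM.symm.continuous.comp
    (Complex.continuous_re.neg.prodMk Complex.continuous_im)

namespace IsQuotProj

variable {h π : S3 → S3}

/-- The chart at a branch point all of whose neighbouring boundary points are branch points. -/
theorem exists_isChartAt_univ (hπ : IsQuotProj h π) (hc : Continuous h) (hh : Involutive h)
    {S : Set S3} {x : S3} (hx : h x = x) {e : ℂ → S3} (he : IsChartAt S (π x) rightHalf e)
    (hO : ∀ z ∈ closedBall (0 : ℂ) 1 ∩ rightHalf, (e z ∈ π '' fixedPoints h ↔ z.re = 0)) :
    ∃ E, IsChartAt (π ⁻¹' S) x univ E ∧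
      ∀ z ∈ closedBall (0 : ℂ) 1, (h (E z) = E z ↔ z.re = 0) ∧ E (reflect z) = h (E z) := by
  let F : ℂ → ℂ := fun z => ⟨|z.re|, z.im⟩
  have hF : Continuous F := Complex.equivRealProdCLM.symm.continuous.comp
    (Complex.continuous_re.abs.prodMk Complex.continuous_im)
  have hFm : MapsTo F (closedBall 0 1 ∩ univ) (closedBall 0 1 ∩ rightHalf) := by
    intro z hz
    have := (norm_le_one_iff z).1 (mem_closedBall_zero_iff.1 hz.1)
    refine ⟨mem_closedBall_zero_iff.2 ((norm_le_one_iff _).2 ?_), abs_nonneg z.re⟩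
    simpa only [F, abs_mul_abs_self] using this
  have hfx : ∀ z, reflect z = z ↔ z.re = 0 := fun z => by
    rw [Complex.ext_iff]
    simp only [reflect, and_true]
    constructor <;> intro h <;> linarith
  obtain ⟨E, hE, hEp⟩ := hπ.exists_isChartAt_fold hc hh hx he (fun z hz => (hO z hz).1)
    isClosedCone_univ isClosedCone_rightHalf.isClosed (F := F) (ρ := reflect) hF continuous_reflect
    (by simp only [F, Complex.ext_iff]; simp) hFm (by
      intro z hz
      have := (norm_le_one_iff z).1 (mem_closedBall_zero_iff.1 hz.1)
      refine ⟨mem_closedBall_zero_iff.2 ((norm_le_one_iff _).2 ?_), mem_univ _⟩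
      simpa only [reflect, neg_mul_neg] using this)
    (fun z => by simp only [F, reflect, abs_neg])
    (fun z => by
      simp only [rightHalf, mem_ofPred_eq, reflect]
      rcases le_total 0 z.re with h | h
      · exact Or.inl h
      · exact Or.inr (by linarith))
    (fun z hz hz' => by
      rw [hfx]
      have h1 : 0 ≤ z.re := hz
      have h2 : 0 ≤ -z.re := hz'
      linarith)
    (fun z _ w _ hzw => by
      rw [Complex.ext_iff] at hzw
      simp only [F] at hzw
      rw [Complex.ext_iff, Complex.ext_iff]
      simp only [reflect]
      rcases abs_eq_abs.1 hzw.1 with h | h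
      · exact Or.inl ⟨h.symm, hzw.2.symm⟩
      · exact Or.inr ⟨by linarith, hzw.2.symm⟩)
    (fun z hz => by
      rw [hO _ (hFm hz), hfx]
      exact abs_eq_zero)
    (fun w hw => ⟨w, ⟨hw.1, mem_univ _⟩, by
      have : 0 ≤ w.re := hw.2
      simp only [F, abs_of_nonneg this]⟩)
  refine ⟨E, hE, fun z hz => ⟨?_, (hEp z ⟨hz, mem_univ _⟩).2⟩⟩
  rw [← hπ.mem_image_fixed, (hEp z ⟨hz, mem_univ _⟩).1, hO _ (hFm ⟨hz, mem_univ _⟩)]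
  exact abs_eq_zero

/-- The chart at an end point of the branch arc. -/
theorem exists_isChartAt_rightHalf (hπ : IsQuotProj h π) (hc : Continuous h) (hh : Involutive h)
    {S : Set S3} {x : S3} (hx : h x = x) {e : ℂ → S3} (he : IsChartAt S (π x) rightHalf e)
    (hO : ∀ z ∈ closedBall (0 : ℂ) 1 ∩ rightHalf,
      (e z ∈ π '' fixedPoints h ↔ z.re = 0 ∧ z.im ≤ 0)) :
    ∃ E, IsChartAt (π ⁻¹' S) x rightHalf E := by
  let F : ℂ → ℂ := fun z => ⟨2 * z.re * |z.im|, z.im ^ 2 - z.re ^ 2⟩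
  have hF : Continuous F := Complex.equivRealProdCLM.symm.continuous.comp
    (Continuous.prodMk (by fun_prop) (by fun_prop))
  have hsq : ∀ z : ℂ, (2 * z.re * |z.im|) * (2 * z.re * |z.im|) + (z.im ^ 2 - z.re ^ 2) *
      (z.im ^ 2 - z.re ^ 2) = (z.re * z.re + z.im * z.im) ^ 2 := fun z => by
    have := abs_mul_abs_self z.im
    linear_combination (4 * z.re ^ 2) * this
  have hFm : MapsTo F (closedBall 0 1 ∩ rightHalf) (closedBall 0 1 ∩ rightHalf) := by
    intro z hz
    have h1 := (norm_le_one_iff z).1 (mem_closedBall_zero_iff.1 hz.1)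
    have h2 : 0 ≤ z.re := hz.2
    refine ⟨mem_closedBall_zero_iff.2 ((norm_le_one_iff _).2 ?_), ?_⟩
    · simp only [F, hsq]
      exact pow_le_one₀ (add_nonneg (mul_self_nonneg _) (mul_self_nonneg _)) h1
    · exact mul_nonneg (mul_nonneg zero_le_two h2) (abs_nonneg _)
  have hfx : ∀ z : ℂ, (starRingEnd ℂ) z = z ↔ z.im = 0 := fun z => Complex.conj_eq_iff_im
  obtain ⟨E, hE, -⟩ := hπ.exists_isChartAt_fold hc hh hx he (fun z hz h => ((hO z hz).1 h).1)
    isClosedCone_rightHalf (isClosed_le continuous_const Complex.continuous_im : IsClosed {z : ℂ | 0 ≤ z.im})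
    (F := F) (ρ := starRingEnd ℂ) hF Complex.continuous_conj
    (by simp only [F, Complex.ext_iff]; simp) hFm (by
      intro z hz
      have h1 := mem_closedBall_zero_iff.1 hz.1
      have h2 : 0 ≤ z.re := hz.2
      exact ⟨mem_closedBall_zero_iff.2 (by rwa [Complex.norm_conj]), h2⟩)
    (fun z => by simp only [F, Complex.conj_re, Complex.conj_im, abs_neg, neg_sq])
    (fun z => by
      simp only [mem_ofPred_eq, Complex.conj_im]
      rcases le_total 0 z.im with h | h
      · exact Or.inl h
      · exact Or.inr (by linarith))
    (fun z hz hz' => by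
      rw [hfx]
      have h1 : 0 ≤ z.im := hz
      have h2 : 0 ≤ -z.im := hz'
      linarith)
    (fun z hz w hw hzw => by
      have hz0 : 0 ≤ z.re := hz.2
      have hw0 : 0 ≤ w.re := hw.2
      have h1 := hsq z
      have h2 := hsq w
      rw [Complex.ext_iff] at hzw
      simp only [F] at hzw
      rw [hzw.1, hzw.2, h2] at h1
      have h3 : w.re * w.re + w.im * w.im = z.re * z.re + z.im * z.im :=
        (pow_left_inj₀ (add_nonneg (mul_self_nonneg _) (mul_self_nonneg _))
          (add_nonneg (mul_self_nonneg _) (mul_self_nonneg _)) two_ne_zero).1 h1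
      have h4 : w.re ^ 2 = z.re ^ 2 := by linarith [hzw.2]
      have h5 : w.im ^ 2 = z.im ^ 2 := by linarith [hzw.2]
      have h6 : w.re = z.re := (pow_left_inj₀ hw0 hz0 two_ne_zero).1 h4
      rw [Complex.ext_iff, Complex.ext_iff, Complex.conj_re, Complex.conj_im]
      rcases sq_eq_sq_iff_eq_or_eq_neg.1 h5 with h | h
      · exact Or.inl ⟨h6, h⟩
      · exact Or.inr ⟨h6, h⟩)
    (fun z hz => by
      rw [hO _ (hFm hz), hfx]
      have hz0 : 0 ≤ z.re := hz.2
      change 2 * z.re * |z.im| = 0 ∧ z.im ^ 2 - z.re ^ 2 ≤ 0 ↔ z.im = 0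
      constructor
      · rintro ⟨h1, h2⟩
        rcases mul_eq_zero.1 h1 with h | h
        · have : z.re = 0 := by linarith
          rw [this] at h2
          have : z.im ^ 2 = 0 := le_antisymm (by linarith) (sq_nonneg _)
          exact pow_eq_zero_iff two_ne_zero |>.1 this
        · exact abs_eq_zero.1 h
      · intro h
        rw [h]
        simp [sq_nonneg])
    (fun w hw => by
      have hw0 : 0 ≤ w.re := hw.2
      have hn := mem_closedBall_zero_iff.1 hw.1
      have habs := Complex.abs_im_le_norm w
      have h1 : 0 ≤ (‖w‖ - w.im) / 2 := by linarith [(abs_le.1 habs).2]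
      have h2 : 0 ≤ (‖w‖ + w.im) / 2 := by linarith [(abs_le.1 habs).1]
      have hnn : ‖w‖ ^ 2 = w.re * w.re + w.im * w.im := by
        rw [← Complex.normSq_apply, Complex.normSq_eq_norm_sq]
      refine ⟨⟨√((‖w‖ - w.im) / 2), √((‖w‖ + w.im) / 2)⟩, ⟨mem_closedBall_zero_iff.2
        ((norm_le_one_iff _).2 ?_), Real.sqrt_nonneg _⟩, ?_⟩
      · simp only [Real.mul_self_sqrt h1, Real.mul_self_sqrt h2]
        linarith
      · rw [Complex.ext_iff]
        simp only [F, abs_of_nonneg (Real.sqrt_nonneg _), Real.sq_sqrt h1, Real.sq_sqrt h2]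
        refine ⟨?_, by ring⟩
        rw [mul_assoc, ← Real.sqrt_mul h1]
        have : (‖w‖ - w.im) / 2 * ((‖w‖ + w.im) / 2) = (w.re / 2) ^ 2 := by
          linear_combination hnn / 4
        rw [this, Real.sqrt_sq (by linarith)]
        ring)
  exact ⟨E, hE⟩

end IsQuotProj

/-! ### Circles and arcs in the three-sphere -/

/-- A circle is the bijective image of `[0,1)`, starting at any of its points. -/
theorem IsCircleSet.exists_param {O : Set S3} (hO : IsCircleSet O) {x : S3} (hx : x ∈ O) :
    ∃ f : ℝ → S3, Continuous f ∧ f 0 = x ∧ (∀ t, f t ∈ O) ∧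
      (∀ y ∈ O, ∃ t ∈ Icc (0:ℝ) 1, f t = y) ∧ ∀ s t, f s = f t ↔ ∃ n : ℤ, t = s + n := by
  obtain ⟨ψ⟩ := hO
  obtain ⟨t₀, -, ht₀⟩ := exists_circlePt (ψ ⟨x, hx⟩)
  refine ⟨fun t => (ψ.symm (circlePt (t₀ + t)) : S3), ?_, ?_, fun t => Subtype.coe_prop _, ?_, ?_⟩
  · exact continuous_subtype_val.comp (ψ.symm.continuous.comp
      (continuous_circlePt.comp (continuous_const.add continuous_id)))
  · simp [ht₀]
  · intro y hy
    obtain ⟨s, -, hs⟩ := exists_circlePt (ψ ⟨y, hy⟩)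
    refine ⟨Int.fract (s - t₀), ⟨Int.fract_nonneg _, (Int.fract_lt_one _).le⟩, ?_⟩
    have : circlePt (t₀ + Int.fract (s - t₀)) = circlePt s := by
      rw [circlePt_eq_iff]
      refine ⟨⌊s - t₀⌋, ?_⟩
      rw [Int.fract]; ring
    simp only [this, hs, ψ.symm_apply_apply]
  · intro s t
    rw [Subtype.coe_inj, ψ.symm.injective.eq_iff, circlePt_eq_iff]
    exact exists_congr fun n => by constructor <;> intro h <;> linarith

/-- Points of a circle off a subarc are cut points of the closure of the complementary arc. -/
theorem mem_arcInterior_closure_diff {O D : Set S3} (hO : IsCircleSet O) (hDO : D ⊆ O)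
    (hDc : IsClosed D) (hD : IsPreconnected D) (hD2 : D.Nontrivial) {x : S3} (hx : x ∈ O \ D) :
    x ∈ arcInterior (closure (O \ D)) := by
  obtain ⟨f, hf, hf0, hfO, hsurj, hper⟩ := hO.exists_param hx.1
  have hends : ∀ s t, s ∈ Icc (0:ℝ) 1 → t ∈ Icc (0:ℝ) 1 → s < t → f s = f t → s = 0 ∧ t = 1 := by
    intro s t hs ht hst h
    obtain ⟨n, hn⟩ := (hper s t).1 h
    have h1 : (0:ℝ) < n := by linarith
    have h2 : (1:ℝ) ≤ n := by exact_mod_cast (Int.cast_pos.1 h1 : 0 < n)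
    constructor <;> linarith [hs.1, ht.2]
  have hf1 : f 1 = x := by
    rw [← hf0, eq_comm, hper]; exact ⟨1, by simp⟩
  set J := f ⁻¹' D ∩ Icc (0:ℝ) 1 with hJ
  have hJc : IsCompact J := (isCompact_Icc).inter_left (hDc.preimage hf)
  obtain ⟨y₁, hy₁, y₂, hy₂, hne⟩ := hD2
  obtain ⟨t₁, ht₁, rfl⟩ := hsurj y₁ (hDO hy₁)
  obtain ⟨t₂, ht₂, rfl⟩ := hsurj y₂ (hDO hy₂)
  have hJne : J.Nonempty := ⟨t₁, hy₁, ht₁⟩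
  obtain ⟨a, haJ, ha⟩ := hJc.exists_isLeast hJne
  obtain ⟨b, hbJ, hb⟩ := hJc.exists_isGreatest hJne
  have ha0 : 0 < a := lt_of_le_of_ne haJ.2.1 (by rintro rfl; exact hx.2 (hf0 ▸ haJ.1))
  have hb1 : b < 1 := lt_of_le_of_ne hbJ.2.2 (by rintro rfl; exact hx.2 (hf1 ▸ hbJ.1))
  have hab : a < b := by
    have h1 := ha ⟨hy₁, ht₁⟩
    have h2 := ha ⟨hy₂, ht₂⟩
    have h3 := hb ⟨hy₁, ht₁⟩
    have h4 := hb ⟨hy₂, ht₂⟩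
    rcases lt_or_gt_of_ne (fun h => hne (congrArg f h) : t₁ ≠ t₂) with h | h <;> linarith
  have hcl : ∀ u v, IsClosed (f '' Icc u v) := fun u v => (isCompact_Icc.image hf).isClosed
  have hmem : ∀ c ∈ Icc a b, f c ∈ D := by
    intro c hc
    obtain ⟨y, hyD, ⟨s, hs, hsy⟩, ⟨t, ht, hty⟩⟩ := isPreconnected_closed_iff.1 hD
      (f '' Icc 0 c) (f '' Icc c 1) (hcl _ _) (hcl _ _)
      (by
        intro y hy
        obtain ⟨t, ht, rfl⟩ := hsurj y (hDO hy)
        rcases le_total t c with h | h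
        · exact Or.inl ⟨t, ⟨ht.1, h⟩, rfl⟩
        · exact Or.inr ⟨t, ⟨h, ht.2⟩, rfl⟩)
      ⟨f a, haJ.1, a, ⟨ha0.le, hc.1⟩, rfl⟩ ⟨f b, hbJ.1, b, ⟨hc.2, hb1.le⟩, rfl⟩
    rcases (hs.2.trans ht.1).lt_or_eq with h | h
    · obtain ⟨rfl, rfl⟩ := hends s t ⟨hs.1, by linarith [hc.2, hs.2]⟩
        ⟨by linarith [ht.1, hc.1], ht.2⟩ h (hsy.trans hty.symm)
      exact absurd hyD (by rw [← hsy, hf0]; exact hx.2)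
    · have : s = c := le_antisymm hs.2 (h ▸ ht.1)
      rw [← this, hsy]; exact hyD
  have hsub : closure (O \ D) ⊆ f '' Icc 0 a ∪ f '' Icc b 1 := by
    refine closure_minimal ?_ ((hcl _ _).union (hcl _ _))
    rintro y ⟨hyO, hyD⟩
    obtain ⟨t, ht, rfl⟩ := hsurj y hyO
    rcases le_total t a with h | h
    · exact Or.inl ⟨t, ⟨ht.1, h⟩, rfl⟩
    · rcases le_total b t with h' | h'
      · exact Or.inr ⟨t, ⟨h', ht.2⟩, rfl⟩
      · exact absurd (hmem t ⟨h, h'⟩) hyD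
  refine ⟨subset_closure hx, fun hend => ?_⟩
  have hpt : ∀ t ∈ Ioo (0:ℝ) 1, t < a ∨ b < t → f t ∈ closure (O \ D) \ {x} := by
    intro t ht hta
    refine ⟨subset_closure ⟨hfO t, fun h => ?_⟩, fun h => ?_⟩
    · rcases hta with h' | h'
      · exact absurd (ha ⟨h, ht.1.le, ht.2.le⟩) (not_le.2 h')
      · exact absurd (hb ⟨h, ht.1.le, ht.2.le⟩) (not_le.2 h')
    · exact ht.2.ne (hends 0 t ⟨le_rfl, zero_le_one⟩ ⟨ht.1.le, ht.2.le⟩ ht.1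
        (hf0.trans h.symm)).2
  obtain ⟨y, ⟨-, hyx⟩, ⟨s, hs, hsy⟩, ⟨t, ht, hty⟩⟩ := isPreconnected_closed_iff.1 hend.2
    _ _ (hcl 0 a) (hcl b 1) (sdiff_subset.trans hsub)
    ⟨f (a / 2), hpt _ ⟨by linarith, by linarith⟩ (Or.inl (by linarith)), a / 2,
      ⟨by linarith, by linarith⟩, rfl⟩
    ⟨f ((1 + b) / 2), hpt _ ⟨by linarith, by linarith⟩ (Or.inr (by linarith)), (1 + b) / 2,
      ⟨by linarith, by linarith⟩, rfl⟩
  obtain ⟨rfl, -⟩ := hends s t ⟨hs.1, by linarith [hs.2]⟩ ⟨by linarith [ht.1], ht.2⟩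
    (by linarith [hs.2, ht.1]) (hsy.trans hty.symm)
  exact hyx (hsy ▸ hf0)

theorem IsCircleSet.image {O : Set S3} (hO : IsCircleSet O) {π : S3 → S3} (hπ : Continuous π)
    (hi : InjOn π O) : IsCircleSet (π '' O) := by
  obtain ⟨ψ⟩ := hO
  have : CompactSpace O := ψ.symm.compactSpace
  have hc : Continuous (Equiv.Set.imageOfInjOn π O hi) :=
    (hπ.comp continuous_subtype_val).subtype_mk _
  exact ⟨(hc.homeoOfEquivCompactToT2).symm.trans ψ⟩

theorem IsKnot.isCircleSet {K : Set S3} (hK : IsKnot K) : IsCircleSet K := by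
  obtain ⟨γ, -, hγ, rfl⟩ := hK
  exact ⟨hγ.toHomeomorph.symm⟩

theorem IsArcSet.isCompact {A : Set S3} (hA : IsArcSet A) : IsCompact A := by
  obtain ⟨ψ⟩ := hA
  have := ψ.symm.compactSpace
  exact isCompact_iff_compactSpace.2 this

theorem IsArcSet.isPreconnected {A : Set S3} (hA : IsArcSet A) : IsPreconnected A := by
  obtain ⟨ψ⟩ := hA
  have h := isPreconnected_range (continuous_subtype_val.comp ψ.symm.continuous)
  rwa [range_comp, ψ.symm.surjective.range_eq, image_univ, Subtype.range_coe] at h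

/-! ### Charts at corners of the boundary -/

theorem IsClosedCone.exists_smul {P : Set ℂ} (hP : IsClosedCone P) {Q : ℂ → Prop}
    (hQ : ∀ᶠ z in 𝓝 (0 : ℂ), z ∈ P → Q z) :
    ∃ r : ℝ, 0 < r ∧ r ≤ 1 ∧ ∀ z ∈ closedBall (0 : ℂ) 1 ∩ P, Q (r • z) := by
  obtain ⟨r, hr, h⟩ := Metric.eventually_nhds_iff_ball.1 hQ
  refine ⟨min (r / 2) 1, by positivity, min_le_right _ _, fun z hz => h _ ?_
    (hP.smul_mem _ (by positivity) z hz.2)⟩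
  have hz1 : ‖z‖ ≤ 1 := mem_closedBall_zero_iff.1 hz.1
  rw [mem_ball_zero_iff, norm_smul, Real.norm_of_nonneg (by positivity)]
  have h0 : (0 : ℝ) ≤ min (r / 2) 1 := by positivity
  calc min (r / 2) 1 * ‖z‖ ≤ min (r / 2) 1 * 1 := by gcongr
    _ < r := by linarith [min_le_left (r / 2) 1]

theorem IsChartAt.comp_conj {S : Set S3} {x : S3} {e : ℂ → S3} (he : IsChartAt S x rightHalf e) :
    IsChartAt S x rightHalf (fun z => e ((starRingEnd ℂ) z)) := by
  have hm : MapsTo (starRingEnd ℂ) (closedBall 0 1 ∩ rightHalf) (closedBall 0 1 ∩ rightHalf) := by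
    intro z hz
    refine ⟨?_, ?_⟩
    · rw [mem_closedBall_zero_iff, Complex.norm_conj]; exact mem_closedBall_zero_iff.1 hz.1
    · have : 0 ≤ z.re := hz.2
      exact this
  have him : (fun z => e ((starRingEnd ℂ) z)) '' (closedBall 0 1 ∩ rightHalf) =
      e '' (closedBall 0 1 ∩ rightHalf) := by
    ext y; constructor
    · rintro ⟨z, hz, rfl⟩; exact ⟨_, hm hz, rfl⟩
    · rintro ⟨z, hz, rfl⟩; exact ⟨_, hm hz, by simp⟩
  exact ⟨he.cont.comp Complex.continuous_conj.continuousOn hm,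
    he.inj.comp (star_injective.injOn) hm, by simpa using he.map_zero, by rw [him]; exact he.subset,
    by rw [him]; exact he.mem_nhds⟩

/-- A half-open segment in the disjoint union of two closed sets lies in one of them. -/
theorem forall_mem_or_forall_mem {A₁ A₂ : Set S3} (h₁ : IsClosed A₁) (h₂ : IsClosed A₂)
    {f : ℝ → S3} (hf : ContinuousOn f (Ioc 0 1)) (hA : ∀ t ∈ Ioc (0:ℝ) 1, f t ∈ A₁ ∪ A₂)
    (hd : ∀ t ∈ Ioc (0:ℝ) 1, f t ∈ A₁ → f t ∉ A₂) :
    (∀ t ∈ Ioc (0:ℝ) 1, f t ∈ A₁ ∧ f t ∉ A₂) ∨ ∀ t ∈ Ioc (0:ℝ) 1, f t ∈ A₂ ∧ f t ∉ A₁ := by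
  have hp := (isPreconnected_Ioc (a := (0:ℝ)) (b := 1)).image f hf
  rcases isPreconnected_iff_subset_of_disjoint_closed.1 hp A₁ A₂ h₁ h₂
    (by rintro _ ⟨t, ht, rfl⟩; exact hA t ht)
    (by
      rw [eq_empty_iff_forall_notMem]
      rintro _ ⟨⟨t, ht, rfl⟩, ha, hb⟩
      exact hd t ht ha hb) with h | h
  · exact Or.inl fun t ht => ⟨h ⟨t, ht, rfl⟩, hd t ht (h ⟨t, ht, rfl⟩)⟩
  · exact Or.inr fun t ht => ⟨h ⟨t, ht, rfl⟩, fun h' => hd t ht h' (h ⟨t, ht, rfl⟩)⟩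

/-- A chart at a point of the boundary where two boundary arcs meet. -/
theorem IsSurfaceWithBoundary.exists_isChartAt_corner {S A₁ A₂ : Set S3}
    (hS : IsSurfaceWithBoundary S (A₁ ∪ A₂)) (h₁ : IsClosed A₁) (h₂ : IsClosed A₂)
    (hfin : (A₁ ∩ A₂).Finite) {y : S3} (hy : y ∈ A₁ ∩ A₂)
    (hn₁ : ∀ U ∈ 𝓝 y, ∃ p ∈ A₁, p ∈ U ∧ p ≠ y) (hn₂ : ∀ U ∈ 𝓝 y, ∃ p ∈ A₂, p ∈ U ∧ p ≠ y) :
    ∃ e, IsChartAt S y rightHalf e ∧ ∀ z ∈ closedBall (0 : ℂ) 1 ∩ rightHalf,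
      (e z ∈ A₂ ↔ z.re = 0 ∧ z.im ≤ 0) := by
  obtain ⟨e₀, he₀⟩ := (hS.2.2.2.2 y (Or.inl hy.1)).exists_isChartAt
  have hev : ∀ᶠ z in 𝓝 (0 : ℂ), z ∈ rightHalf → (e₀ z ∈ A₁ → e₀ z ∈ A₂ → z = 0) := by
    have hU : ((A₁ ∩ A₂) \ {y})ᶜ ∈ 𝓝 (e₀ 0) := by
      rw [he₀.map_zero]
      exact (hfin.subset sdiff_subset).isClosed.isOpen_compl.mem_nhds (by simp)
    have := eventually_nhdsWithin_iff.1
      ((he₀.cont 0 isClosedCone_rightHalf.zero_mem_inter).eventually_mem hU)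
    filter_upwards [this, closedBall_mem_nhds (0 : ℂ) one_pos] with z hz hz1 hzP ha hb
    have hzy : e₀ z = y := by
      by_contra hne
      exact hz ⟨hz1, hzP⟩ ⟨⟨ha, hb⟩, hne⟩
    exact he₀.inj ⟨hz1, hzP⟩ isClosedCone_rightHalf.zero_mem_inter (hzy.trans he₀.map_zero.symm)
  obtain ⟨r, hr, hr1, hQ⟩ := isClosedCone_rightHalf.exists_smul
    (((hS.eventually_mem_iff he₀).and hev).mono fun z hz hzP => And.intro (hz.1 hzP) (hz.2 hzP))
  have he := he₀.scale isClosedCone_rightHalf hr hr1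
  set e : ℂ → S3 := fun z => e₀ (r • z) with hedef
  have hB : ∀ z ∈ closedBall (0 : ℂ) 1 ∩ rightHalf, (e z ∈ A₁ ∪ A₂ ↔ z.re = 0) := by
    intro z hz
    have := (hQ z hz).1
    rwa [Complex.smul_re, smul_eq_mul, mul_eq_zero, or_iff_right hr.ne'] at this
  have hdis : ∀ z ∈ closedBall (0 : ℂ) 1 ∩ rightHalf, e z ∈ A₁ → e z ∈ A₂ → z = 0 := by
    intro z hz ha hb
    simpa [hr.ne'] using (hQ z hz).2 ha hb
  have hexists : ∀ A : Set S3, A ⊆ A₁ ∪ A₂ → (∀ U ∈ 𝓝 y, ∃ p ∈ A, p ∈ U ∧ p ≠ y) →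
      ∃ z ∈ closedBall (0 : ℂ) 1 ∩ rightHalf, z.re = 0 ∧ z.im ≠ 0 ∧ e z ∈ A := by
    intro A hA hn
    obtain ⟨U, hU, hUS⟩ := mem_nhdsWithin_iff_exists_mem_nhds_inter.1 he.mem_nhds
    obtain ⟨p, hpA, hpU, hpy⟩ := hn U hU
    obtain ⟨z, hz, rfl⟩ := hUS ⟨hpU, hS.2.2.1 (hA hpA)⟩
    have hz0 := (hB z hz).1 (hA hpA)
    refine ⟨z, hz, hz0, fun him => hpy ?_, hpA⟩
    rw [show z = 0 from Complex.ext hz0 him]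
    exact he.map_zero
  have hmem : ∀ s : ℝ, |s| ≤ 1 → (⟨0, s⟩ : ℂ) ∈ closedBall (0 : ℂ) 1 ∩ rightHalf := by
    intro s hs
    refine ⟨?_, le_refl (0:ℝ)⟩
    rw [mem_closedBall_zero_iff, norm_le_one_iff]
    simpa [← sq, sq_le_one_iff_abs_le_one] using hs
  have hray : ∀ ε : ℝ, |ε| = 1 →
      (∀ t ∈ Ioc (0:ℝ) 1, e ⟨0, ε * t⟩ ∈ A₁ ∧ e ⟨0, ε * t⟩ ∉ A₂) ∨
      ∀ t ∈ Ioc (0:ℝ) 1, e ⟨0, ε * t⟩ ∈ A₂ ∧ e ⟨0, ε * t⟩ ∉ A₁ := by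
    intro ε hε
    have hm : ∀ t ∈ Ioc (0:ℝ) 1, (⟨0, ε * t⟩ : ℂ) ∈ closedBall (0 : ℂ) 1 ∩ rightHalf := by
      intro t ht
      apply hmem
      rw [abs_mul, hε, one_mul, abs_of_pos ht.1]; exact ht.2
    refine forall_mem_or_forall_mem h₁ h₂ (f := fun t => e ⟨0, ε * t⟩) ?_ ?_ ?_
    · refine he.cont.comp (Continuous.continuousOn ?_) hm
      exact Complex.equivRealProdCLM.symm.continuous.comp
        (continuous_const.prodMk (continuous_const.mul continuous_id))
    · intro t ht
      exact (hB _ (hm t ht)).2 rfl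
    · intro t ht ha hb
      have := congrArg Complex.im (hdis _ (hm t ht) ha hb)
      have hε0 : ε ≠ 0 := by rintro rfl; simp at hε
      simp [hε0, ht.1.ne'] at this
  have hpos : ∀ z : ℂ, z ∈ closedBall (0 : ℂ) 1 ∩ rightHalf → z.re = 0 → z.im ≠ 0 →
      (0 < z.im ∧ z.im ∈ Ioc (0:ℝ) 1 ∧ z = ⟨0, 1 * z.im⟩) ∨
      (z.im < 0 ∧ -z.im ∈ Ioc (0:ℝ) 1 ∧ z = ⟨0, (-1) * (-z.im)⟩) := by
    intro z hz hz0 hzi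
    have habs : |z.im| ≤ 1 := (Complex.abs_im_le_norm z).trans (mem_closedBall_zero_iff.1 hz.1)
    rcases lt_or_gt_of_ne hzi with h | h
    · refine Or.inr ⟨h, ⟨by linarith, by linarith [(abs_le.1 habs).1]⟩, Complex.ext hz0 (by simp)⟩
    · exact Or.inl ⟨h, ⟨h, (abs_le.1 habs).2⟩, Complex.ext hz0 (by simp)⟩
  obtain ⟨z₁, hz₁, hz₁r, hz₁i, hz₁A⟩ := hexists A₁ subset_union_left hn₁
  obtain ⟨z₂, hz₂, hz₂r, hz₂i, hz₂A⟩ := hexists A₂ subset_union_right hn₂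
  have hfinal : ∀ e' : ℂ → S3, (∀ z ∈ closedBall (0 : ℂ) 1 ∩ rightHalf, (e' z ∈ A₁ ∪ A₂ ↔ z.re = 0))
      → e' 0 = y → (∀ z ∈ closedBall (0 : ℂ) 1 ∩ rightHalf, z.re = 0 → 0 < z.im → e' z ∉ A₂) →
      (∀ z ∈ closedBall (0 : ℂ) 1 ∩ rightHalf, z.re = 0 → z.im < 0 → e' z ∈ A₂) →
      ∀ z ∈ closedBall (0 : ℂ) 1 ∩ rightHalf, (e' z ∈ A₂ ↔ z.re = 0 ∧ z.im ≤ 0) := by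
    intro e' hB' h0' hp hm z hz
    constructor
    · intro h
      have hz0 := (hB' z hz).1 (Or.inr h)
      exact ⟨hz0, not_lt.1 fun hi => hp z hz hz0 hi h⟩
    · rintro ⟨hz0, hi⟩
      rcases hi.lt_or_eq with hi | hi
      · exact hm z hz hz0 hi
      · rw [show z = 0 from Complex.ext hz0 hi, h0']; exact hy.2
  rcases hray 1 (by simp) with hu | hu <;> rcases hray (-1) (by simp) with hl | hl
  · exfalso
    rcases hpos z₂ hz₂ hz₂r hz₂i with ⟨-, h, h'⟩ | ⟨-, h, h'⟩
    · exact (hu _ h).2 (h' ▸ hz₂A)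
    · exact (hl _ h).2 (h' ▸ hz₂A)
  · refine ⟨e, he, hfinal e hB he.map_zero ?_ ?_⟩
    · intro z hz hz0 hi
      rcases hpos z hz hz0 hi.ne' with ⟨-, h, h'⟩ | ⟨hi', -⟩
      · rw [h']; exact (hu _ h).2
      · exact absurd hi hi'.not_gt
    · intro z hz hz0 hi
      rcases hpos z hz hz0 hi.ne with ⟨hi', -⟩ | ⟨-, h, h'⟩
      · exact absurd hi hi'.not_gt
      · rw [h']; exact (hl _ h).1
  · have hconj : ∀ z ∈ closedBall (0 : ℂ) 1 ∩ rightHalf,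
        (starRingEnd ℂ) z ∈ closedBall (0 : ℂ) 1 ∩ rightHalf := fun z hz =>
      ⟨by rw [mem_closedBall_zero_iff, Complex.norm_conj]; exact mem_closedBall_zero_iff.1 hz.1,
        hz.2⟩
    refine ⟨_, he.comp_conj, hfinal _ (fun z hz => hB _ (hconj z hz)) he.comp_conj.map_zero ?_ ?_⟩
    · intro z hz hz0 hi
      have hi2 : ((starRingEnd ℂ) z).im < 0 := by simpa using hi
      rcases hpos _ (hconj z hz) hz0 hi2.ne with ⟨hi', -⟩ | ⟨-, h, h'⟩
      · exact absurd hi2 hi'.not_gt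
      · rw [h']; exact (hl _ h).2
    · intro z hz hz0 hi
      have hi2 : 0 < ((starRingEnd ℂ) z).im := by simpa using hi
      rcases hpos _ (hconj z hz) hz0 hi2.ne' with ⟨-, h, h'⟩ | ⟨hi', -⟩
      · rw [h']; exact (hu _ h).1
      · exact absurd hi2 hi'.not_gt
  · exfalso
    rcases hpos z₁ hz₁ hz₁r hz₁i with ⟨-, h, h'⟩ | ⟨-, h, h'⟩
    · exact (hu _ h).2 (h' ▸ hz₁A)
    · exact (hl _ h).2 (h' ▸ hz₁A)

/-- The preimage of a connected set meeting the branch set is connected. -/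
theorem IsQuotProj.isConnected_preimage {h π : S3 → S3} (hπ : IsQuotProj h π) (hc : Continuous h)
    {S : Set S3} (hS : IsConnected S) (hSc : IsClosed S) {d : S3} (hd : h d = d) (hdS : π d ∈ S) :
    IsConnected (π ⁻¹' S) := by
  refine ⟨⟨d, hdS⟩, isPreconnected_closed_iff.2 ?_⟩
  have hclosed : IsClosed (π ⁻¹' S) := hSc.preimage hπ.continuous
  have key : ∀ u v : Set S3, IsClosed u → IsClosed v → π ⁻¹' S ⊆ u ∪ v → d ∈ u →
      (π ⁻¹' S ∩ v).Nonempty → (π ⁻¹' S ∩ (u ∩ v)).Nonempty := by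
    rintro u v hu hv huv hdu ⟨w, hwS, hwv⟩
    have hcv : IsClosed (π '' (π ⁻¹' S ∩ v)) := hπ.isClosedMap _ (hclosed.inter hv)
    have hcu : IsClosed (π '' ((π ⁻¹' S ∩ u) ∩ h ⁻¹' u)) :=
      hπ.isClosedMap _ ((hclosed.inter hu).inter (hu.preimage hc))
    obtain ⟨_, -, ⟨a, ⟨⟨haS, hau⟩, hha⟩, rfl⟩, ⟨b, ⟨hbS, hbv⟩, hab⟩⟩ :=
      isPreconnected_closed_iff.1 hS.isPreconnected _ _ hcu hcv
        (by
          intro y hy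
          obtain ⟨x, rfl⟩ := hπ.surjective y
          have hhx : h x ∈ π ⁻¹' S := by
            change π (h x) ∈ S; rw [hπ.map_h]; exact hy
          by_cases h1 : x ∈ v
          · exact Or.inr ⟨x, ⟨hy, h1⟩, rfl⟩
          by_cases h2 : h x ∈ v
          · exact Or.inr ⟨h x, ⟨hhx, h2⟩, hπ.map_h x⟩
          · exact Or.inl ⟨x, ⟨⟨hy, (huv hy).resolve_right h1⟩, (huv hhx).resolve_right h2⟩, rfl⟩)
        ⟨π d, hdS, d, ⟨⟨hdS, hdu⟩, by change h d ∈ u; rwa [hd]⟩, rfl⟩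
        ⟨π w, hwS, w, ⟨hwS, hwv⟩, rfl⟩
    refine ⟨b, hbS, ?_, hbv⟩
    rcases hπ.eq_iff.1 hab.symm with rfl | rfl
    · exact hau
    · exact hha
  intro u v hu hv huv hun hvn
  rcases huv (show d ∈ π ⁻¹' S from hdS) with h1 | h1
  · exact key u v hu hv huv h1 hvn
  · obtain ⟨w, hw, ha, hb⟩ := key v u hv hu (by rwa [union_comm]) h1 hun
    exact ⟨w, hw, hb, ha⟩

/-! ### The preimage of the surface -/

theorem IsCircleSet.isCompact {A : Set S3} (hA : IsCircleSet A) : IsCompact A := by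
  obtain ⟨ψ⟩ := hA
  exact isCompact_iff_compactSpace.2 ψ.symm.compactSpace

theorem IsCircleSet.isPreconnected {A : Set S3} (hA : IsCircleSet A) : IsPreconnected A := by
  obtain ⟨ψ⟩ := hA
  have h := isPreconnected_range (continuous_subtype_val.comp ψ.symm.continuous)
  rwa [range_comp, ψ.symm.surjective.range_eq, image_univ, Subtype.range_coe] at h

theorem IsPreconnected.exists_mem_ne {A : Set S3} (hA : IsPreconnected A) (hn : A.Nontrivial)
    {x : S3} (hx : x ∈ A) : ∀ U ∈ 𝓝 x, ∃ y ∈ A, y ∈ U ∧ y ≠ x := by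
  intro U hU
  obtain ⟨y, hy, hyx⟩ := accPt_iff_nhds.1 (hA.preperfect_of_nontrivial hn x hx) U hU
  exact ⟨y, hy.2, hy.1, hyx⟩

namespace MarkedSIK

variable {M : MarkedSIK} {π : S3 → S3} {Sq : Set S3}

theorem continuous_h (M : MarkedSIK) : Continuous M.h := M.smooth.continuous

theorem fixed_of_mem {x : S3} (hx : x ∈ M.δ) : M.h x = x := M.marking.1 hx

theorem mem_δ_of_fixed {x : S3} (hx : M.h x = x) (hK : x ∈ M.K) : x ∈ M.δ :=
  ((Set.ext_iff.1 M.marking.2.2 x).2 ⟨hx, hK⟩).1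

theorem h_mem_K {x : S3} (hx : x ∈ M.K) : M.h x ∈ M.K := M.invariant ▸ mem_image_of_mem _ hx

theorem mem_image_K (hπ : IsQuotProj M.h π) {x : S3} : π x ∈ π '' M.K ↔ x ∈ M.K := by
  refine ⟨?_, mem_image_of_mem π⟩
  rintro ⟨y, hy, hyx⟩
  rcases hπ.eq_iff.1 hyx with rfl | rfl
  · exact hy
  · exact h_mem_K hy

theorem mem_image_δ (hπ : IsQuotProj M.h π) {x : S3} : π x ∈ π '' M.δ ↔ x ∈ M.δ := by
  refine ⟨?_, mem_image_of_mem π⟩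
  rintro ⟨y, hy, hyx⟩
  rwa [hπ.eq_of_fixed (fixed_of_mem hy) hyx]

theorem exists_endpoints (M : MarkedSIK) :
    ∃ a b, a ≠ b ∧ a ∈ M.K ∧ b ∈ M.K ∧ a ∈ M.δ ∧ b ∈ M.δ := by
  obtain ⟨a, b, hab, h⟩ := ncard_eq_two.1 M.fixMeetsK
  have ha : a ∈ fixedPoints M.h ∩ M.K := h ▸ mem_insert _ _
  have hb : b ∈ fixedPoints M.h ∩ M.K := h ▸ mem_insert_of_mem _ rfl
  exact ⟨a, b, hab, ha.2, hb.2, mem_δ_of_fixed ha.1 ha.2, mem_δ_of_fixed hb.1 hb.2⟩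

theorem nontrivial_images (hπ : IsQuotProj M.h π) :
    (π '' M.K).Nontrivial ∧ (π '' M.δ).Nontrivial := by
  obtain ⟨a, b, hab, haK, hbK, haδ, hbδ⟩ := M.exists_endpoints
  have hne : π a ≠ π b := fun h => hab (hπ.eq_of_fixed (fixed_of_mem haδ) h).symm
  exact ⟨⟨_, mem_image_of_mem π haK, _, mem_image_of_mem π hbK, hne⟩,
    ⟨_, mem_image_of_mem π haδ, _, mem_image_of_mem π hbδ, hne⟩⟩

theorem isClosed_image_K (hπ : IsQuotProj M.h π) : IsClosed (π '' M.K) :=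
  (M.isKnot.isCircleSet.isCompact.image hπ.continuous).isClosed

theorem isClosed_image_δ (hπ : IsQuotProj M.h π) : IsClosed (π '' M.δ) :=
  (M.marking.2.1.isCompact.image hπ.continuous).isClosed

/-- A surface disjoint from the interior of the complementary arc meets the branch set in the
marked arc only. -/
theorem image_fixed_iff (hπ : IsQuotProj M.h π)
    (h2 : Sq ∩ arcInterior (closure ((π '' fixedPoints M.h) \ (π '' M.δ))) = ∅) {y : S3}
    (hy : y ∈ Sq) : y ∈ π '' fixedPoints M.h ↔ y ∈ π '' M.δ := by
  refine ⟨fun hO => ?_, fun h => image_mono M.marking.1 h⟩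
  by_contra hyδ
  have hi : InjOn π (fixedPoints M.h) := fun a ha b _ hab => (hπ.eq_of_fixed ha hab).symm
  exact eq_empty_iff_forall_notMem.1 h2 y ⟨hy, mem_arcInterior_closure_diff
    (M.fixCircle.image hπ.continuous hi) (image_mono M.marking.1) (isClosed_image_δ hπ)
    (M.marking.2.1.isPreconnected.image π hπ.continuous.continuousOn) (nontrivial_images hπ).2
    ⟨hO, hyδ⟩⟩

/-- The lifted chart at an interior point of the marked arc. -/
theorem exists_isChartAt_of_mem_δ (hπ : IsQuotProj M.h π)
    (h1 : IsSurfaceWithBoundary Sq (π '' M.K ∪ π '' M.δ))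
    (h2 : Sq ∩ arcInterior (closure ((π '' fixedPoints M.h) \ (π '' M.δ))) = ∅)
    {x : S3} (hx : x ∈ M.δ) (hxK : x ∉ M.K) :
    ∃ E, IsChartAt (π ⁻¹' Sq) x univ E ∧ ∀ z ∈ closedBall (0 : ℂ) 1,
      (M.h (E z) = E z ↔ z.re = 0) ∧ E (reflect z) = M.h (E z) := by
  obtain ⟨e₀, he₀⟩ := (h1.2.2.2.2 (π x) (Or.inr (mem_image_of_mem π hx))).exists_isChartAt
  have hev : ∀ᶠ z in 𝓝 (0 : ℂ), z ∈ rightHalf → e₀ z ∉ π '' M.K := by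
    have hU : (π '' M.K)ᶜ ∈ 𝓝 (e₀ 0) := by
      rw [he₀.map_zero]
      exact (isClosed_image_K hπ).isOpen_compl.mem_nhds fun h => hxK ((mem_image_K hπ).1 h)
    have := eventually_nhdsWithin_iff.1
      ((he₀.cont 0 isClosedCone_rightHalf.zero_mem_inter).eventually_mem hU)
    filter_upwards [this, closedBall_mem_nhds (0 : ℂ) one_pos] with z hz hz1 hzP
    exact hz ⟨hz1, hzP⟩
  obtain ⟨r, hr, hr1, hQ⟩ := isClosedCone_rightHalf.exists_smul
    (((h1.eventually_mem_iff he₀).and hev).mono fun z hz hzP => And.intro (hz.1 hzP) (hz.2 hzP))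
  have he := he₀.scale isClosedCone_rightHalf hr hr1
  refine hπ.exists_isChartAt_univ M.continuous_h M.involutive (fixed_of_mem hx) he fun z hz => ?_
  have hB := (hQ z hz).1
  rw [Complex.smul_re, smul_eq_mul, mul_eq_zero, or_iff_right hr.ne',
    mem_union, or_iff_right (hQ z hz).2] at hB
  rw [← hB]
  exact image_fixed_iff hπ h2 (he.subset ⟨z, hz, rfl⟩)

/-- The preimage of the spanning surface is a surface bounded by the knot. -/
theorem isSurfaceWithBoundary_preimage (hπ : IsQuotProj M.h π)
    (h1 : IsSurfaceWithBoundary Sq (π '' M.K ∪ π '' M.δ))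
    (h2 : Sq ∩ arcInterior (closure ((π '' fixedPoints M.h) \ (π '' M.δ))) = ∅) :
    IsSurfaceWithBoundary (π ⁻¹' Sq) M.K := by
  have hδS : π '' M.δ ⊆ Sq := subset_union_right.trans h1.2.2.1
  have hcl : IsClosed Sq := h1.1.isClosed
  obtain ⟨a, b, hab, haK, hbK, haδ, hbδ⟩ := M.exists_endpoints
  refine ⟨(hcl.preimage hπ.continuous).isCompact,
    hπ.isConnected_preimage M.continuous_h h1.2.1 hcl (fixed_of_mem haδ)
      (hδS (mem_image_of_mem π haδ)),
    fun x hx => h1.2.2.1 (Or.inl (mem_image_of_mem π hx)), ?_, ?_⟩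
  · rintro x ⟨hxS, hxK⟩
    by_cases hfix : M.h x = x
    · have hxδ : x ∈ M.δ := (mem_image_δ hπ).1
        ((image_fixed_iff hπ h2 hxS).1 (mem_image_of_mem π hfix))
      obtain ⟨E, hE, -⟩ := exists_isChartAt_of_mem_δ hπ h1 h2 hxδ hxK
      exact hE.isInteriorPointOf
    · have hxB : π x ∈ Sq \ (π '' M.K ∪ π '' M.δ) := by
        refine ⟨hxS, ?_⟩
        rintro (h | h)
        · exact hxK ((mem_image_K hπ).1 h)
        · exact hfix (fixed_of_mem ((mem_image_δ hπ).1 h))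
      obtain ⟨e, he⟩ := (h1.2.2.2.1 _ hxB).exists_isChartAt hxS
      obtain ⟨E, hE⟩ := hπ.exists_isChartAt_of_ne M.continuous_h hfix isClosedCone_univ he
      exact hE.isInteriorPointOf
  · intro x hxK
    by_cases hfix : M.h x = x
    · have hfin : (π '' M.K ∩ π '' M.δ).Finite := by
        have hf : (fixedPoints M.h ∩ M.K).Finite :=
          finite_of_ncard_ne_zero (by rw [M.fixMeetsK]; norm_num)
        refine (hf.image π).subset ?_
        rintro _ ⟨h, ⟨y, hy, rfl⟩⟩
        exact ⟨y, ⟨M.marking.1 hy, (mem_image_K hπ).1 h⟩, rfl⟩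
      have hxδ := mem_δ_of_fixed hfix hxK
      have hxπ := mem_image_of_mem π hxK
      have hxπ' := mem_image_of_mem π hxδ
      obtain ⟨e, he, hz⟩ := h1.exists_isChartAt_corner (isClosed_image_K hπ) (isClosed_image_δ hπ)
        hfin ⟨hxπ, hxπ'⟩
        ((M.isKnot.isCircleSet.isPreconnected.image π hπ.continuous.continuousOn).exists_mem_ne
          (nontrivial_images hπ).1 hxπ)
        ((M.marking.2.1.isPreconnected.image π hπ.continuous.continuousOn).exists_mem_ne
          (nontrivial_images hπ).2 hxπ')
      obtain ⟨E, hE⟩ := hπ.exists_isChartAt_rightHalf M.continuous_h M.involutive hfix he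
        fun z hz' => by
          rw [← hz z hz']
          exact image_fixed_iff hπ h2 (he.subset ⟨z, hz', rfl⟩)
      exact hE.isBoundaryPointOf
    · obtain ⟨e, he⟩ := (h1.2.2.2.2 _ (Or.inl (mem_image_of_mem π hxK))).exists_isChartAt
      obtain ⟨E, hE⟩ := hπ.exists_isChartAt_of_ne M.continuous_h hfix isClosedCone_rightHalf he
      exact hE.isBoundaryPointOf

end MarkedSIK

/-! ### Orientability of the preimage -/

/-- Under Condition (C) the preimage of the interior of the surface is oriented relative to the
surface, and the involution reverses the relative orientation. -/
theorem exists_relative_orientation {h π : S3 → S3} (hs : ContMDiff (𝓡 3) (𝓡 3) (⊤ : ℕ∞) h)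
    (hπ : IsQuotProj h π) (hh : Involutive h) (hfix : IsCircleSet (fixedPoints h))
    {S B : Set S3} (hS : IsSurfaceWithBoundary S B) (hO : S \ B ⊆ (π '' fixedPoints h)ᶜ)
    (hC : ConditionC (π '' fixedPoints h) S B) :
    ∃ o : OpenPartialHomeomorph ↥(S \ B) ℂ → S3 → ℤˣ,
      (∀ φ x (hx : π x ∈ S \ B), (⟨π x, hx⟩ : ↥(S \ B)) ∈ φ.source →
        ∀ᶠ x' in 𝓝[π ⁻¹' (S \ B)] x, o φ x' = o φ x) ∧
      (∀ φ ψ x (hx : π x ∈ S \ B), (⟨π x, hx⟩ : ↥(S \ B)) ∈ φ.source →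
        (⟨π x, hx⟩ : ↥(S \ B)) ∈ ψ.source →
        o ψ x = sdeg (ψ ∘ φ.symm) (φ ⟨π x, hx⟩) * o φ x) ∧
      (∀ φ x (hx : π x ∈ S \ B), (⟨π x, hx⟩ : ↥(S \ B)) ∈ φ.source → o φ (h x) = -o φ x) := by
  classical
  obtain ⟨σ, hσ⟩ := exists_section_prodCocycle hs hπ hh hfix hS hO hC
  have hcov := hπ.isDoubleCover hs.continuous
  have hne : ∀ x : ↥(π ⁻¹' (S \ B)), (x : S3) ∈ (fixedPoints h)ᶜ := fun x hx =>
    hO x.2 (mem_image_of_mem π hx)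
  let F : ↥(π ⁻¹' (S \ B)) → ↥(fixedPoints h)ᶜ := fun x => ⟨x, hne x⟩
  have hF : Continuous F := continuous_subtype_val.subtype_mk _
  let pS : ↥(π ⁻¹' (S \ B)) → ↥(S \ B) := fun x => ⟨π x, x.2⟩
  have hpS : Continuous pS := (hπ.continuous.comp continuous_subtype_val).subtype_mk _
  have hσ' := hσ.comp hpS
  have hl : (hcov.cocycle.comap (continuous_subtype_val :
      Continuous (Subtype.val : ↥(S \ B) → S3))).IsSection pS (hcov.lifted F) :=
    (SignCocycle.isSection_comap _).2 (hcov.isSection_lifted hF)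
  have hdom : ∀ a : ↥(π ⁻¹' (S \ B)), ∃ i, π a ∈ (hcov.chart i).target := fun a =>
    ⟨F a, hcov.mem_chart_target (F a)⟩
  obtain ⟨τ, hτ, hτe⟩ := SignCocycle.IsSection.div_left hpS hσ' hl hdom
  let o : OpenPartialHomeomorph ↥(S \ B) ℂ → S3 → ℤˣ := fun φ x =>
    if hx : x ∈ π ⁻¹' (S \ B) then τ φ ⟨x, hx⟩ else 1
  have ho : ∀ φ (a : ↥(π ⁻¹' (S \ B))), o φ a = τ φ a := fun φ a => dif_pos a.2
  refine ⟨o, ?_, ?_, ?_⟩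
  · intro φ x hx hφ
    have := hτ.locConst φ ⟨x, hx⟩ hφ
    rw [nhds_subtype_eq_comap_nhdsWithin, Filter.eventually_comap] at this
    filter_upwards [this, self_mem_nhdsWithin] with x' h1 h2
    exact (ho φ ⟨x', h2⟩).trans ((h1 ⟨x', h2⟩ rfl).trans (ho φ ⟨x, hx⟩).symm)
  · intro φ ψ x hx hφ hψ
    exact (ho ψ ⟨x, hx⟩).trans
      ((hτ.compat φ ψ ⟨x, hx⟩ hφ hψ).trans (by rw [← ho φ ⟨x, hx⟩]; rfl))
  · intro φ x hx hφ
    have hx' : h x ∈ π ⁻¹' (S \ B) := by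
      change π (h x) ∈ S \ B
      rw [hπ.map_h]; exact hx
    obtain ⟨i, hi⟩ := hdom ⟨x, hx⟩
    have hp : pS ⟨h x, hx'⟩ = pS ⟨x, hx⟩ := Subtype.ext (hπ.map_h x)
    have hi' : π (h x) ∈ (hcov.chart i).target := by rw [hπ.map_h]; exact hi
    have hφ' : pS ⟨h x, hx'⟩ ∈ φ.source := by rw [hp]; exact hφ
    have e1 := hτe i φ ⟨x, hx⟩ hi hφ
    have e2 := hτe i φ ⟨h x, hx'⟩ hi' hφ'
    have e3 : hcov.lifted F i ⟨h x, hx'⟩ = -hcov.lifted F i ⟨x, hx⟩ :=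
      hcov.lifted_neg (F := F) (G := F) (hπ.map_h x).symm
        (fun he => hne ⟨x, hx⟩ (congrArg Subtype.val he).symm) hi
    rw [ho φ ⟨h x, hx'⟩, ho φ ⟨x, hx⟩, e1, e2, hp, e3, mul_neg]

theorem GoodAt.comp_of_eventually {T T' : Type*} [TopologicalSpace T] [TopologicalSpace T']
    {f : ℂ → T} {z : ℂ} (hf : GoodAt f z) {g : T → T'} {s : Set T} (hs : ∀ᶠ z' in 𝓝 z, f z' ∈ s)
    (hg : ContinuousOn g s) (hgi : InjOn g s) : GoodAt (g ∘ f) z := by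
  obtain ⟨t, ht, hc, hi⟩ := goodAt_iff.1 hf
  exact goodAt_iff.2 ⟨t ∩ f ⁻¹' s, Filter.inter_mem ht hs,
    hg.comp (hc.mono inter_subset_left) fun _ h => h.2,
    hgi.comp (hi.mono inter_subset_left) fun _ h => h.2⟩

/-- A local embedding of the plane at `z` into the preimage of `W`. -/
def IsPatch (π : S3 → S3) (W : Set S3) (q : ℂ → S3) (z : ℂ) : Prop :=
  GoodAt q z ∧ ∀ᶠ z' in 𝓝 z, π (q z') ∈ W

theorem IsPatch.eventually {π : S3 → S3} {W : Set S3} {q : ℂ → S3} {z : ℂ} (h : IsPatch π W q z) :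
    ∀ᶠ z' in 𝓝 z, IsPatch π W q z' :=
  (h.1.eventually.and h.2.eventually_nhds).mono fun _ h => h

/-- Local embeddings of the plane in the lifted surface carry a sign, which the involution
reverses. -/
theorem exists_patch_sign {h π : S3 → S3} (hs : ContMDiff (𝓡 3) (𝓡 3) (⊤ : ℕ∞) h)
    (hπ : IsQuotProj h π) (hh : Involutive h) (hfix : IsCircleSet (fixedPoints h))
    {S B : Set S3} (hS : IsSurfaceWithBoundary S B) (hO : S \ B ⊆ (π '' fixedPoints h)ᶜ)
    (hC : ConditionC (π '' fixedPoints h) S B) :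
    ∃ s : (ℂ → S3) → ℂ → ℤˣ,
      (∀ q z, IsPatch π (S \ B) q z → ∀ᶠ z' in 𝓝 z, s q z' = s q z) ∧
      (∀ q T z, GoodAt T z → IsPatch π (S \ B) q (T z) → s (q ∘ T) z = s q (T z) * sdeg T z) ∧
      (∀ q q' z, IsPatch π (S \ B) q z → q =ᶠ[𝓝 z] q' → s q z = s q' z) ∧
      (∀ q z, IsPatch π (S \ B) q z → s (h ∘ q) z = -s q z) := by
  classical
  rcases isEmpty_or_nonempty ↥(S \ B) with hW | ⟨⟨w₀⟩⟩
  · have hno : ∀ q z, ¬ IsPatch π (S \ B) q z := fun q z hq => hW.elim ⟨_, hq.2.self_of_nhds⟩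
    exact ⟨fun _ _ => 1, by simp, fun q T z _ hq => absurd hq (hno _ _), by simp,
      fun q z hq => absurd hq (hno _ _)⟩
  obtain ⟨o, ho1, ho2, ho3⟩ := exists_relative_orientation hs hπ hh hfix hS hO hC
  choose φ hφ using hS.exists_chart
  let r : S3 → ↥(S \ B) := fun x => if hx : π x ∈ S \ B then ⟨π x, hx⟩ else w₀
  have hr : ∀ x (hx : π x ∈ S \ B), r x = ⟨π x, hx⟩ := fun x hx => dif_pos hx
  have hrc : ContinuousOn r (π ⁻¹' (S \ B)) := by
    rw [continuousOn_iff_continuous_domRestrict]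
    refine ((hπ.continuous.comp continuous_subtype_val).subtype_mk
      (fun x : ↥(π ⁻¹' (S \ B)) => x.2)).congr fun x => (hr x x.2).symm
  have hgood : ∀ q z, IsPatch π (S \ B) q z → GoodAt (r ∘ q) z := by
    intro q z hq
    have hz := hq.2.self_of_nhds
    obtain ⟨V, hV, hzV, hVi⟩ := hπ.exists_injOn hs.continuous
      (fun hf => hO hz (mem_image_of_mem π hf) : h (q z) ≠ q z)
    refine hq.1.comp_of_eventually (s := V ∩ π ⁻¹' (S \ B))
      ((hq.1.continuousAt.eventually_mem (hV.mem_nhds hzV)).and hq.2) (hrc.mono inter_subset_right) ?_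
    rintro a ⟨ha, ha'⟩ b ⟨hb, hb'⟩ hab
    rw [hr a ha', hr b hb'] at hab
    exact hVi ha hb (congrArg Subtype.val hab)
  let s : (ℂ → S3) → ℂ → ℤˣ := fun q z => sdeg (φ (r (q z)) ∘ (r ∘ q)) z * o (φ (r (q z))) (q z)
  have hs' : ∀ q z, IsPatch π (S \ B) q z → ∀ ψ : OpenPartialHomeomorph ↥(S \ B) ℂ,
      r (q z) ∈ ψ.source → s q z = sdeg (ψ ∘ (r ∘ q)) z * o ψ (q z) := by
    intro q z hq ψ hψ
    have hz := hq.2.self_of_nhds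
    have hrz := hr _ hz
    have h1 := hφ (r (q z))
    have e1 := sdeg_chart_change (hgood q z hq) (φ (r (q z))) ψ h1 hψ
    have e2 := ho2 (φ (r (q z))) ψ (q z) hz (by rw [← hrz]; exact h1) (by rw [← hrz]; exact hψ)
    rw [← hrz] at e2
    rw [e1, e2, comp_apply, mul_mul_mul_comm, Int.units_mul_self, one_mul]
  refine ⟨s, ?_, ?_, ?_, ?_⟩
  · intro q z hq
    have hz := hq.2.self_of_nhds
    have h1 := hφ (r (q z))
    have hev : ∀ᶠ z' in 𝓝 z, o (φ (r (q z))) (q z') = o (φ (r (q z))) (q z) :=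
      (tendsto_nhdsWithin_iff.2 ⟨hq.1.continuousAt, hq.2⟩).eventually
        (ho1 (φ (r (q z))) (q z) hz (by rw [← hr _ hz]; exact h1))
    filter_upwards [hq.eventually, hev, ((hgood q z hq).chart_comp _ h1).eventually_sdeg_eq,
      (hgood q z hq).continuousAt ((φ (r (q z))).open_source.mem_nhds h1)] with z' h2 h3 h4 h5
    rw [hs' q z' h2 _ h5, h3, h4]
  · intro q T z hT hq
    have h1 := (hgood q (T z) hq).chart_comp (φ (r (q (T z)))) (hφ _)
    have e := sdeg_comp hT h1
    change sdeg (φ (r (q (T z))) ∘ (r ∘ (q ∘ T))) z * _ = sdeg _ _ * _ * _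
    rw [mul_right_comm, ← e]
    rfl
  · intro q q' z hq hqq
    have hz : q z = q' z := hqq.self_of_nhds
    have e := sdeg_congr ((hgood q z hq).chart_comp (φ (r (q z))) (hφ _))
      (hqq.mono fun z' hz' => by
        change φ (r (q z)) (r (q z')) = φ (r (q z)) (r (q' z'))
        rw [hz'])
    change sdeg (φ (r (q z)) ∘ r ∘ q) z * o (φ (r (q z))) (q z) =
      sdeg (φ (r (q' z)) ∘ r ∘ q') z * o (φ (r (q' z))) (q' z)
    rw [← hz]
    exact congrArg (· * _) e
  · intro q z hq
    have hz := hq.2.self_of_nhds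
    have hrh : ∀ x, r (h x) = r x := fun x => by simp only [r, hπ.map_h]
    have hc : r ∘ h ∘ q = r ∘ q := funext fun z' => hrh (q z')
    have h1 := hφ (r (q z))
    have e := ho3 (φ (r (q z))) (q z) hz (by rw [← hr _ hz]; exact h1)
    change sdeg (φ (r (h (q z))) ∘ r ∘ h ∘ q) z * o (φ (r (h (q z)))) (h (q z)) = -(_ * _)
    rw [hc, hrh, e, mul_neg]

theorem reflect_eq : reflect = (fun w : ℂ => (-1) * w + 0) ∘ (starRingEnd ℂ) := by
  funext z
  apply Complex.ext <;> simp [reflect]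

theorem injective_reflect : Injective reflect := by
  intro a b h
  have h1 := congrArg Complex.re h
  have h2 := congrArg Complex.im h
  exact Complex.ext (neg_injective h1) h2

theorem sdeg_reflect (z : ℂ) : sdeg reflect z = -1 := by
  rw [reflect_eq, sdeg_comp, sdeg_affine (by norm_num), sdeg_conj, one_mul]
  · exact goodAt_of_injective Complex.continuous_conj (RingHom.injective _) z
  · exact goodAt_of_injective (by fun_prop) (fun a b h => by simpa using h) _

theorem norm_reflect (z : ℂ) : ‖reflect z‖ = ‖z‖ := by
  rw [reflect_eq, comp_apply, add_zero, neg_one_mul, norm_neg, Complex.norm_conj]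

/-- A sign which is locally constant on a dense subset of a connected set, coherently near every
point, is constant on that subset. -/
theorem IsPreconnected.exists_eq_of_coherent {Ω G : Set ℂ} (hΩ : IsPreconnected Ω) {s : ℂ → ℤˣ}
    (H : ∀ z₀ ∈ Ω, ∃ c, (∀ᶠ z in 𝓝 z₀, z ∈ G → s z = c) ∧ ∃ᶠ z in 𝓝 z₀, z ∈ G) :
    ∃ c, ∀ z ∈ Ω, z ∈ G → s z = c := by
  classical
  choose! c hc hf using H
  rcases Ω.eq_empty_or_nonempty with rfl | ⟨z₀, hz₀⟩
  · exact ⟨1, by simp⟩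
  have hcont : ContinuousOn c Ω := by
    intro z hz
    refine (continuousWithinAt_const (b := c z)).congr_of_eventuallyEq ?_ rfl
    filter_upwards [mem_nhdsWithin_of_mem_nhds (hc z hz).eventually_nhds, self_mem_nhdsWithin]
      with z' h1 h2
    obtain ⟨w, hw, hw1, hw2⟩ := ((hf z' h2).and_eventually (h1.and (hc z' h2))).exists
    rw [← hw2 hw, ← hw1 hw]
  exact ⟨c z₀, fun z hz hG => by
    rw [(hc z hz).self_of_nhds hG, hΩ.constant hcont hz₀ hz]⟩

/-- A locally constant sign on a connected open set is constant. -/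
theorem IsPreconnected.exists_eq_of_eventually {Ω : Set ℂ} (hΩ : IsPreconnected Ω) {s : ℂ → ℤˣ}
    (H : ∀ z₀ ∈ Ω, ∀ᶠ z in 𝓝 z₀, s z = s z₀) : ∃ c, ∀ z ∈ Ω, s z = c := by
  obtain ⟨c, hc⟩ := hΩ.exists_eq_of_coherent (G := univ) (s := s) fun z₀ hz₀ =>
    ⟨s z₀, (H z₀ hz₀).mono fun z hz _ => hz, (Filter.Eventually.of_forall mem_univ).frequently⟩
  exact ⟨c, fun z hz => hc z hz (mem_univ z)⟩

namespace MarkedSIK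

variable {M : MarkedSIK} {π : S3 → S3} {Sq : Set S3}

theorem mem_interior_iff (hπ : IsQuotProj M.h π) {x : S3} (hx : π x ∈ Sq) (hK : x ∉ M.K) :
    π x ∈ Sq \ (π '' M.K ∪ π '' M.δ) ↔ x ∉ M.δ := by
  rw [mem_sdiff, mem_union, mem_image_K hπ, mem_image_δ hπ]
  tauto

/-- The preimage of a spanning surface satisfying Condition (C) contains no Möbius band. -/
theorem orientable_preimage (hπ : IsQuotProj M.h π)
    (h1 : IsSurfaceWithBoundary Sq (π '' M.K ∪ π '' M.δ))
    (h2 : Sq ∩ arcInterior (closure ((π '' fixedPoints M.h) \ (π '' M.δ))) = ∅)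
    (h3 : ConditionC (π '' fixedPoints M.h) Sq (π '' M.K ∪ π '' M.δ)) :
    Orientable (π ⁻¹' Sq) := by
  rintro ⟨N, hN, ⟨e⟩⟩
  have hS := isSurfaceWithBoundary_preimage hπ h1 h2
  obtain ⟨q₀, hq₀, -⟩ := hS.exists_isStripMap (γ := ∅) (isBandMap_mobius.homeomorph e.symm) hN
    (by simp)
  set W := Sq \ (π '' M.K ∪ π '' M.δ) with hW
  have hO : W ⊆ (π '' fixedPoints M.h)ᶜ := fun y hy hyO =>
    hy.2 (Or.inr ((image_fixed_iff hπ h2 hy.1).1 hyO))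
  obtain ⟨s, hsl, hsc, hsg, hsh⟩ := exists_patch_sign M.smooth hπ M.involutive M.fixCircle h1 hO h3
  let q : ℂ → S3 := fun z => q₀ z
  have hqS : ∀ z, π (q z) ∈ Sq := fun z => (q₀ z).2.1
  have hqK : ∀ z, q z ∉ M.K := fun z => (q₀ z).2.2
  have hqg : ∀ z ∈ strip, GoodAt q z := fun z hz => (hq₀.good z hz).comp Filter.univ_mem
    continuous_subtype_val.continuousOn Subtype.val_injective.injOn
  have hqW : ∀ z, π (q z) ∈ W ↔ q z ∉ M.δ := fun z => mem_interior_iff hπ (hqS z) (hqK z)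
  have hδc : IsClosed M.δ := M.marking.2.1.isCompact.isClosed
  have hpatch : ∀ z ∈ strip, q z ∉ M.δ → IsPatch π W q z := fun z hz hzδ =>
    ⟨hqg z hz, ((hqg z hz).continuousAt.eventually_mem (hδc.isOpen_compl.mem_nhds hzδ)).mono
      fun z' hz' => (hqW z').2 hz'⟩
  have hlocal : ∀ z₀ ∈ strip, ∃ c, (∀ᶠ z in 𝓝 z₀, z ∈ {z | q z ∉ M.δ} → s q z = c) ∧
      ∃ᶠ z in 𝓝 z₀, z ∈ {z | q z ∉ M.δ} := by
    intro z₀ hz₀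
    by_cases hδ : q z₀ ∈ M.δ
    swap
    · exact ⟨s q z₀, (hsl q z₀ (hpatch z₀ hz₀ hδ)).mono fun z hz _ => hz,
        ((hqg z₀ hz₀).continuousAt.eventually_mem (hδc.isOpen_compl.mem_nhds hδ)).frequently⟩
    obtain ⟨E, hE, hEh⟩ := exists_isChartAt_of_mem_δ hπ h1 h2 hδ (hqK z₀)
    have hDu : closedBall (0 : ℂ) 1 ∩ univ = closedBall 0 1 := inter_univ _
    have hEc := hDu ▸ hE.cont
    have hEi := hDu ▸ hE.inj
    have hES : ∀ w ∈ closedBall (0 : ℂ) 1, π (E w) ∈ Sq := fun w hw =>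
      hE.subset ⟨w, ⟨hw, mem_univ w⟩, rfl⟩
    have hEgood : ∀ w ∈ ball (0 : ℂ) 1, GoodAt E w := fun w hw => goodAt_iff.2
      ⟨ball 0 1, isOpen_ball.mem_nhds hw, hEc.mono ball_subset_closedBall,
        hEi.mono ball_subset_closedBall⟩
    have hEW : ∀ w ∈ ball (0 : ℂ) 1, (π (E w) ∈ W ↔ w.re ≠ 0) := by
      intro w hw
      have hwc := ball_subset_closedBall hw
      have hK : E w ∉ M.K := hS.not_goodAt (hEgood w hw)
        ((isOpen_ball.eventually_mem hw).mono fun w' hw' => hES w' (ball_subset_closedBall hw'))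
      rw [mem_interior_iff hπ (hES w hwc) hK, ← mem_image_δ hπ, ← image_fixed_iff hπ h2 (hES w hwc),
        hπ.mem_image_fixed, (hEh w hwc).1]
    have hEp : ∀ w ∈ ball (0 : ℂ) 1, w.re ≠ 0 → IsPatch π W E w := fun w hw hr => ⟨hEgood w hw, by
      filter_upwards [isOpen_ball.eventually_mem hw,
        Complex.continuous_re.continuousAt.eventually_ne hr] with w' h h'
      exact (hEW w' h).2 h'⟩
    have href : ∀ w ∈ ball (0 : ℂ) 1, w.re ≠ 0 → s E (reflect w) = s E w := by
      intro w hw hr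
      have hw' : reflect w ∈ ball (0 : ℂ) 1 := by
        rw [mem_ball_zero_iff, norm_reflect]; exact mem_ball_zero_iff.1 hw
      have hr' : (reflect w).re ≠ 0 := neg_ne_zero.2 hr
      have hgr : GoodAt reflect w := goodAt_of_injective continuous_reflect injective_reflect w
      have e1 := hsc E reflect w hgr (hEp _ hw' hr')
      have e2 := hsh E w (hEp w hw hr)
      have hpr : IsPatch π W (M.h ∘ E) w :=
        ⟨(hEgood w hw).comp Filter.univ_mem M.continuous_h.continuousOn M.involutive.injective.injOn,
          (hEp w hw hr).2.mono fun w' h => by rw [comp_apply, hπ.map_h]; exact h⟩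
      have e3 := hsg (M.h ∘ E) (E ∘ reflect) w hpr
        ((isOpen_ball.eventually_mem hw).mono fun w' hw' =>
          (hEh w' (ball_subset_closedBall hw')).2.symm)
      rw [e2, e1, sdeg_reflect, mul_neg, mul_one] at e3
      exact (neg_injective e3).symm
    obtain ⟨c₀, hc₀⟩ : ∃ c, ∀ w ∈ ball (0 : ℂ) 1 ∩ {w | 0 < w.re}, s E w = c :=
      ((convex_ball 0 1).inter (convex_halfSpace_re_gt 0)).isPreconnected.exists_eq_of_eventually
        fun w hw => hsl E w (hEp w hw.1 (ne_of_gt hw.2))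
    have hc : ∀ w ∈ ball (0 : ℂ) 1, w.re ≠ 0 → s E w = c₀ := by
      intro w hw hr
      rcases lt_or_gt_of_ne hr with h | h
      · rw [← href w hw hr]
        refine hc₀ _ ⟨?_, neg_pos.2 h⟩
        rw [mem_ball_zero_iff, norm_reflect]; exact mem_ball_zero_iff.1 hw
      · exact hc₀ w ⟨hw, h⟩
    let D := closedBall (0 : ℂ) 1
    let u : ℂ → ℂ := invFunOn E D ∘ q
    have hqN : ∀ᶠ z in 𝓝 z₀, q z ∈ E '' D := by
      have := (tendsto_nhdsWithin_iff.2 ⟨(hqg z₀ hz₀).continuousAt,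
        Filter.Eventually.of_forall hqS⟩).eventually (hDu ▸ hE.mem_nhds)
      exact this
    have hug : GoodAt u z₀ := (hqg z₀ hz₀).comp_of_eventually hqN
      (ContinuousOn.continuousOn_invFunOn (isCompact_closedBall 0 1) hEc hEi)
      (fun a ha b hb hab => by
        rw [← (invFunOn_mem_of_mem ha).2, hab, (invFunOn_mem_of_mem hb).2])
    have hu0 : u z₀ = 0 := by
      have h0 : (0 : ℂ) ∈ D := by simp [D]
      change invFunOn E D (q z₀) = 0
      rw [← hE.map_zero]
      exact hEi.leftInvOn_invFunOn h0
    have huball : ∀ᶠ z in 𝓝 z₀, u z ∈ ball (0 : ℂ) 1 :=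
      hug.continuousAt.eventually_mem (isOpen_ball.mem_nhds (by rw [hu0]; simp))
    have huδ : ∀ᶠ z in 𝓝 z₀, (q z ∉ M.δ ↔ (u z).re ≠ 0) := by
      filter_upwards [hqN, huball] with z h h'
      rw [← hEW _ h', ← hqW, show E (u z) = q z from (invFunOn_mem_of_mem h).2]
    refine ⟨c₀ * sdeg u z₀, ?_, fun hno => ?_⟩
    · filter_upwards [hqN.eventually_nhds, huball, huδ, hug.eventually, hug.eventually_sdeg_eq,
        isOpen_strip.eventually_mem hz₀] with z h4 h5 h6 h7 h8 h9 hz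
      have hre := h6.1 hz
      rw [hsg q (E ∘ u) z (hpatch z h9 hz) (h4.mono fun z' h => (invFunOn_mem_of_mem h).2.symm),
        hsc E u z h7 (hEp _ h5 hre), hc _ h5 hre, h8]
    · refine hug.not_eventually_re_nonneg (by rw [hu0]; rfl) ?_
      filter_upwards [hno, huδ] with z h h'
      exact (not_not.1 fun h0 => h (h'.2 h0)).ge
  obtain ⟨c, hc⟩ := isPreconnected_strip.exists_eq_of_coherent hlocal
  obtain ⟨-, -, hfr⟩ := hlocal 0 zero_mem_strip
  obtain ⟨z, hzδ, hz⟩ := (hfr.and_eventually (isOpen_strip.eventually_mem zero_mem_strip)).exists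
  have hshift : ∀ z ∈ strip, q (stripShift (-1) 1 z) = q z := fun z hz =>
    congrArg Subtype.val (hq₀.shift hz 1)
  have hz' : stripShift (-1) 1 z ∈ strip := stripShift_mem hz
  have hzδ' : q (stripShift (-1) 1 z) ∉ M.δ := by rw [hshift z hz]; exact hzδ
  have e1 := hsg q (q ∘ stripShift (-1) 1) z (hpatch z hz hzδ)
    ((isOpen_strip.eventually_mem hz).mono fun z' h => (hshift z' h).symm)
  rw [hsc q _ z (goodAt_stripShift (-1) 1 z) (hpatch _ hz' hzδ'), hc _ hz' hzδ', hc z hz hzδ,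
    sdeg_stripShift, mul_neg, mul_one] at e1
  exact neg_ne_self_units c e1.symm

end MarkedSIK

/-- Conversely, if `Š` is a spanning surface for the constituent knot
`Ǩ = k ∪ δ̌` in `S³/h ≅ S³`, disjoint from the interior of `δ̌ᶜ` and satisfying Condition
(C), then `π⁻¹(Š)` is an invariant Seifert surface for `(K,h,δ)`. -/
theorem lift_of_spanning_surface_is_invariant_Seifert_surface (M : MarkedSIK)
    (π : S3 → S3) (hπ : IsQuotProj M.h π) (Sq : Set S3)
    (h1 : IsSurfaceWithBoundary Sq (π '' M.K ∪ π '' M.δ))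
    (h2 : Sq ∩ arcInterior (closure ((π '' Function.fixedPoints M.h) \ (π '' M.δ))) = ∅)
    (h3 : ConditionC (π '' Function.fixedPoints M.h) Sq (π '' M.K ∪ π '' M.δ)) :
    IsInvariantSeifertSurface M.K M.h M.δ (π ⁻¹' Sq) := by
  refine ⟨⟨MarkedSIK.isSurfaceWithBoundary_preimage hπ h1 h2,
    MarkedSIK.orientable_preimage hπ h1 h2 h3⟩, ?_, ?_⟩
  · have hsub : M.h '' (π ⁻¹' Sq) ⊆ π ⁻¹' Sq := by
      rintro _ ⟨x, hx, rfl⟩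
      rw [mem_preimage, hπ.map_h]; exact hx
    exact hsub.antisymm fun x hx => ⟨M.h x, hsub ⟨x, hx, rfl⟩, M.involutive x⟩
  · ext x
    constructor
    · rintro ⟨hx, hxS⟩
      exact (MarkedSIK.mem_image_δ hπ).1
        ((MarkedSIK.image_fixed_iff hπ h2 hxS).1 (mem_image_of_mem π hx))
    · intro hx
      exact ⟨M.marking.1 hx, h1.2.2.1 (Or.inr (mem_image_of_mem π hx))⟩

end
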